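/- Suppose aₙ → ∞, tₙ := m⁻¹(aₙ), and ψ(tₙ)²/(√n·ψ′(tₙ)) → 0 as n → ∞. Define Hₙ(u) := √n·exp(−n·I(u))/(√(2π)·s(m⁻¹(u))). Then sup_{u > aₙ} of the ratio of the density of Sₙ/n at u (namely n·p^{*n}(n·u)) to Hₙ(u) equals 1 + o(1/√n) as n → ∞. -/

import Mathlib

open Real Filter Topology MeasureTheory Set

noncomputable section

/-- A representation of a function `l` in class `R₀`:
`l x = exp (∫_1^x ε u / u du)` for `x ≥ 1`, where `ε` is twice differentiable
(with first and second derivatives `ε'`, `ε''`) and `ε x → 0` as `x → ∞`. -/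
def IsR0Rep (l ε ε' ε'' : ℝ → ℝ) : Prop :=
  (∀ x, HasDerivAt ε (ε' x) x) ∧ (∀ x, HasDerivAt ε' (ε'' x) x) ∧
    Tendsto ε atTop (𝓝 0) ∧
    ∀ x ≥ (1 : ℝ), l x = Real.exp (∫ u in (1:ℝ)..x, ε u / u)

/-- The generalized inverse `ψ u = inf {x | h x ≥ u}` of `h`. -/
def geninv (h : ℝ → ℝ) (u : ℝ) : ℝ := sInf {x : ℝ | u ≤ h x}

/-- Class `R_β` (`β > 0`): `h x = x ^ β * l x` for large `x`, with `l ∈ R₀` whose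
representing `ε` satisfies `limsup x * |ε' x| < ∞` and `limsup x ^ 2 * |ε'' x| < ∞`. -/
def MemRbeta (h : ℝ → ℝ) (β : ℝ) : Prop :=
  0 < β ∧ ∃ l ε ε' ε'' : ℝ → ℝ, IsR0Rep l ε ε' ε'' ∧
    (∀ᶠ x in atTop, h x = x ^ β * l x) ∧
    (∃ C : ℝ, ∀ᶠ x in atTop, x * |ε' x| ≤ C) ∧
    (∃ C : ℝ, ∀ᶠ x in atTop, x ^ (2 : ℕ) * |ε'' x| ≤ C)

/-- Class `R_∞`: `h` is increasing and strictly monotone and its generalized inverse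
`ψ` satisfies `ψ x = exp (∫_1^x ε u / u du)` with `ψ x → ∞`, `x ε' x / ε x → 0`,
`x ^ 2 ε'' x / ε x → 0` and `liminf x ^ η * ε x > 0` for some `η ∈ (0, 1/4)`. -/
def MemRinfty (h : ℝ → ℝ) : Prop :=
  StrictMonoOn h (Set.Ici 0) ∧
  ∃ ε ε' ε'' : ℝ → ℝ,
    (∀ x, HasDerivAt ε (ε' x) x) ∧ (∀ x, HasDerivAt ε' (ε'' x) x) ∧
    (∀ x ≥ (1 : ℝ), geninv h x = Real.exp (∫ u in (1:ℝ)..x, ε u / u)) ∧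
    Tendsto (geninv h) atTop atTop ∧
    Tendsto (fun x => x * ε' x / ε x) atTop (𝓝 0) ∧
    Tendsto (fun x => x ^ (2 : ℕ) * ε'' x / ε x) atTop (𝓝 0) ∧
    ∃ η : ℝ, η ∈ Set.Ioo (0 : ℝ) (1/4) ∧ ∃ c > (0 : ℝ), ∀ᶠ x in atTop, c ≤ x ^ η * ε x

/-- The class `𝔯 = R_β ∪ R_∞`. -/
def MemFrakR (h : ℝ → ℝ) : Prop := (∃ β : ℝ, MemRbeta h β) ∨ MemRinfty h

/-- The moment generating function `Φ t = ∫_0^∞ e^{t x} p x dx`. -/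
def mgfFun (p : ℝ → ℝ) (t : ℝ) : ℝ := ∫ x in Set.Ici (0:ℝ), Real.exp (t * x) * p x

/-- `m = (log Φ)'`, the mean of the tilted density. -/
def mFun (p : ℝ → ℝ) : ℝ → ℝ := deriv fun t => Real.log (mgfFun p t)

/-- `s² = m'`, the variance of the tilted density. -/
def s2Fun (p : ℝ → ℝ) : ℝ → ℝ := deriv (mFun p)

/-- `μ₃ = (log Φ)'''`, the third centered moment of the tilted density. -/
def mu3Fun (p : ℝ → ℝ) : ℝ → ℝ := deriv (s2Fun p)

/-- The tilted density `π^a x = e^{t x} p x / Φ t` (with `t` the tilting parameter). -/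
def tilt (p : ℝ → ℝ) (t x : ℝ) : ℝ := Real.exp (t * x) * p x / mgfFun p t

/-- `convPow f n` is the `n`-fold convolution of the density `f` with itself. -/
def convPow (f : ℝ → ℝ) : ℕ → ℝ → ℝ
  | 0 => fun _ => 0
  | 1 => f
  | n + 2 => fun x => ∫ y : ℝ, f y * convPow f (n + 1) (x - y)

section Auxiliary

open scoped FourierTransform Convolution

/-- Convolution of an integrable function with a bounded integrable one is continuous. -/
lemma continuous_convolution_of_bounded {f g : ℝ → ℂ} (hf : Integrable f) (hg : Integrable g)
    {M : ℝ} (hM : ∀ x, ‖g x‖ ≤ M) :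
    Continuous (f ⋆[ContinuousLinearMap.mul ℂ ℂ] g) := by
  have hM0 : 0 ≤ M := (norm_nonneg _).trans (hM 0)
  have hex : ∀ k : ℕ, ∃ F : ℝ → ℂ, HasCompactSupport F ∧
      (∫ x, ‖f x - F x‖) ≤ 1 / ((k : ℝ) + 1) ∧ Continuous F ∧ Integrable F := fun k =>
    hf.exists_hasCompactSupport_integral_sub_le (by positivity)
  choose F hF1 hF2 hF3 hF4 using hex
  have hunif : TendstoUniformly (fun k => F k ⋆[ContinuousLinearMap.mul ℂ ℂ] g)
      (f ⋆[ContinuousLinearMap.mul ℂ ℂ] g) atTop := by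
    rw [Metric.tendstoUniformly_iff]
    intro ε hε
    have h0 : Tendsto (fun k : ℕ => 1 / ((k : ℝ) + 1) * M) atTop (𝓝 (0 * M)) :=
      tendsto_one_div_add_atTop_nhds_zero_nat.mul_const M
    rw [zero_mul] at h0
    filter_upwards [h0.eventually (gt_mem_nhds hε)] with k hk x
    have hb : ∀ {u : ℝ → ℂ}, Integrable u → Integrable (fun y => u y * g (x - y)) := by
      intro u hu
      refine hu.mul_bdd (c := M) ?_ (Eventually.of_forall fun y => hM _)
      exact (hg.comp_sub_left x).aestronglyMeasurable
    rw [dist_eq_norm]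
    refine lt_of_le_of_lt ?_ hk
    simp only [convolution_def, ContinuousLinearMap.mul_apply']
    rw [← integral_sub (hb hf) (hb (hF4 k))]
    calc ‖∫ y, (f y * g (x - y) - F k y * g (x - y))‖
        ≤ ∫ y, ‖f y - F k y‖ * M := by
          refine norm_integral_le_of_norm_le ((hf.sub (hF4 k)).norm.mul_const M) ?_
          refine Eventually.of_forall fun y => ?_
          rw [← sub_mul, norm_mul]
          exact mul_le_mul_of_nonneg_left (hM _) (norm_nonneg _)
      _ ≤ 1 / ((k : ℝ) + 1) * M := by
          rw [integral_mul_const]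
          exact mul_le_mul_of_nonneg_right (hF2 k) hM0
  refine hunif.continuous (Eventually.frequently (Eventually.of_forall fun k => ?_))
  exact (hF1 k).continuous_convolution_left _ (hF3 k) hg.locallyIntegrable

/-- Fourier inversion for a convolution of integrable functions, one of them bounded. -/
lemma convolution_eq_fourierInv {f g : ℝ → ℂ} (hf : Integrable f) (hg : Integrable g)
    {M : ℝ} (hM : ∀ x, ‖g x‖ ≤ M) (hfg : Integrable (fun w => 𝓕 f w * 𝓕 g w)) (x : ℝ) :
    (∫ y, f y * g (x - y)) = 𝓕⁻ (fun w => 𝓕 f w * 𝓕 g w) x := by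
  have hc := continuous_convolution_of_bounded hf hg hM
  have hF : 𝓕 (f ⋆[ContinuousLinearMap.mul ℂ ℂ] g) = fun w => 𝓕 f w * 𝓕 g w := by
    ext w
    exact Real.fourier_mul_convolution_eq hf hg w
  have hi : Integrable (f ⋆[ContinuousLinearMap.mul ℂ ℂ] g) := hf.integrable_convolution _ hg
  have h2 := hi.fourierInv_fourier_eq (by rw [hF]; exact hfg) (v := x) hc.continuousAt
  rw [hF] at h2
  rw [h2]
  simp [convolution_def]

lemma norm_fourier_le_integral (f : ℝ → ℂ) (w : ℝ) : ‖𝓕 f w‖ ≤ ∫ x, ‖f x‖ :=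
  VectorFourier.norm_fourierIntegral_le_integral_norm _ _ _ _ _

lemma continuous_fourier {f : ℝ → ℂ} (hf : Integrable f) : Continuous (𝓕 f) :=
  VectorFourier.fourierIntegral_continuous Real.continuous_fourierChar
    (by exact continuous_inner) hf

/-- Convolving an inverse Fourier transform. -/
lemma integral_mul_fourierInv_sub {f r : ℝ → ℂ} (hf : Integrable f) (hr : Integrable r) (x : ℝ) :
    (∫ y, f y * 𝓕⁻ r (x - y)) = 𝓕⁻ (fun w => 𝓕 f w * r w) x := by
  simp only [Real.fourierInv_eq', Real.fourier_eq', smul_eq_mul]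
  have h1 : ∀ y, f y * ∫ v : ℝ, Complex.exp (↑(2 * π * inner ℝ v (x - y)) * Complex.I) * r v =
      ∫ v : ℝ, Complex.exp (↑(2 * π * inner ℝ v (x - y)) * Complex.I) * (f y * r v) := by
    intro y
    rw [← integral_const_mul]
    congr 1; ext v; ring
  simp_rw [h1]
  rw [integral_integral_swap]
  · congr 1; ext w
    rw [← integral_mul_const, ← integral_const_mul]
    congr 1; ext y
    rw [show Complex.exp (↑(2 * π * inner ℝ w (x - y)) * Complex.I) =
      Complex.exp (↑(2 * π * inner ℝ w x) * Complex.I) *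
        Complex.exp (↑(-2 * π * inner ℝ y w) * Complex.I) by
      rw [← Complex.exp_add]; congr 1; simp; ring]
    ring
  · refine (hf.mul_prod hr).bdd_mul (c := 1) ?_ ?_
    · apply Continuous.aestronglyMeasurable
      fun_prop
    · refine Eventually.of_forall fun z => ?_
      simp only [Complex.norm_exp_ofReal_mul_I, le_refl]

/-- The Fourier transform of a bounded integrable real function is square integrable. -/
lemma integrable_norm_fourier_sq {g : ℝ → ℝ} (hg : Integrable g) {M : ℝ} (hM : ∀ x, |g x| ≤ M) :
    Integrable (fun w => ‖𝓕 (fun x => (g x : ℂ)) w‖ ^ 2) ∧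
      ∫ w, ‖𝓕 (fun x => (g x : ℂ)) w‖ ^ 2 ≤ M * ∫ x, |g x| := by
  set G : ℝ → ℂ := fun x => (g x : ℂ) with hG
  set G' : ℝ → ℂ := fun x => (g (-x) : ℂ) with hG'
  have hGi : Integrable G := hg.ofReal
  have hGi' : Integrable G' := hGi.comp_neg
  have hM0 : 0 ≤ M := (abs_nonneg _).trans (hM 0)
  have hF' : ∀ w, 𝓕 G' w = (starRingEnd ℂ) (𝓕 G w) := by
    intro w
    rw [Real.fourier_eq', Real.fourier_eq', ← integral_conj]
    rw [← integral_neg_eq_self]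
    congr 1; ext x
    simp only [hG, hG', smul_eq_mul, map_mul, ← Complex.exp_conj, Complex.conj_ofReal,
      Complex.conj_I, neg_neg]
    congr 2
    simp
  set W : ℝ → ℂ := G ⋆[ContinuousLinearMap.mul ℂ ℂ] G' with hW
  have hWi : Integrable W := hGi.integrable_convolution _ hGi'
  have hFW : ∀ w, 𝓕 W w = ((‖𝓕 G w‖ ^ 2 : ℝ) : ℂ) := by
    intro w
    rw [hW, Real.fourier_mul_convolution_eq hGi hGi' w, hF', Complex.mul_conj,
      Complex.normSq_eq_norm_sq]
  have hWb : ∀ x, ‖W x‖ ≤ M * ∫ x, |g x| := by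
    intro x
    rw [hW, convolution_def]
    rw [← integral_const_mul]
    refine norm_integral_le_of_norm_le (hg.abs.const_mul M) (Eventually.of_forall fun y => ?_)
    simp only [ContinuousLinearMap.mul_apply', norm_mul, hG, hG', Complex.norm_real,
      Real.norm_eq_abs]
    rw [mul_comm]
    exact mul_le_mul_of_nonneg_right (hM _) (abs_nonneg _)
  have hcont : Continuous (𝓕 G) := continuous_fourier hGi
  set C := M * ∫ x, |g x| with hC
  have hC0 : 0 ≤ C := mul_nonneg hM0 (integral_nonneg fun _ => abs_nonneg _)
  have hgauss : ∀ k : ℕ, (∫⁻ w, ENNReal.ofReal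
      (Real.exp (-π * (1 / ((k : ℝ) + 1)) * w ^ 2) * ‖𝓕 G w‖ ^ 2)) ≤ ENNReal.ofReal C := by
    intro k
    set b : ℝ := 1 / ((k : ℝ) + 1) with hb
    have hb0 : 0 < b := by positivity
    have hbint : Integrable (fun w : ℝ => Complex.exp (-π * (b : ℂ) * w ^ 2)) := by
      have := integrable_cexp_neg_mul_sq (b := (π * b : ℂ)) (by
        rw [← Complex.ofReal_mul, Complex.ofReal_re]; positivity)
      simpa using this
    have key := VectorFourier.integral_fourierIntegral_smul_eq_flip (L := innerₗ ℝ)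
      (μ := volume) (ν := volume) Real.continuous_fourierChar
      (by exact continuous_inner) hbint hWi
    have e1 : VectorFourier.fourierIntegral Real.fourierChar volume (innerₗ ℝ)
        (fun w : ℝ => Complex.exp (-π * (b : ℂ) * w ^ 2)) =
        𝓕 (fun w : ℝ => Complex.exp (-π * (b : ℂ) * w ^ 2)) := rfl
    have e2 : VectorFourier.fourierIntegral Real.fourierChar volume (innerₗ ℝ).flip W = 𝓕 W := by
      ext w
      rw [flip_innerₗ]; rfl
    rw [e1, e2, fourier_gaussian_pi (by simpa using hb0)] at key
    have hreal : ∀ w, Real.exp (-π * b * w ^ 2) * ‖𝓕 G w‖ ^ 2 =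
        ‖Complex.exp (-π * (b : ℂ) * w ^ 2) • 𝓕 W w‖ := by
      intro w
      rw [hFW, norm_smul, Complex.norm_real, Complex.norm_exp]
      rw [Real.norm_of_nonneg (by positivity)]
      congr 2
      rw [show (-π * (b : ℂ) * w ^ 2) = ((-π * b * w ^ 2 : ℝ) : ℂ) by push_cast; ring]
      exact (Complex.ofReal_re _).symm
    have hinteg : Integrable (fun w => Real.exp (-π * b * w ^ 2) * ‖𝓕 G w‖ ^ 2) := by
      simp_rw [hreal]
      apply Integrable.norm
      refine hbint.mul_bdd (c := ∫ x, ‖W x‖) ?_ (Eventually.of_forall fun w =>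
        norm_fourier_le_integral W w)
      exact (continuous_fourier hWi).aestronglyMeasurable
    rw [← ofReal_integral_eq_lintegral_ofReal hinteg
      (Eventually.of_forall fun w => by positivity)]
    apply ENNReal.ofReal_le_ofReal
    have hre : ((∫ w, Real.exp (-π * b * w ^ 2) * ‖𝓕 G w‖ ^ 2 : ℝ) : ℂ) =
        ∫ w : ℝ, Complex.exp (-π * (b : ℂ) * w ^ 2) • 𝓕 W w := by
      rw [← integral_complex_ofReal]
      congr 1; ext w
      rw [hFW]; push_cast; simp
    have hnn : 0 ≤ ∫ w, Real.exp (-π * b * w ^ 2) * ‖𝓕 G w‖ ^ 2 :=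
      integral_nonneg fun w => by positivity
    rw [← Real.norm_of_nonneg hnn, ← Complex.norm_real, hre, ← key]
    have hfull : ∫ t : ℝ, ‖1 / (b : ℂ) ^ (1 / 2 : ℂ) * Complex.exp (-π / b * t ^ 2)‖ = 1 := by
      have : ∀ t : ℝ, ‖1 / (b : ℂ) ^ (1 / 2 : ℂ) * Complex.exp (-π / b * t ^ 2)‖ =
          1 / Real.sqrt b * Real.exp (-(π / b) * t ^ 2) := by
        intro t
        rw [norm_mul, norm_div, norm_one, Complex.norm_exp]
        congr 2
        · rw [show (1 / 2 : ℂ) = ((1 / 2 : ℝ) : ℂ) by push_cast; ring,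
            Complex.norm_cpow_eq_rpow_re_of_pos hb0, Complex.ofReal_re, Real.sqrt_eq_rpow]
        · rw [show (-π / (b : ℂ) * t ^ 2) = ((-(π / b) * t ^ 2 : ℝ) : ℂ) by push_cast; ring]
          exact Complex.ofReal_re _
      simp_rw [this]
      rw [integral_const_mul, integral_gaussian, show π / (π / b) = b by field_simp]
      field_simp
    have hnint : Integrable
        (fun t : ℝ => ‖1 / (b : ℂ) ^ (1 / 2 : ℂ) * Complex.exp (-π / b * t ^ 2)‖) :=
      integrable_of_integral_eq_one hfull
    refine (norm_integral_le_of_norm_le (hnint.mul_const C)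
      (Eventually.of_forall fun t => ?_)).trans_eq ?_
    · rw [norm_smul]
      exact mul_le_mul_of_nonneg_left (hWb t) (norm_nonneg _)
    · rw [integral_mul_const, hfull, one_mul]
  have hlim : (∫⁻ w, ENNReal.ofReal (‖𝓕 G w‖ ^ 2)) ≤ ENNReal.ofReal C := by
    have hpt : ∀ w, Tendsto (fun k : ℕ => ENNReal.ofReal
        (Real.exp (-π * (1 / ((k : ℝ) + 1)) * w ^ 2) * ‖𝓕 G w‖ ^ 2)) atTop
        (𝓝 (ENNReal.ofReal (‖𝓕 G w‖ ^ 2))) := by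
      intro w
      apply ENNReal.tendsto_ofReal
      have h0 := tendsto_one_div_add_atTop_nhds_zero_nat (𝕜 := ℝ)
      have h1 := (((h0.const_mul (-π)).mul_const (w ^ 2)).rexp).mul_const (‖𝓕 G w‖ ^ 2)
      simpa using h1
    calc (∫⁻ w, ENNReal.ofReal (‖𝓕 G w‖ ^ 2))
        = ∫⁻ w, liminf (fun k : ℕ => ENNReal.ofReal
        (Real.exp (-π * (1 / ((k : ℝ) + 1)) * w ^ 2) * ‖𝓕 G w‖ ^ 2)) atTop := by
          congr 1; ext w; exact (hpt w).liminf_eq.symm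
      _ ≤ liminf (fun k : ℕ => ∫⁻ w, ENNReal.ofReal
        (Real.exp (-π * (1 / ((k : ℝ) + 1)) * w ^ 2) * ‖𝓕 G w‖ ^ 2)) atTop := by
          apply lintegral_liminf_le
          intro k
          have := hcont.measurable
          fun_prop
      _ ≤ ENNReal.ofReal C := by
          refine (liminf_le_liminf (Eventually.of_forall hgauss)).trans_eq ?_
          simp
  have hsm : AEStronglyMeasurable (fun w => ‖𝓕 G w‖ ^ 2) volume :=
    (hcont.norm.pow 2).aestronglyMeasurable
  refine ⟨⟨hsm, ?_⟩, ?_⟩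
  · rw [hasFiniteIntegral_iff_ofReal (Eventually.of_forall fun w => by positivity)]
    exact hlim.trans_lt ENNReal.ofReal_lt_top
  · rw [integral_eq_lintegral_of_nonneg_ae (Eventually.of_forall fun w => by positivity) hsm]
    exact ENNReal.toReal_le_of_le_ofReal hC0 hlim

/-- Convolution of `[0,∞]`-valued functions. -/
def eConv (u v : ℝ → ENNReal) (x : ℝ) : ENNReal := ∫⁻ y, u y * v (x - y)

/-- The `(n+1)`-fold convolution power of `u`. -/
def ePow (u : ℝ → ENNReal) : ℕ → ℝ → ENNReal
  | 0 => u
  | n + 1 => eConv u (ePow u n)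

/-- The part of the `(n+1)`-fold convolution power of `u + v` that contains one factor `v`. -/
def eOne (u v : ℝ → ENNReal) : ℕ → ℝ → ENNReal
  | 0 => v
  | n + 1 => fun x => eConv u (eOne u v n) x + eConv v (ePow u n) x

/-- The part of the `(n+1)`-fold convolution power of `u + v` with at least two factors `v`. -/
def eTwo (u v : ℝ → ENNReal) : ℕ → ℝ → ENNReal
  | 0 => 0
  | n + 1 => fun x => eConv (u + v) (eTwo u v n) x + eConv v (eOne u v n) x

lemma measurable_eConv {u v : ℝ → ENNReal} (hu : Measurable u) (hv : Measurable v) :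
    Measurable (eConv u v) := by
  unfold eConv
  apply Measurable.lintegral_prod_right' (f := fun z : ℝ × ℝ => u z.2 * v (z.1 - z.2))
  fun_prop

lemma measurable_ePow {u : ℝ → ENNReal} (hu : Measurable u) (n : ℕ) : Measurable (ePow u n) := by
  induction n with
  | zero => exact hu
  | succ n ih => exact measurable_eConv hu ih

lemma measurable_eOne {u v : ℝ → ENNReal} (hu : Measurable u) (hv : Measurable v) (n : ℕ) :
    Measurable (eOne u v n) := by
  induction n with
  | zero => exact hv
  | succ n ih => exact (measurable_eConv hu ih).add (measurable_eConv hv (measurable_ePow hu n))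

lemma measurable_eTwo {u v : ℝ → ENNReal} (hu : Measurable u) (hv : Measurable v) (n : ℕ) :
    Measurable (eTwo u v n) := by
  induction n with
  | zero => exact measurable_const
  | succ n ih =>
    exact (measurable_eConv (hu.add hv) ih).add (measurable_eConv hv (measurable_eOne hu hv n))

lemma eConv_add_right {u v w : ℝ → ENNReal} (hu : Measurable u) (hv : Measurable v) (x : ℝ) :
    eConv u (fun y => v y + w y) x = eConv u v x + eConv u w x := by
  unfold eConv
  rw [← lintegral_add_left (by fun_prop)]
  simp only [mul_add]

lemma eConv_add_left {u v w : ℝ → ENNReal} (hu : Measurable u) (hw : Measurable w) (x : ℝ) :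
    eConv (u + v) w x = eConv u w x + eConv v w x := by
  unfold eConv
  rw [← lintegral_add_left (by fun_prop)]
  simp only [Pi.add_apply, add_mul]

lemma ePow_add {u v : ℝ → ENNReal} (hu : Measurable u) (hv : Measurable v) (n : ℕ) (x : ℝ) :
    ePow (u + v) n x = ePow u n x + eOne u v n x + eTwo u v n x := by
  induction n generalizing x with
  | zero => simp [ePow, eOne, eTwo]
  | succ n ih =>
    have m1 := measurable_ePow hu n
    have m2 := measurable_eOne hu hv n
    have m3 := measurable_eTwo hu hv n
    have h1 : ePow (u + v) n = fun y => (ePow u n y + eOne u v n y) + eTwo u v n y :=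
      funext ih
    simp only [ePow, eOne, eTwo]
    rw [h1, eConv_add_right (v := fun y => ePow u n y + eOne u v n y) (w := eTwo u v n)
      (hu.add hv) (m1.add m2), eConv_add_right (hu.add hv) m1,
      eConv_add_left hu m1, eConv_add_left hu m2]
    ring

lemma lintegral_eConv {u v : ℝ → ENNReal} (hu : Measurable u) (hv : Measurable v) :
    ∫⁻ x, eConv u v x = (∫⁻ x, u x) * ∫⁻ x, v x := by
  unfold eConv
  rw [lintegral_lintegral_swap (by fun_prop)]
  have : ∀ y, ∫⁻ x, u y * v (x - y) = u y * ∫⁻ x, v x := by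
    intro y
    rw [lintegral_const_mul _ (by fun_prop), lintegral_sub_right_eq_self v y]
  simp_rw [this]
  rw [lintegral_mul_const _ hu]

lemma lintegral_ePow {u : ℝ → ENNReal} (hu : Measurable u) (n : ℕ) :
    ∫⁻ x, ePow u n x = (∫⁻ x, u x) ^ (n + 1) := by
  induction n with
  | zero => simp [ePow]
  | succ n ih => simp only [ePow]; rw [lintegral_eConv hu (measurable_ePow hu n), ih]; ring

lemma lintegral_eOne {u v : ℝ → ENNReal} (hu : Measurable u) (hv : Measurable v) (n : ℕ) :
    ∫⁻ x, eOne u v n x = (n + 1) * (∫⁻ x, u x) ^ n * ∫⁻ x, v x := by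
  induction n with
  | zero => simp [eOne]
  | succ n ih =>
    simp only [eOne]
    rw [lintegral_add_left (measurable_eConv hu (measurable_eOne hu hv n)),
      lintegral_eConv hu (measurable_eOne hu hv n), lintegral_eConv hv (measurable_ePow hu n), ih,
      lintegral_ePow hu n]
    push_cast; ring

lemma eConv_le_of_right_le {u v : ℝ → ENNReal} (hu : Measurable u) {C : ENNReal}
    (hC : ∀ x, v x ≤ C) (x : ℝ) : eConv u v x ≤ (∫⁻ y, u y) * C := by
  unfold eConv
  rw [← lintegral_mul_const _ hu]
  exact lintegral_mono fun y => by gcongr; exact hC _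

lemma eConv_le_of_left_le {u v : ℝ → ENNReal} (hv : Measurable v) {C : ENNReal}
    (hC : ∀ x, u x ≤ C) (x : ℝ) : eConv u v x ≤ C * ∫⁻ y, v y := by
  unfold eConv
  rw [← lintegral_sub_left_eq_self v x, ← lintegral_const_mul _ (by fun_prop)]
  exact lintegral_mono fun y => by gcongr; exact hC _

lemma eOne_le {u v : ℝ → ENNReal} (hu : Measurable u) {C : ENNReal}
    (hC : ∀ x, v x ≤ C) (n : ℕ) (x : ℝ) : eOne u v n x ≤ (n + 1) * C * (∫⁻ x, u x) ^ n := by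
  induction n generalizing x with
  | zero => simpa [eOne] using hC x
  | succ n ih =>
    simp only [eOne]
    calc _ ≤ (∫⁻ x, u x) * ((n + 1) * C * (∫⁻ x, u x) ^ n) + C * ∫⁻ x, ePow u n x :=
          add_le_add (eConv_le_of_right_le hu ih x)
            (eConv_le_of_left_le (measurable_ePow hu n) hC x)
      _ = _ := by rw [lintegral_ePow hu n]; push_cast; ring

lemma ePow_eq_zero {u : ℝ → ENNReal} {K : ℝ} (h : ∀ x, K ≤ x → u x = 0) (n : ℕ) (x : ℝ)
    (hx : (n + 1) * K ≤ x) : ePow u n x = 0 := by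
  induction n generalizing x with
  | zero => exact h x (by simpa using hx)
  | succ n ih =>
    simp only [ePow, eConv]
    refine (lintegral_congr fun y => ?_).trans lintegral_zero
    rcases le_or_gt K y with hy | hy
    · rw [h y hy, zero_mul]
    · rw [ih (x - y) (by push_cast at hx; linarith), mul_zero]

lemma integrable_toReal_ofReal {u : ℝ → ENNReal} (hu : Measurable u) (hi : ∫⁻ x, u x ≠ ⊤) :
    Integrable (fun x => ((u x).toReal : ℂ)) :=
  (integrable_toReal_of_lintegral_ne_top hu.aemeasurable hi).ofReal

lemma toReal_eConv {u v : ℝ → ENNReal} (hu : Measurable u) (hv : Measurable v)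
    (hi : ∫⁻ x, u x ≠ ⊤) (hj : ∫⁻ x, v x ≠ ⊤) (x : ℝ) :
    (eConv u v x).toReal = ∫ y, (u y).toReal * (v (x - y)).toReal := by
  unfold eConv
  rw [← integral_toReal (by fun_prop)]
  · simp only [ENNReal.toReal_mul]
  · have h1 := ae_lt_top hu hi
    have h2 : ∀ᵐ y, v (x - y) < ⊤ := by
      apply ae_lt_top (by fun_prop)
      rwa [lintegral_sub_left_eq_self v x]
    filter_upwards [h1, h2] with y h1 h2 using ENNReal.mul_lt_top h1 h2

/-- Fourier transform of (the real part of) a `[0,∞]`-valued function. -/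
def eFourier (u : ℝ → ENNReal) : ℝ → ℂ := 𝓕 (fun x => ((u x).toReal : ℂ))

lemma eFourier_eConv {u v : ℝ → ENNReal} (hu : Measurable u) (hv : Measurable v)
    (hi : ∫⁻ x, u x ≠ ⊤) (hj : ∫⁻ x, v x ≠ ⊤) (w : ℝ) :
    eFourier (eConv u v) w = eFourier u w * eFourier v w := by
  unfold eFourier
  rw [← Real.fourier_mul_convolution_eq (integrable_toReal_ofReal hu hi)
    (integrable_toReal_ofReal hv hj)]
  refine congrFun (congrArg 𝓕 (funext fun x => ?_)) w
  rw [toReal_eConv hu hv hi hj, ← integral_complex_ofReal]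
  simp [convolution_def]

lemma eFourier_add {u v : ℝ → ENNReal} (hu : Measurable u) (hv : Measurable v)
    (hi : ∫⁻ x, u x ≠ ⊤) (hj : ∫⁻ x, v x ≠ ⊤) (w : ℝ) :
    eFourier (fun x => u x + v x) w = eFourier u w + eFourier v w := by
  unfold eFourier
  rw [Real.fourier_eq', Real.fourier_eq', Real.fourier_eq', ← integral_add]
  · apply integral_congr_ae
    filter_upwards [ae_lt_top hu hi, ae_lt_top hv hj] with x h1 h2
    rw [ENNReal.toReal_add h1.ne h2.ne]
    push_cast
    simp only [smul_eq_mul]; ring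
  · simpa [Circle.smul_def, Real.fourierChar_apply] using
      (Real.fourierIntegral_convergent_iff w).2 (integrable_toReal_ofReal hu hi)
  · simpa [Circle.smul_def, Real.fourierChar_apply] using
      (Real.fourierIntegral_convergent_iff w).2 (integrable_toReal_ofReal hv hj)

lemma eFourier_ePow {u : ℝ → ENNReal} (hu : Measurable u) (hi : ∫⁻ x, u x ≠ ⊤) (n : ℕ) (w : ℝ) :
    eFourier (ePow u n) w = eFourier u w ^ (n + 1) := by
  induction n with
  | zero => simp [ePow]
  | succ n ih =>
    simp only [ePow]
    rw [eFourier_eConv hu (measurable_ePow hu n) hi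
      (by rw [lintegral_ePow hu]; exact ENNReal.pow_ne_top hi), ih]
    ring

lemma lintegral_eOne_ne_top {u v : ℝ → ENNReal} (hu : Measurable u) (hv : Measurable v)
    (hi : ∫⁻ x, u x ≠ ⊤) (hj : ∫⁻ x, v x ≠ ⊤) (n : ℕ) : ∫⁻ x, eOne u v n x ≠ ⊤ := by
  rw [lintegral_eOne hu hv]
  exact ENNReal.mul_ne_top (ENNReal.mul_ne_top (by norm_cast; exact ENNReal.natCast_ne_top _)
    (ENNReal.pow_ne_top hi)) hj

lemma eFourier_eOne {u v : ℝ → ENNReal} (hu : Measurable u) (hv : Measurable v)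
    (hi : ∫⁻ x, u x ≠ ⊤) (hj : ∫⁻ x, v x ≠ ⊤) (n : ℕ) (w : ℝ) :
    eFourier (eOne u v n) w = (n + 1) * eFourier u w ^ n * eFourier v w := by
  induction n with
  | zero => simp [eOne]
  | succ n ih =>
    have m1 := measurable_ePow hu n
    have m2 := measurable_eOne hu hv n
    have i1 : ∫⁻ x, ePow u n x ≠ ⊤ := by
      rw [lintegral_ePow hu]; exact ENNReal.pow_ne_top hi
    have i2 := lintegral_eOne_ne_top hu hv hi hj n
    simp only [eOne]
    rw [eFourier_add (measurable_eConv hu m2) (measurable_eConv hv m1)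
      (by rw [lintegral_eConv hu m2]; exact ENNReal.mul_ne_top hi i2)
      (by rw [lintegral_eConv hv m1]; exact ENNReal.mul_ne_top hj i1),
      eFourier_eConv hu m2 hi i2, eFourier_eConv hv m1 hj i1, ih, eFourier_ePow hu hi]
    push_cast; ring

/-- The Fourier transform of `eTwo u v n`, in terms of those of `u` and `v`. -/
def twoKernel (u v : ℝ → ENNReal) (n : ℕ) (w : ℝ) : ℂ :=
  (eFourier u w + eFourier v w) ^ (n + 1) - eFourier u w ^ (n + 1)
    - (n + 1) * eFourier u w ^ n * eFourier v w

lemma twoKernel_succ (u v : ℝ → ENNReal) (n : ℕ) (w : ℝ) :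
    twoKernel u v (n + 1) w = (eFourier u w + eFourier v w) * twoKernel u v n w
      + eFourier v w * ((n + 1) * eFourier u w ^ n * eFourier v w) := by
  unfold twoKernel
  push_cast; ring

lemma norm_twoKernel_le (u v : ℝ → ENNReal) (n : ℕ) (w : ℝ) {θ : ℝ}
    (h1 : ‖eFourier u w + eFourier v w‖ ≤ θ) (h2 : ‖eFourier u w‖ ≤ θ) :
    ‖twoKernel u v (n + 1) w‖ ≤ ((n : ℝ) + 1) ^ 2 * θ ^ n * ‖eFourier v w‖ ^ 2 := by
  have hθ : 0 ≤ θ := (norm_nonneg _).trans h1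
  have hz : twoKernel u v 0 w = 0 := by unfold twoKernel; push_cast; ring
  have hterm : ∀ n : ℕ, ‖eFourier v w * ((n + 1) * eFourier u w ^ n * eFourier v w)‖ ≤
      ((n : ℝ) + 1) * θ ^ n * ‖eFourier v w‖ ^ 2 := by
    intro n
    have e : ‖eFourier v w * ((n + 1) * eFourier u w ^ n * eFourier v w)‖ =
      ((n : ℝ) + 1) * ‖eFourier u w‖ ^ n * ‖eFourier v w‖ ^ 2 := by
      rw [norm_mul, norm_mul, norm_mul, norm_pow]
      have : ‖(n + 1 : ℂ)‖ = (n : ℝ) + 1 := by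
        rw [show (n + 1 : ℂ) = ((n + 1 : ℕ) : ℂ) by push_cast; ring, Complex.norm_natCast]
        push_cast; ring
      rw [this]; ring
    rw [e]
    gcongr
  induction n with
  | zero =>
    rw [twoKernel_succ, hz, mul_zero, zero_add]
    simpa using hterm 0
  | succ n ih =>
    rw [twoKernel_succ]
    refine (norm_add_le _ _).trans ?_
    rw [norm_mul]
    calc _ ≤ θ * (((n : ℝ) + 1) ^ 2 * θ ^ n * ‖eFourier v w‖ ^ 2) +
          (((n + 1 : ℕ) : ℝ) + 1) * θ ^ (n + 1) * ‖eFourier v w‖ ^ 2 :=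
          add_le_add (mul_le_mul h1 ih (norm_nonneg _) hθ) (hterm (n + 1))
      _ = (((n : ℝ) + 1) ^ 2 + ((n : ℝ) + 2)) * (θ ^ (n + 1) * ‖eFourier v w‖ ^ 2) := by
          push_cast; ring
      _ ≤ ((((n + 1 : ℕ) : ℝ) + 1) ^ 2) * (θ ^ (n + 1) * ‖eFourier v w‖ ^ 2) := by
          gcongr
          push_cast
          nlinarith [Nat.cast_nonneg (α := ℝ) n]
      _ = _ := by ring

lemma norm_eFourier_le (u : ℝ → ENNReal) (hu : Measurable u) (hi : ∫⁻ x, u x ≠ ⊤) (w : ℝ) :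
    ‖eFourier u w‖ ≤ (∫⁻ x, u x).toReal := by
  refine (norm_fourier_le_integral _ w).trans_eq ?_
  rw [← integral_toReal hu.aemeasurable (ae_lt_top hu hi)]
  congr 1; ext x
  rw [Complex.norm_real, Real.norm_of_nonneg ENNReal.toReal_nonneg]

lemma continuous_eFourier {u : ℝ → ENNReal} (hu : Measurable u) (hi : ∫⁻ x, u x ≠ ⊤) :
    Continuous (eFourier u) :=
  continuous_fourier (integrable_toReal_ofReal hu hi)

lemma continuous_twoKernel {u v : ℝ → ENNReal} (hu : Measurable u) (hv : Measurable v)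
    (hi : ∫⁻ x, u x ≠ ⊤) (hj : ∫⁻ x, v x ≠ ⊤) (n : ℕ) : Continuous (twoKernel u v n) := by
  have h1 := continuous_eFourier hu hi
  have h2 := continuous_eFourier hv hj
  unfold twoKernel
  fun_prop

lemma integrable_eFourier_sq {v : ℝ → ENNReal} (hv : Measurable v) (hj : ∫⁻ x, v x ≠ ⊤)
    {M : ℝ} (hM : ∀ x, v x ≤ ENNReal.ofReal M) (hM0 : 0 ≤ M) :
    Integrable (fun w => ‖eFourier v w‖ ^ 2) ∧
      ∫ w, ‖eFourier v w‖ ^ 2 ≤ M * (∫⁻ x, v x).toReal := by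
  have h := integrable_norm_fourier_sq (g := fun x => (v x).toReal) (M := M)
    (integrable_toReal_of_lintegral_ne_top hv.aemeasurable hj) (fun x => by
      rw [abs_of_nonneg ENNReal.toReal_nonneg]
      exact ENNReal.toReal_le_of_le_ofReal hM0 (hM x))
  refine ⟨h.1, h.2.trans_eq ?_⟩
  rw [← integral_toReal hv.aemeasurable (ae_lt_top hv hj)]
  simp only [abs_of_nonneg ENNReal.toReal_nonneg]

lemma integrable_twoKernel {u v : ℝ → ENNReal} (hu : Measurable u) (hv : Measurable v)
    (hi : ∫⁻ x, u x ≠ ⊤) (hj : ∫⁻ x, v x ≠ ⊤) {M : ℝ} (hM : ∀ x, v x ≤ ENNReal.ofReal M)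
    (hM0 : 0 ≤ M) (n : ℕ) : Integrable (twoKernel u v n) := by
  rcases n with _ | n
  · have : twoKernel u v 0 = fun _ => 0 := by
      ext w; unfold twoKernel; push_cast; ring
    rw [this]; exact integrable_zero _ _ _
  · set θ := (∫⁻ x, u x).toReal + (∫⁻ x, v x).toReal
    refine Integrable.mono' ((integrable_eFourier_sq hv hj hM hM0).1.const_mul
      (((n : ℝ) + 1) ^ 2 * θ ^ n))
      (continuous_twoKernel hu hv hi hj _).aestronglyMeasurable
      (Eventually.of_forall fun w => norm_twoKernel_le u v n w ?_ ?_)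
    · exact (norm_add_le _ _).trans (add_le_add (norm_eFourier_le u hu hi w)
        (norm_eFourier_le v hv hj w))
    · exact (norm_eFourier_le u hu hi w).trans (le_add_of_nonneg_right ENNReal.toReal_nonneg)

/-- Fourier inversion for the part of the convolution power with two bounded factors. -/
lemma eTwo_eq_fourierInv {u v : ℝ → ENNReal} (hu : Measurable u) (hv : Measurable v)
    (hi : ∫⁻ x, u x ≠ ⊤) (hj : ∫⁻ x, v x ≠ ⊤) {M : ℝ} (hM : ∀ x, v x ≤ ENNReal.ofReal M)
    (hM0 : 0 ≤ M) (n : ℕ) :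
    (∃ C : ENNReal, C ≠ ⊤ ∧ ∀ x, eTwo u v n x ≤ C) ∧
      ∀ x, ((eTwo u v n x).toReal : ℂ) = 𝓕⁻ (twoKernel u v n) x := by
  induction n with
  | zero =>
    refine ⟨⟨0, by simp, fun x => by simp [eTwo]⟩, fun x => ?_⟩
    have : twoKernel u v 0 = fun _ => 0 := by
      ext w; unfold twoKernel; push_cast; ring
    rw [this]
    simp [eTwo, Real.fourierInv_eq']
  | succ n ih =>
    obtain ⟨⟨C, hC, hCx⟩, ih⟩ := ih
    have m1 := measurable_eOne hu hv n
    have m2 := measurable_eTwo hu hv n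
    have i1 := lintegral_eOne_ne_top hu hv hi hj n
    have huv : ∫⁻ x, (u + v) x ≠ ⊤ := by
      simp only [Pi.add_apply]
      rw [lintegral_add_left hu]; exact ENNReal.add_ne_top.2 ⟨hi, hj⟩
    have b1 : ∀ x, eConv (u + v) (eTwo u v n) x ≤ (∫⁻ x, (u + v) x) * C := fun x =>
      eConv_le_of_right_le (hu.add hv) hCx x
    have b2 : ∀ x, eConv v (eOne u v n) x ≤ ENNReal.ofReal M * ∫⁻ y, eOne u v n y := fun x =>
      eConv_le_of_left_le m1 hM x
    have t1 : (∫⁻ x, (u + v) x) * C ≠ ⊤ := ENNReal.mul_ne_top huv hC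
    have t2 : ENNReal.ofReal M * ∫⁻ y, eOne u v n y ≠ ⊤ :=
      ENNReal.mul_ne_top ENNReal.ofReal_ne_top i1
    refine ⟨⟨_, ENNReal.add_ne_top.2 ⟨t1, t2⟩, fun x => add_le_add (b1 x) (b2 x)⟩, fun x => ?_⟩
    simp only [eTwo]
    rw [ENNReal.toReal_add (ne_top_of_le_ne_top t1 (b1 x)) (ne_top_of_le_ne_top t2 (b2 x))]
    have huvF : eFourier (u + v) = fun w => eFourier u w + eFourier v w :=
      funext fun w => eFourier_add hu hv hi hj w
    have e1 : ((eConv (u + v) (eTwo u v n) x).toReal : ℂ) =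
        𝓕⁻ (fun w => (eFourier u w + eFourier v w) * twoKernel u v n w) x := by
      have : (eConv (u + v) (eTwo u v n) x).toReal =
          ∫ y, ((u + v) y).toReal * (eTwo u v n (x - y)).toReal := by
        unfold eConv
        rw [← integral_toReal (by fun_prop)]
        · simp only [ENNReal.toReal_mul]
        · filter_upwards [ae_lt_top (hu.add hv) huv] with y h1
          exact ENNReal.mul_lt_top h1 ((hCx _).trans_lt hC.lt_top)
      rw [this, ← integral_complex_ofReal]
      simp only [Complex.ofReal_mul, ih]
      rw [integral_mul_fourierInv_sub (integrable_toReal_ofReal (hu.add hv) huv)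
        (integrable_twoKernel hu hv hi hj hM hM0 n) x]
      change 𝓕⁻ (fun w => eFourier (u + v) w * _) x = _
      rw [huvF]
    have hbb : Integrable (fun w => eFourier v w * eFourier (eOne u v n) w) := by
      refine Integrable.mono' ((integrable_eFourier_sq hv hj hM hM0).1.const_mul
        (((n : ℝ) + 1) * (∫⁻ x, u x).toReal ^ n))
        ((continuous_eFourier hv hj).mul (continuous_eFourier m1 i1)).aestronglyMeasurable
        (Eventually.of_forall fun w => ?_)
      rw [eFourier_eOne hu hv hi hj, norm_mul, norm_mul, norm_mul, norm_pow]
      have : ‖(n + 1 : ℂ)‖ = (n : ℝ) + 1 := by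
        rw [show (n + 1 : ℂ) = ((n + 1 : ℕ) : ℂ) by push_cast; ring, Complex.norm_natCast]
        push_cast; ring
      rw [this]
      have := norm_eFourier_le u hu hi w
      calc _ = ((n : ℝ) + 1) * ‖eFourier u w‖ ^ n * ‖eFourier v w‖ ^ 2 := by ring
        _ ≤ _ := by gcongr
    have e2 : ((eConv v (eOne u v n) x).toReal : ℂ) =
        𝓕⁻ (fun w => eFourier v w * ((n + 1) * eFourier u w ^ n * eFourier v w)) x := by
      rw [toReal_eConv hv m1 hj i1, ← integral_complex_ofReal]
      simp only [Complex.ofReal_mul]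
      have hb : ∀ x, ‖((eOne u v n x).toReal : ℂ)‖ ≤
          ((n + 1) * ENNReal.ofReal M * (∫⁻ x, u x) ^ n).toReal := by
        intro x
        rw [Complex.norm_real, Real.norm_of_nonneg ENNReal.toReal_nonneg]
        refine ENNReal.toReal_mono ?_ (eOne_le hu hM n x)
        exact ENNReal.mul_ne_top (ENNReal.mul_ne_top
          (by norm_cast; exact ENNReal.natCast_ne_top _) ENNReal.ofReal_ne_top)
          (ENNReal.pow_ne_top hi)
      rw [convolution_eq_fourierInv (integrable_toReal_ofReal hv hj)
        (integrable_toReal_ofReal m1 i1) hb hbb x]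
      change 𝓕⁻ (fun w => eFourier v w * eFourier (eOne u v n) w) x = _
      simp only [eFourier_eOne hu hv hi hj]
    rw [Complex.ofReal_add, e1, e2]
    simp only [Real.fourierInv_eq']
    rw [← integral_add]
    · congr 1; ext w
      rw [twoKernel_succ]; simp only [smul_eq_mul]; ring
    · have h_int : Integrable (fun w => (eFourier u w + eFourier v w) * twoKernel u v n w) := by
        refine (integrable_twoKernel hu hv hi hj hM hM0 n).bdd_mul
          (c := (∫⁻ x, u x).toReal + (∫⁻ x, v x).toReal) ?_ (Eventually.of_forall fun w => ?_)
        · exact ((continuous_eFourier hu hi).add (continuous_eFourier hv hj)).aestronglyMeasurable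
        · exact (norm_add_le _ _).trans (add_le_add (norm_eFourier_le u hu hi w)
            (norm_eFourier_le v hv hj w))
      refine h_int.bdd_mul (c := 1) (Continuous.aestronglyMeasurable (by fun_prop))
        (Eventually.of_forall fun w => ?_)
      rw [Complex.norm_exp_ofReal_mul_I]
    · simp only [eFourier_eOne hu hv hi hj] at hbb
      refine hbb.bdd_mul (c := 1) (Continuous.aestronglyMeasurable (by fun_prop))
        (Eventually.of_forall fun w => ?_)
      rw [Complex.norm_exp_ofReal_mul_I]

/-- A convolution power, off the support of the unbounded part, is up to a small error the inverse
Fourier transform of `twoKernel`. -/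
lemma norm_ePow_sub_fourierInv_le {u v : ℝ → ENNReal} (hu : Measurable u) (hv : Measurable v)
    (hi : ∫⁻ x, u x ≠ ⊤) (hj : ∫⁻ x, v x ≠ ⊤) {M : ℝ} (hM : ∀ x, v x ≤ ENNReal.ofReal M)
    (hM0 : 0 ≤ M) {K : ℝ} (hK : ∀ x, K ≤ x → u x = 0) (n : ℕ) {x : ℝ} (hx : (n + 1) * K ≤ x) :
    ‖((ePow (u + v) n x).toReal : ℂ) - 𝓕⁻ (twoKernel u v n) x‖ ≤
      ((n : ℝ) + 1) * M * (∫⁻ x, u x).toReal ^ n := by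
  obtain ⟨⟨C, hC, hCx⟩, h2⟩ := eTwo_eq_fourierInv hu hv hi hj hM hM0 n
  have ht : (n + 1) * ENNReal.ofReal M * (∫⁻ x, u x) ^ n ≠ ⊤ :=
    ENNReal.mul_ne_top (ENNReal.mul_ne_top
      (by norm_cast; exact ENNReal.natCast_ne_top _) ENNReal.ofReal_ne_top)
      (ENNReal.pow_ne_top hi)
  have h1 := eOne_le (u := u) (v := v) hu hM n x
  rw [ePow_add hu hv, ePow_eq_zero hK n x hx, zero_add,
    ENNReal.toReal_add (ne_top_of_le_ne_top ht h1) (ne_top_of_le_ne_top hC (hCx x)), ← h2]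
  push_cast
  rw [add_sub_cancel_right, Complex.norm_real, Real.norm_of_nonneg ENNReal.toReal_nonneg]
  refine (ENNReal.toReal_mono ht h1).trans_eq ?_
  rw [ENNReal.toReal_mul, ENNReal.toReal_mul, ENNReal.toReal_ofReal hM0, ENNReal.toReal_pow]
  congr 2

lemma norm_exp_mul_I_sub_taylor_le (x : ℝ) :
    ‖Complex.exp (x * Complex.I) - (1 + x * Complex.I - x ^ 2 / 2 - x ^ 3 / 6 * Complex.I)‖ ≤
      4 * x ^ 4 := by
  rcases le_or_gt |x| 1 with hx | hx
  · have h := Complex.exp_bound (x := x * Complex.I) (by simpa using hx) (n := 4) (by norm_num)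
    have e : ∑ m ∈ Finset.range 4, (x * Complex.I) ^ m / (m.factorial : ℂ) =
        1 + x * Complex.I - x ^ 2 / 2 - x ^ 3 / 6 * Complex.I := by
      simp only [Finset.sum_range_succ, Finset.sum_range_zero, mul_pow, Complex.I_sq,
        Complex.I_pow_three, Nat.factorial]
      push_cast; ring
    rw [e] at h
    refine h.trans ?_
    have : ‖(x : ℂ) * Complex.I‖ ^ 4 = x ^ 4 := by
      simp [Even.pow_abs (by decide : Even 4)]
    rw [this]
    norm_num [Nat.factorial]
    nlinarith [sq_nonneg (x ^ 2)]
  · have h1 : ‖Complex.exp (x * Complex.I)‖ = 1 := Complex.norm_exp_ofReal_mul_I x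
    have h2 : ‖(1 + x * Complex.I - x ^ 2 / 2 - x ^ 3 / 6 * Complex.I : ℂ)‖ ≤
        1 + |x| + |x| ^ 2 / 2 + |x| ^ 3 / 6 := by
      refine (norm_sub_le _ _).trans (add_le_add ((norm_sub_le _ _).trans (add_le_add
        ((norm_add_le _ _).trans (add_le_add ?_ ?_)) ?_)) ?_) <;> simp
    refine (norm_sub_le _ _).trans ?_
    rw [h1]
    refine (add_le_add_right h2 _).trans ?_
    have e : x ^ 4 = |x| ^ 4 := (Even.pow_abs (by decide) x).symm
    rw [e]
    have a1 : |x| ≤ |x| ^ 4 := le_self_pow₀ hx.le (by norm_num)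
    have a2 : |x| ^ 2 ≤ |x| ^ 4 := pow_le_pow_right₀ hx.le (by norm_num)
    have a3 : |x| ^ 3 ≤ |x| ^ 4 := pow_le_pow_right₀ hx.le (by norm_num)
    linarith

lemma norm_pow_sub_pow_le {z w : ℂ} {ρ : ℝ} (hz : ‖z‖ ≤ ρ) (hw : ‖w‖ ≤ ρ) (n : ℕ) :
    ‖z ^ (n + 1) - w ^ (n + 1)‖ ≤ (n + 1) * ‖z - w‖ * ρ ^ n := by
  have hρ : 0 ≤ ρ := (norm_nonneg _).trans hz
  induction n with
  | zero => simp
  | succ n ih =>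
    have e : z ^ (n + 1 + 1) - w ^ (n + 1 + 1) =
      z * (z ^ (n + 1) - w ^ (n + 1)) + (z - w) * w ^ (n + 1) := by ring
    rw [e]
    refine (norm_add_le _ _).trans ?_
    rw [norm_mul, norm_mul, norm_pow]
    calc _ ≤ ρ * ((n + 1) * ‖z - w‖ * ρ ^ n) + ‖z - w‖ * ρ ^ (n + 1) := by gcongr
      _ = _ := by push_cast; ring

/-- Bounds on the characteristic function of a centred reduced density near the origin. -/
lemma norm_charfun_sub_le {f y : ℝ → ℝ} {η C : ℝ} (hf0 : ∀ x, 0 ≤ f x)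
    (hy : Measurable y)
    (hi : ∀ k ≤ 4, Integrable (fun x => y x ^ k * f x))
    (h0 : ∫ x, f x = 1) (h1 : ∫ x, y x * f x = 0) (h2 : ∫ x, y x ^ 2 * f x = 1)
    (h3 : |∫ x, y x ^ 3 * f x| ≤ η) (h4 : ∫ x, y x ^ 4 * f x ≤ C) (ζ : ℝ) :
    ‖(∫ x, Complex.exp ((-ζ * y x : ℝ) * Complex.I) * (f x : ℂ)) - (1 - ζ ^ 2 / 2 : ℝ)‖ ≤
      η * |ζ| ^ 3 + 4 * C * ζ ^ 4 := by
  have i0 : Integrable f := by simpa using hi 0 (by norm_num)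
  have i1 : Integrable (fun x => y x * f x) := by simpa using hi 1 (by norm_num)
  have i2 := hi 2 (by norm_num)
  have i3 := hi 3 (by norm_num)
  have i4 := hi 4 (by norm_num)
  have hpoly : ∫ x, ((f x : ℂ) + (-ζ * Complex.I) * ((y x * f x : ℝ) : ℂ)
      - (ζ ^ 2 / 2) * ((y x ^ 2 * f x : ℝ) : ℂ)
      + (ζ ^ 3 / 6 * Complex.I) * ((y x ^ 3 * f x : ℝ) : ℂ)) =
      (1 - ζ ^ 2 / 2 : ℝ) + (ζ ^ 3 / 6 * Complex.I) * ((∫ x, y x ^ 3 * f x : ℝ) : ℂ) := by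
    rw [integral_add, integral_sub, integral_add, integral_const_mul, integral_const_mul,
      integral_const_mul]
    · simp only [integral_complex_ofReal, h0, h1, h2]
      push_cast; ring
    · exact i0.ofReal
    · exact i1.ofReal.const_mul _
    · exact i0.ofReal.add (i1.ofReal.const_mul _)
    · exact i2.ofReal.const_mul _
    · exact (i0.ofReal.add (i1.ofReal.const_mul _)).sub (i2.ofReal.const_mul _)
    · exact i3.ofReal.const_mul _
  have ipoly : Integrable (fun x => ((f x : ℂ) + (-ζ * Complex.I) * ((y x * f x : ℝ) : ℂ)
      - (ζ ^ 2 / 2) * ((y x ^ 2 * f x : ℝ) : ℂ)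
      + (ζ ^ 3 / 6 * Complex.I) * ((y x ^ 3 * f x : ℝ) : ℂ))) :=
    ((i0.ofReal.add (i1.ofReal.const_mul _)).sub (i2.ofReal.const_mul _)).add
      (i3.ofReal.const_mul _)
  have iexp : Integrable (fun x => Complex.exp ((-ζ * y x : ℝ) * Complex.I) * (f x : ℂ)) := by
    refine i0.ofReal.bdd_mul (c := 1) (Measurable.aestronglyMeasurable (by fun_prop))
      (Eventually.of_forall fun x => ?_)
    rw [Complex.norm_exp_ofReal_mul_I]
  have hrem : ‖(∫ x, Complex.exp ((-ζ * y x : ℝ) * Complex.I) * (f x : ℂ)) -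
      ((1 - ζ ^ 2 / 2 : ℝ) + (ζ ^ 3 / 6 * Complex.I) * ((∫ x, y x ^ 3 * f x : ℝ) : ℂ))‖ ≤
      4 * C * ζ ^ 4 := by
    rw [← hpoly, ← integral_sub iexp ipoly]
    refine (norm_integral_le_of_norm_le (i4.const_mul (4 * ζ ^ 4))
      (Eventually.of_forall fun x => ?_)).trans ?_
    · have := norm_exp_mul_I_sub_taylor_le (-ζ * y x)
      have e : Complex.exp ((-ζ * y x : ℝ) * Complex.I) * (f x : ℂ) -
          ((f x : ℂ) + (-ζ * Complex.I) * ((y x * f x : ℝ) : ℂ)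
          - (ζ ^ 2 / 2) * ((y x ^ 2 * f x : ℝ) : ℂ)
          + (ζ ^ 3 / 6 * Complex.I) * ((y x ^ 3 * f x : ℝ) : ℂ)) =
          (Complex.exp ((-ζ * y x : ℝ) * Complex.I) - (1 + (-ζ * y x : ℝ) * Complex.I
            - (-ζ * y x : ℝ) ^ 2 / 2 - (-ζ * y x : ℝ) ^ 3 / 6 * Complex.I)) * (f x : ℂ) := by
        push_cast; ring
      rw [e, norm_mul, Complex.norm_real, Real.norm_of_nonneg (hf0 x)]
      refine (mul_le_mul_of_nonneg_right this (hf0 x)).trans_eq ?_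
      ring
    · rw [integral_const_mul]
      have : 0 ≤ ζ ^ 4 := by positivity
      nlinarith
  have hthird : ‖(ζ ^ 3 / 6 * Complex.I) * ((∫ x, y x ^ 3 * f x : ℝ) : ℂ)‖ ≤ η * |ζ| ^ 3 := by
    rw [norm_mul, Complex.norm_real, Real.norm_eq_abs]
    have : ‖(ζ ^ 3 / 6 * Complex.I : ℂ)‖ = |ζ| ^ 3 / 6 := by simp
    rw [this]
    have hη : 0 ≤ η := (abs_nonneg _).trans h3
    calc |ζ| ^ 3 / 6 * |∫ x, y x ^ 3 * f x| ≤ |ζ| ^ 3 / 6 * η := by gcongr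
      _ ≤ η * |ζ| ^ 3 := by
        have : 0 ≤ |ζ| ^ 3 * η := by positivity
        linarith
  have e : (∫ x, Complex.exp ((-ζ * y x : ℝ) * Complex.I) * (f x : ℂ)) - (1 - ζ ^ 2 / 2 : ℝ) =
      ((∫ x, Complex.exp ((-ζ * y x : ℝ) * Complex.I) * (f x : ℂ)) -
      ((1 - ζ ^ 2 / 2 : ℝ) + (ζ ^ 3 / 6 * Complex.I) * ((∫ x, y x ^ 3 * f x : ℝ) : ℂ))) +
      (ζ ^ 3 / 6 * Complex.I) * ((∫ x, y x ^ 3 * f x : ℝ) : ℂ) := by ring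
  rw [e]
  exact (norm_add_le _ _).trans (by linarith)

lemma abs_exp_neg_half_sq_sub_le {ζ : ℝ} (hζ : |ζ| ≤ 1) :
    |Real.exp (-ζ ^ 2 / 2) - (1 - ζ ^ 2 / 2)| ≤ ζ ^ 4 := by
  have hsq : ζ ^ 2 ≤ 1 := by rw [← sq_abs]; exact pow_le_one₀ (abs_nonneg _) hζ
  have h := Real.exp_bound (x := -ζ ^ 2 / 2) (by
    rw [abs_le]; constructor <;> nlinarith [sq_nonneg ζ]) (n := 2) (by norm_num)
  have e : ∑ m ∈ Finset.range 2, (-ζ ^ 2 / 2) ^ m / (m.factorial : ℝ) = 1 - ζ ^ 2 / 2 := by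
    simp [Finset.sum_range_succ]; ring
  rw [e] at h
  refine h.trans ?_
  rw [sq_abs]
  norm_num [Nat.factorial]
  nlinarith [sq_nonneg (ζ ^ 2)]

/-- Powers of a characteristic function close to those of the Gaussian one near the origin. -/
lemma norm_pow_sub_exp_le {z : ℂ} {η C ζ : ℝ} (hη1 : η ≤ 1) (hC : 1 ≤ C)
    (hζ : |ζ| ≤ 1 / (8 * C))
    (hz : ‖z - (1 - ζ ^ 2 / 2 : ℝ)‖ ≤ η * |ζ| ^ 3 + 4 * C * ζ ^ 4) (n : ℕ) :
    ‖z ^ (n + 1) - (Real.exp (-((n + 1 : ℝ) * ζ ^ 2 / 2)) : ℂ)‖ ≤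
      (n + 1) * (η * |ζ| ^ 3 + 5 * C * ζ ^ 4) * Real.exp (-(n * ζ ^ 2 / 4)) := by
  have hζ8 : |ζ| ≤ 1 / 8 := hζ.trans (by
    rw [div_le_div_iff₀ (by positivity) (by norm_num)]; linarith)
  have hCζ : C * |ζ| ≤ 1 / 8 := by
    rw [le_div_iff₀ (by positivity)] at hζ; linarith
  have hsq : ζ ^ 2 = |ζ| ^ 2 := (sq_abs ζ).symm
  have hfour : ζ ^ 4 = |ζ| ^ 4 := (Even.pow_abs (by decide) ζ).symm
  have hz0 := abs_nonneg ζ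
  have hg := abs_exp_neg_half_sq_sub_le (hζ8.trans (by norm_num))
  have hexp : 1 - ζ ^ 2 / 4 ≤ Real.exp (-(ζ ^ 2 / 4)) := by
    have := Real.add_one_le_exp (-(ζ ^ 2 / 4)); linarith
  have hzn : ‖z‖ ≤ Real.exp (-(ζ ^ 2 / 4)) := by
    refine le_trans ?_ hexp
    have h1 : ‖((1 - ζ ^ 2 / 2 : ℝ) : ℂ)‖ = 1 - ζ ^ 2 / 2 := by
      rw [Complex.norm_real, Real.norm_of_nonneg]; rw [hsq]; nlinarith
    have h2 : ‖z‖ ≤ ‖z - (1 - ζ ^ 2 / 2 : ℝ)‖ + ‖((1 - ζ ^ 2 / 2 : ℝ) : ℂ)‖ := by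
      have := norm_add_le (z - ((1 - ζ ^ 2 / 2 : ℝ) : ℂ)) ((1 - ζ ^ 2 / 2 : ℝ) : ℂ)
      rwa [sub_add_cancel] at this
    have h3 : η * |ζ| ^ 3 ≤ |ζ| ^ 2 / 8 := by
      calc η * |ζ| ^ 3 ≤ 1 * |ζ| ^ 3 := by gcongr
        _ = |ζ| ^ 2 * |ζ| := by ring
        _ ≤ |ζ| ^ 2 * (1 / 8) := by gcongr
        _ = _ := by ring
    have h4 : 4 * C * ζ ^ 4 ≤ |ζ| ^ 2 / 8 := by
      rw [hfour]
      calc 4 * C * |ζ| ^ 4 = 4 * |ζ| ^ 2 * (C * |ζ|) * |ζ| := by ring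
        _ ≤ 4 * |ζ| ^ 2 * (1 / 8) * (1 / 8) := by gcongr
        _ ≤ _ := by nlinarith [sq_nonneg |ζ|]
    rw [← hsq] at h3 h4
    linarith
  have hwn : ‖(Real.exp (-ζ ^ 2 / 2) : ℂ)‖ ≤ Real.exp (-(ζ ^ 2 / 4)) := by
    rw [Complex.norm_real, Real.norm_of_nonneg (Real.exp_pos _).le]
    apply Real.exp_le_exp.2; nlinarith [sq_nonneg ζ]
  have key := norm_pow_sub_pow_le hzn hwn n
  have e1 : (Real.exp (-((n + 1 : ℝ) * ζ ^ 2 / 2)) : ℂ) =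
      (Real.exp (-ζ ^ 2 / 2) : ℂ) ^ (n + 1) := by
    rw [← Complex.ofReal_pow, ← Real.exp_nat_mul]
    congr 2; push_cast; ring
  have e2 : Real.exp (-(n * ζ ^ 2 / 4)) = Real.exp (-(ζ ^ 2 / 4)) ^ n := by
    rw [← Real.exp_nat_mul]; congr 1; ring
  rw [e1, e2]
  refine key.trans ?_
  gcongr
  have h5 : ‖(Real.exp (-ζ ^ 2 / 2) : ℂ) - ((1 - ζ ^ 2 / 2 : ℝ) : ℂ)‖ ≤ ζ ^ 4 := by
    rw [← Complex.ofReal_sub, Complex.norm_real]; exact hg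
  have h6 : z - (Real.exp (-ζ ^ 2 / 2) : ℂ) = (z - (1 - ζ ^ 2 / 2 : ℝ)) -
      ((Real.exp (-ζ ^ 2 / 2) : ℂ) - ((1 - ζ ^ 2 / 2 : ℝ) : ℂ)) := by ring
  rw [h6]
  refine (norm_sub_le _ _).trans ?_
  have : 0 ≤ ζ ^ 4 := by positivity
  nlinarith

lemma exp_mul_eFourier_eq {w : ℝ → ENNReal} {m s : ℝ} (hs : 0 < s) (ζ : ℝ) :
    Complex.exp ((ζ * m / s : ℝ) * Complex.I) * eFourier w (ζ / (2 * π * s)) =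
      ∫ x, Complex.exp ((-ζ * ((x - m) / s) : ℝ) * Complex.I) * ((w x).toReal : ℂ) := by
  unfold eFourier
  rw [Real.fourier_eq', ← integral_const_mul]
  refine integral_congr_ae (Eventually.of_forall fun x => ?_)
  simp only [smul_eq_mul]
  rw [← mul_assoc, ← Complex.exp_add, ← add_mul, ← Complex.ofReal_add]
  congr 4
  simp only [RCLike.inner_apply, conj_trivial]
  have := Real.pi_pos
  field_simp
  ring

/-- Pointwise comparison of the rescaled kernel with the Gaussian one. -/
lemma norm_twoKernel_sub_gaussian_le {u v : ℝ → ENNReal} (hu : Measurable u) (hv : Measurable v)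
    (hmass : ∫⁻ x, (u x + v x) = 1) {m s θ η C : ℝ} (hs : 0 < s) (hη1 : η ≤ 1)
    (hC : 1 ≤ C) (hθ : (∫⁻ x, u x).toReal ≤ θ)
    (hi : ∀ k ≤ 4, Integrable (fun x => ((x - m) / s) ^ k * (u x + v x).toReal))
    (h1 : ∫ x, (x - m) / s * (u x + v x).toReal = 0)
    (h2 : ∫ x, ((x - m) / s) ^ 2 * (u x + v x).toReal = 1)
    (h3 : |∫ x, ((x - m) / s) ^ 3 * (u x + v x).toReal| ≤ η)
    (h4 : ∫ x, ((x - m) / s) ^ 4 * (u x + v x).toReal ≤ C)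
    (hout : ∀ ζ, 1 / (8 * C) ≤ |ζ| →
      ‖∫ x, Complex.exp ((-ζ * ((x - m) / s) : ℝ) * Complex.I) * ((u x + v x).toReal : ℂ)‖ ≤ θ)
    (n : ℕ) (ζ : ℝ) :
    ‖Complex.exp ((ζ * ((n + 2) * m) / s : ℝ) * Complex.I) *
        twoKernel u v (n + 1) (ζ / (2 * π * s)) -
        (Real.exp (-((n + 2 : ℝ) * ζ ^ 2 / 2)) : ℂ)‖ ≤
      (n + 2) * (η * |ζ| ^ 3 + 5 * C * ζ ^ 4) * Real.exp (-((n + 1) / 4 * ζ ^ 2)) +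
      (n + 3) * θ ^ (n + 1) * (Icc (-(1 / (8 * C))) (1 / (8 * C))).indicator 1 ζ +
      (n + 1) ^ 2 * θ ^ n * ‖eFourier v (ζ / (2 * π * s))‖ ^ 2 +
      Real.exp (-((n + 1) * (1 / (8 * C)) ^ 2 / 2)) * Real.exp (-(1 / 2) * ζ ^ 2) := by
  have hum : ∫⁻ x, u x ≤ 1 := by rw [← hmass]; exact lintegral_mono fun x => le_self_add
  have hvm : ∫⁻ x, v x ≤ 1 := by rw [← hmass]; exact lintegral_mono fun x => le_add_self
  have hut : ∫⁻ x, u x ≠ ⊤ := ne_top_of_le_ne_top ENNReal.one_ne_top hum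
  have hvt : ∫⁻ x, v x ≠ ⊤ := ne_top_of_le_ne_top ENNReal.one_ne_top hvm
  have hθ0 : 0 ≤ θ := ENNReal.toReal_nonneg.trans hθ
  have hη0 : 0 ≤ η := (abs_nonneg _).trans h3
  set w := ζ / (2 * π * s) with hw
  set z := Complex.exp ((ζ * m / s : ℝ) * Complex.I) * (eFourier u w + eFourier v w) with hz
  have hzint : z = ∫ x, Complex.exp ((-ζ * ((x - m) / s) : ℝ) * Complex.I) *
      ((u x + v x).toReal : ℂ) := by
    rw [hz, ← eFourier_add hu hv hut hvt, hw, exp_mul_eFourier_eq hs]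
  have hphase : Complex.exp ((ζ * ((n + 2) * m) / s : ℝ) * Complex.I) =
      Complex.exp ((ζ * m / s : ℝ) * Complex.I) ^ (n + 2) := by
    rw [← Complex.exp_nat_mul]; congr 1; push_cast; ring
  have hun : ‖eFourier u w‖ ≤ θ := (norm_eFourier_le u hu hut w).trans hθ
  have hvn : ‖eFourier v w‖ ≤ 1 := (norm_eFourier_le v hv hvt w).trans
    (by simpa using ENNReal.toReal_mono ENNReal.one_ne_top hvm)
  have hA : 0 ≤ (n + 2) * (η * |ζ| ^ 3 + 5 * C * ζ ^ 4) * Real.exp (-((n + 1) / 4 * ζ ^ 2)) := by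
    have : 0 ≤ ζ ^ 4 := by positivity
    positivity
  have hB : 0 ≤ (n + 1) ^ 2 * θ ^ n * ‖eFourier v w‖ ^ 2 := by positivity
  have hD : 0 ≤ Real.exp (-((n + 1) * (1 / (8 * C)) ^ 2 / 2)) * Real.exp (-(1 / 2) * ζ ^ 2) := by
    positivity
  rcases le_or_gt |ζ| (1 / (8 * C)) with hin | hin
  · have hmem : ζ ∈ Icc (-(1 / (8 * C))) (1 / (8 * C)) := abs_le.1 hin
    rw [indicator_of_mem hmem, Pi.one_apply, mul_one]
    have hcf : ‖z - (1 - ζ ^ 2 / 2 : ℝ)‖ ≤ η * |ζ| ^ 3 + 4 * C * ζ ^ 4 := by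
      rw [hzint]
      refine norm_charfun_sub_le (y := fun x => (x - m) / s) (fun x => ENNReal.toReal_nonneg)
        (by fun_prop) hi ?_ h1 h2 h3 h4 ζ
      rw [integral_toReal (f := fun x => u x + v x) (hu.add hv).aemeasurable
        (ae_lt_top (hu.add hv) (by simp [hmass])), hmass, ENNReal.toReal_one]
    have hpow := norm_pow_sub_exp_le hη1 hC hin hcf (n + 1)
    have e1 : Complex.exp ((ζ * ((n + 2) * m) / s : ℝ) * Complex.I) * twoKernel u v (n + 1) w -
        (Real.exp (-((n + 2 : ℝ) * ζ ^ 2 / 2)) : ℂ) =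
        (z ^ (n + 1 + 1) - (Real.exp (-(((n + 1 : ℕ) + 1 : ℝ) * ζ ^ 2 / 2)) : ℂ)) -
        Complex.exp ((ζ * ((n + 2) * m) / s : ℝ) * Complex.I) *
          (eFourier u w ^ (n + 2) + (n + 2) * eFourier u w ^ (n + 1) * eFourier v w) := by
      have : ((n + 1 : ℕ) + 1 : ℝ) = n + 2 := by push_cast; ring
      rw [this, hz, hphase, mul_pow, twoKernel]
      push_cast; ring
    rw [e1]
    refine (norm_sub_le _ _).trans ?_
    rw [norm_mul, Complex.norm_exp_ofReal_mul_I, one_mul]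
    have h5 : ‖eFourier u w ^ (n + 2) + (n + 2) * eFourier u w ^ (n + 1) * eFourier v w‖ ≤
        (n + 3) * θ ^ (n + 1) := by
      refine (norm_add_le _ _).trans ?_
      rw [norm_mul, norm_mul, norm_pow, norm_pow]
      have e2 : ‖((n : ℂ) + 2)‖ = n + 2 := by
        have : ((n : ℂ) + 2) = ((n + 2 : ℕ) : ℂ) := by push_cast; ring
        rw [this, Complex.norm_natCast]; push_cast; ring
      rw [e2]
      have e3 : ‖eFourier u w‖ ≤ 1 := (norm_eFourier_le u hu hut w).trans
        (by simpa using ENNReal.toReal_mono ENNReal.one_ne_top hum)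
      calc ‖eFourier u w‖ ^ (n + 2) + (n + 2) * ‖eFourier u w‖ ^ (n + 1) * ‖eFourier v w‖
          = ‖eFourier u w‖ ^ (n + 1) * ‖eFourier u w‖ +
            (n + 2) * ‖eFourier u w‖ ^ (n + 1) * ‖eFourier v w‖ := by ring
        _ ≤ θ ^ (n + 1) * 1 + (n + 2) * θ ^ (n + 1) * 1 := by gcongr
        _ = _ := by ring
    have h6 : ((n + 1 : ℕ) + 1 : ℝ) * (η * |ζ| ^ 3 + 5 * C * ζ ^ 4) *
        Real.exp (-((n + 1 : ℕ) * ζ ^ 2 / 4)) = (n + 2) * (η * |ζ| ^ 3 + 5 * C * ζ ^ 4) *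
          Real.exp (-((n + 1) / 4 * ζ ^ 2)) := by
      have : -(((n + 1 : ℕ) : ℝ) * ζ ^ 2 / 4) = -((n + 1) / 4 * ζ ^ 2) := by push_cast; ring
      rw [this]; push_cast; ring
    rw [h6] at hpow
    linarith
  · have hmem : ζ ∉ Icc (-(1 / (8 * C))) (1 / (8 * C)) := fun h => hin.not_ge (abs_le.2 h)
    rw [indicator_of_notMem hmem, mul_zero, add_zero]
    have hF : ‖eFourier u w + eFourier v w‖ ≤ θ := by
      have := hout ζ hin.le
      rwa [← hzint, hz, norm_mul, Complex.norm_exp_ofReal_mul_I, one_mul] at this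
    refine (norm_sub_le _ _).trans ?_
    rw [norm_mul, Complex.norm_exp_ofReal_mul_I, one_mul, Complex.norm_real,
      Real.norm_of_nonneg (Real.exp_pos _).le]
    have h5 := norm_twoKernel_le u v n w hF hun
    have h6 : Real.exp (-((n + 2 : ℝ) * ζ ^ 2 / 2)) ≤
        Real.exp (-((n + 1) * (1 / (8 * C)) ^ 2 / 2)) * Real.exp (-(1 / 2) * ζ ^ 2) := by
      rw [← Real.exp_add]
      apply Real.exp_le_exp.2
      have : (1 / (8 * C)) ^ 2 ≤ ζ ^ 2 := by
        rw [← sq_abs ζ]; gcongr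
      have h7 : ((n : ℝ) + 1) * (1 / (8 * C)) ^ 2 ≤ (n + 1) * ζ ^ 2 := by gcongr
      linarith
    linarith

lemma integrable_abs_pow_mul_exp_neg_sq (k : ℕ) {a : ℝ} (ha : 0 < a) :
    Integrable fun x : ℝ => |x| ^ k * Real.exp (-(a * x ^ 2)) := by
  have h := integrable_rpow_mul_exp_neg_mul_sq ha (s := k) (by
    have : (0 : ℝ) ≤ k := k.cast_nonneg
    linarith)
  refine h.norm.congr (Eventually.of_forall fun x => ?_)
  simp [Real.norm_eq_abs, abs_of_pos (Real.exp_pos _)]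

lemma integral_abs_pow_mul_exp_neg_sq (k : ℕ) {a : ℝ} (ha : 0 < a) :
    ∫ x : ℝ, |x| ^ k * Real.exp (-(a * x ^ 2)) =
      (√a)⁻¹ ^ (k + 1) * ∫ x : ℝ, |x| ^ k * Real.exp (-x ^ 2) := by
  have hb : 0 < √a := Real.sqrt_pos.2 ha
  have h := Measure.integral_comp_mul_left (fun x : ℝ => |x| ^ k * Real.exp (-x ^ 2)) (√a)
  rw [abs_of_pos (inv_pos.2 hb), smul_eq_mul] at h
  rw [pow_succ, mul_assoc, ← h, ← integral_const_mul]
  refine integral_congr_ae (Eventually.of_forall fun x => ?_)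
  simp only [abs_mul, mul_pow, Real.sq_sqrt ha.le, abs_of_pos hb]
  rw [inv_pow, ← mul_assoc, ← mul_assoc, inv_mul_cancel₀ (by positivity), one_mul]

lemma integral_add_add_add {f₁ f₂ f₃ f₄ : ℝ → ℝ} (h₁ : Integrable f₁) (h₂ : Integrable f₂)
    (h₃ : Integrable f₃) (h₄ : Integrable f₄) :
    ∫ x, (f₁ x + f₂ x + f₃ x + f₄ x) = (∫ x, f₁ x) + (∫ x, f₂ x) + (∫ x, f₃ x) + ∫ x, f₄ x := by
  have e₁ := integral_add h₁ h₂
  have e₂ := integral_add (h₁.add h₂) h₃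
  have e₃ := integral_add ((h₁.add h₂).add h₃) h₄
  simp only [Pi.add_apply] at e₁ e₂ e₃
  rw [← e₁, ← e₂, ← e₃]

/-- Explicit local limit estimate with error of order `n`. -/
lemma abs_sqrt_mul_ePow_sub_one_le {u v : ℝ → ENNReal} (hu : Measurable u) (hv : Measurable v)
    (hmass : ∫⁻ x, (u x + v x) = 1) {m s θ η C M K : ℝ} (hs : 0 < s) (hη1 : η ≤ 1)
    (hC : 1 ≤ C) (hM0 : 0 ≤ M) (hM : ∀ x, v x ≤ ENNReal.ofReal (M / s))
    (hK : ∀ x, K ≤ x → u x = 0) (hmK : K ≤ m)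
    (hθ : (∫⁻ x, u x).toReal ≤ θ)
    (hi : ∀ k ≤ 4, Integrable (fun x => ((x - m) / s) ^ k * (u x + v x).toReal))
    (h1 : ∫ x, (x - m) / s * (u x + v x).toReal = 0)
    (h2 : ∫ x, ((x - m) / s) ^ 2 * (u x + v x).toReal = 1)
    (h3 : |∫ x, ((x - m) / s) ^ 3 * (u x + v x).toReal| ≤ η)
    (h4 : ∫ x, ((x - m) / s) ^ 4 * (u x + v x).toReal ≤ C)
    (hout : ∀ ζ, 1 / (8 * C) ≤ |ζ| →
      ‖∫ x, Complex.exp ((-ζ * ((x - m) / s) : ℝ) * Complex.I) * ((u x + v x).toReal : ℂ)‖ ≤ θ)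
    (n : ℕ) :
    |√(2 * π) * √(n + 2) * s * (ePow (u + v) (n + 1) ((n + 2) * m)).toReal - 1| ≤
      √(n + 2) * ((n + 2) * (η * ((√((n + 1) / 4))⁻¹ ^ 4 * ∫ x, |x| ^ 3 * Real.exp (-x ^ 2)) +
          5 * C * ((√((n + 1) / 4))⁻¹ ^ 5 * ∫ x, |x| ^ 4 * Real.exp (-x ^ 2))) +
        (n + 3) * θ ^ (n + 1) * (2 * (1 / (8 * C))) +
        (n + 1) ^ 2 * θ ^ n * (2 * π * M) +
        Real.exp (-((n + 1) * (1 / (8 * C)) ^ 2 / 2)) * √(2 * π)) +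
      √(2 * π) * √(n + 2) * ((n + 2) * M * θ ^ (n + 1)) := by
  have hum : ∫⁻ x, u x ≤ 1 := by rw [← hmass]; exact lintegral_mono fun x => le_self_add
  have hvm : ∫⁻ x, v x ≤ 1 := by rw [← hmass]; exact lintegral_mono fun x => le_add_self
  have hut : ∫⁻ x, u x ≠ ⊤ := ne_top_of_le_ne_top ENNReal.one_ne_top hum
  have hvt : ∫⁻ x, v x ≠ ⊤ := ne_top_of_le_ne_top ENNReal.one_ne_top hvm
  have hθ0 : 0 ≤ θ := ENNReal.toReal_nonneg.trans hθ
  have hMs : 0 ≤ M / s := by positivity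
  have hp := Real.pi_pos
  set N : ℝ := n + 2 with hN
  have hNpos : 0 < N := by positivity
  set r := twoKernel u v (n + 1) with hr
  have hc : 0 < 2 * π * s := by positivity
  -- the rescaled inverse Fourier transform
  have hinv : ((2 * π * s : ℝ) : ℂ) * 𝓕⁻ r (N * m) =
      ∫ ζ : ℝ, Complex.exp ((ζ * (N * m) / s : ℝ) * Complex.I) * r (ζ / (2 * π * s)) := by
    rw [Real.fourierInv_eq']
    have := Measure.integral_comp_div (fun w : ℝ =>
      Complex.exp ((2 * π * inner ℝ w (N * m) : ℝ) * Complex.I) • r w) (2 * π * s)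
    rw [abs_of_pos hc] at this
    rw [← Complex.real_smul, ← this]
    refine integral_congr_ae (Eventually.of_forall fun ζ => ?_)
    simp only [smul_eq_mul, RCLike.inner_apply, conj_trivial]
    congr 4
    field_simp
  have hrint : Integrable r := integrable_twoKernel hu hv hut hvt hM hMs (n + 1)
  have hA : Integrable fun ζ : ℝ =>
      Complex.exp ((ζ * (N * m) / s : ℝ) * Complex.I) * r (ζ / (2 * π * s)) := by
    refine (hrint.comp_div hc.ne').bdd_mul (c := 1)
      (Measurable.aestronglyMeasurable (by fun_prop)) (Eventually.of_forall fun x => ?_)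
    rw [Complex.norm_exp_ofReal_mul_I]
  have hBr : Integrable fun ζ : ℝ => Real.exp (-(N * ζ ^ 2 / 2)) := by
    refine (integrable_exp_neg_mul_sq (half_pos hNpos)).congr (Eventually.of_forall fun ζ => ?_)
    simp only; congr 1; ring
  have hBint : ∫ ζ : ℝ, Real.exp (-(N * ζ ^ 2 / 2)) = √(2 * π) / √N := by
    have := integral_gaussian (N / 2)
    rw [← Real.sqrt_div (by positivity), show 2 * π / N = π / (N / 2) by field_simp, ← this]
    refine integral_congr_ae (Eventually.of_forall fun ζ => ?_)
    simp only; congr 1; ring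
  have hsq := integrable_eFourier_sq hv hvt hM hMs
  set κ := 1 / (8 * C) with hκ
  have hκ0 : 0 < κ := by positivity
  have hdiff : ‖∫ ζ : ℝ, (Complex.exp ((ζ * (N * m) / s : ℝ) * Complex.I) *
      r (ζ / (2 * π * s)) - (Real.exp (-(N * ζ ^ 2 / 2)) : ℂ))‖ ≤
      N * (η * ((√((n + 1) / 4))⁻¹ ^ 4 * ∫ x, |x| ^ 3 * Real.exp (-x ^ 2)) +
          5 * C * ((√((n + 1) / 4))⁻¹ ^ 5 * ∫ x, |x| ^ 4 * Real.exp (-x ^ 2))) +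
        (n + 3) * θ ^ (n + 1) * (2 * κ) +
        (n + 1) ^ 2 * θ ^ n * (2 * π * M) +
        Real.exp (-((n + 1) * κ ^ 2 / 2)) * √(2 * π) := by
    have ha : (0 : ℝ) < (n + 1) / 4 := by positivity
    have i3 := integrable_abs_pow_mul_exp_neg_sq 3 ha
    have i4 := integrable_abs_pow_mul_exp_neg_sq 4 ha
    have I1 : Integrable fun ζ : ℝ => N * (η * |ζ| ^ 3 + 5 * C * ζ ^ 4) *
        Real.exp (-((n + 1) / 4 * ζ ^ 2)) := by
      refine (((i3.const_mul η).add (i4.const_mul (5 * C))).const_mul N).congr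
        (Eventually.of_forall fun ζ => ?_)
      simp only [Pi.add_apply, Even.pow_abs (by decide : Even 4)]; ring
    have I2 : Integrable fun ζ : ℝ => (n + 3) * θ ^ (n + 1) *
        (Icc (-κ) κ).indicator (1 : ℝ → ℝ) ζ :=
      (IntegrableOn.integrable_indicator (integrable_const (1 : ℝ)) measurableSet_Icc).const_mul _
    have I3 : Integrable fun ζ : ℝ => (n + 1) ^ 2 * θ ^ n *
        ‖eFourier v (ζ / (2 * π * s))‖ ^ 2 := (hsq.1.comp_div hc.ne').const_mul _
    have I4 : Integrable fun ζ : ℝ => Real.exp (-((n + 1) * κ ^ 2 / 2)) *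
        Real.exp (-(1 / 2) * ζ ^ 2) := (integrable_exp_neg_mul_sq (by norm_num)).const_mul _
    refine (norm_integral_le_of_norm_le (((I1.add I2).add I3).add I4)
      (Eventually.of_forall fun ζ => norm_twoKernel_sub_gaussian_le hu hv hmass hs hη1 hC hθ hi
        h1 h2 h3 h4 hout n ζ)).trans ?_
    have E : ∫ ζ, (N * (η * |ζ| ^ 3 + 5 * C * ζ ^ 4) * Real.exp (-((n + 1) / 4 * ζ ^ 2)) +
        (n + 3) * θ ^ (n + 1) * (Icc (-κ) κ).indicator (1 : ℝ → ℝ) ζ +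
        (n + 1) ^ 2 * θ ^ n * ‖eFourier v (ζ / (2 * π * s))‖ ^ 2 +
        Real.exp (-((n + 1) * κ ^ 2 / 2)) * Real.exp (-(1 / 2) * ζ ^ 2)) =
        (∫ ζ, N * (η * |ζ| ^ 3 + 5 * C * ζ ^ 4) * Real.exp (-((n + 1) / 4 * ζ ^ 2))) +
        (∫ ζ, (n + 3) * θ ^ (n + 1) * (Icc (-κ) κ).indicator (1 : ℝ → ℝ) ζ) +
        (∫ ζ, (n + 1) ^ 2 * θ ^ n * ‖eFourier v (ζ / (2 * π * s))‖ ^ 2) +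
        ∫ ζ, Real.exp (-((n + 1) * κ ^ 2 / 2)) * Real.exp (-(1 / 2) * ζ ^ 2) := by
      exact integral_add_add_add I1 I2 I3 I4
    refine E.le.trans ?_
    gcongr ?_ + ?_ + ?_ + ?_
    · refine le_of_eq ?_
      have e1 := integral_abs_pow_mul_exp_neg_sq 3 ha
      have e2 := integral_abs_pow_mul_exp_neg_sq 4 ha
      rw [← e1, ← e2, ← integral_const_mul, ← integral_const_mul, ← integral_add
        (i3.const_mul η) (i4.const_mul (5 * C)), ← integral_const_mul]
      refine integral_congr_ae (Eventually.of_forall fun ζ => ?_)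
      simp only [Even.pow_abs (by decide : Even 4)]; ring
    · rw [integral_const_mul, integral_indicator_one measurableSet_Icc]
      rw [Measure.real, Real.volume_Icc, ENNReal.toReal_ofReal (by linarith)]
      gcongr; linarith
    · rw [integral_const_mul, Measure.integral_comp_div (fun w => ‖eFourier v w‖ ^ 2),
        abs_of_pos hc, smul_eq_mul]
      refine mul_le_mul_of_nonneg_left ?_ (by positivity)
      calc 2 * π * s * ∫ w, ‖eFourier v w‖ ^ 2 ≤ 2 * π * s * (M / s * (∫⁻ x, v x).toReal) := by
            gcongr; exact hsq.2
        _ ≤ 2 * π * s * (M / s * 1) := by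
            gcongr; simpa using ENNReal.toReal_mono ENNReal.one_ne_top hvm
        _ = 2 * π * M := by field_simp
    · rw [integral_const_mul, integral_gaussian]
      refine le_of_eq ?_
      congr 2
      ring
  have hsplit : ∫ ζ : ℝ, (Complex.exp ((ζ * (N * m) / s : ℝ) * Complex.I) *
      r (ζ / (2 * π * s)) - (Real.exp (-(N * ζ ^ 2 / 2)) : ℂ)) =
      ((2 * π * s : ℝ) : ℂ) * 𝓕⁻ r (N * m) - ((√(2 * π) / √N : ℝ) : ℂ) := by
    rw [hinv, ← hBint, ← integral_complex_ofReal]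
    exact integral_sub hA hBr.ofReal
  rw [hsplit] at hdiff
  have hmain := norm_ePow_sub_fourierInv_le hu hv hut hvt hM hMs hK (n + 1) (x := N * m) (by
    push_cast
    rw [show ((n : ℝ) + 1 + 1) = N by rw [hN]; ring]
    gcongr)
  set e := (ePow (u + v) (n + 1) (N * m)).toReal with he
  have hsN : 0 < √N := Real.sqrt_pos.2 hNpos
  have hs2 : 0 < √(2 * π) := Real.sqrt_pos.2 (by positivity)
  have hs1 : 1 ≤ √(2 * π) := by
    rw [Real.one_le_sqrt]; have := Real.two_le_pi; linarith
  have hss : √(2 * π) * √(2 * π) = 2 * π := Real.mul_self_sqrt (by positivity)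
  have key : ((√(2 * π) * √N * s * e - 1 : ℝ) : ℂ) =
      ((√(2 * π) * √N * s : ℝ) : ℂ) * ((e : ℂ) - 𝓕⁻ r (N * m)) +
      ((√N / √(2 * π) : ℝ) : ℂ) * (((2 * π * s : ℝ) : ℂ) * 𝓕⁻ r (N * m) -
        ((√(2 * π) / √N : ℝ) : ℂ)) := by
    rw [mul_sub, mul_sub, ← mul_assoc, ← Complex.ofReal_mul, ← Complex.ofReal_mul,
      ← Complex.ofReal_mul]
    have a1 : √N / √(2 * π) * (2 * π * s) = √(2 * π) * √N * s := by
      rw [show 2 * π * s = √(2 * π) * √(2 * π) * s by rw [hss]]; field_simp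
    have a2 : √N / √(2 * π) * (√(2 * π) / √N) = 1 := by field_simp
    rw [a1, a2]; push_cast; ring
  have hn := congrArg (fun z : ℂ => ‖z‖) key
  simp only [Complex.norm_real, Real.norm_eq_abs] at hn
  rw [hn, add_comm]
  refine (norm_add_le _ _).trans (add_le_add ?_ ?_)
  · rw [norm_mul, Complex.norm_real, Real.norm_of_nonneg (by positivity)]
    exact mul_le_mul (div_le_self hsN.le hs1) hdiff (norm_nonneg _) hsN.le
  · rw [norm_mul, Complex.norm_real, Real.norm_of_nonneg (by positivity)]
    have hmain' : ‖((e : ℝ) : ℂ) - 𝓕⁻ r (N * m)‖ ≤ N * (M / s) * θ ^ (n + 1) := by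
      refine hmain.trans ?_
      have : (((n + 1 : ℕ) : ℝ) + 1) = N := by rw [hN]; push_cast; ring
      rw [this]
      gcongr
    calc √(2 * π) * √N * s * ‖(e : ℂ) - 𝓕⁻ r (N * m)‖
        ≤ √(2 * π) * √N * s * (N * (M / s) * θ ^ (n + 1)) := by gcongr
      _ = √(2 * π) * √N * (N * M * θ ^ (n + 1)) := by field_simp

lemma tendsto_nat_add_mul_pow_mul_pow {θ : ℝ} (h0 : 0 ≤ θ) (h1 : θ < 1) (k : ℕ) :
    Tendsto (fun n : ℕ => ((n : ℝ) + 3) ^ k * θ ^ n) atTop (𝓝 0) := by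
  have h : Tendsto (fun n : ℕ => 4 ^ k * ((n : ℝ) ^ k * θ ^ n)) atTop (𝓝 0) := by
    simpa using (tendsto_pow_const_mul_const_pow_of_abs_lt_one k
      (by rwa [abs_of_nonneg h0])).const_mul ((4 : ℝ) ^ k)
  refine squeeze_zero' (Eventually.of_forall fun n => by positivity) ?_ h
  filter_upwards [eventually_ge_atTop 1] with n hn
  have : (1 : ℝ) ≤ n := by exact_mod_cast hn
  rw [← mul_assoc, ← mul_pow]
  gcongr
  linarith

/-- Uniform local limit estimate at the mean, with error `o (1 / √n)`. -/
lemma exists_abs_sqrt_mul_ePow_sub_one_le {C M θ : ℝ} (hC : 1 ≤ C) (hM0 : 0 ≤ M)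
    (hθ0 : 0 ≤ θ) (hθ1 : θ < 1) {δ : ℝ} (hδ : 0 < δ) :
    ∃ η > 0, ∃ n₀ : ℕ, ∀ (u v : ℝ → ENNReal) (m s K : ℝ), Measurable u → Measurable v →
      ∫⁻ x, (u x + v x) = 1 → 0 < s → (∀ x, v x ≤ ENNReal.ofReal (M / s)) →
      (∀ x, K ≤ x → u x = 0) → K ≤ m → (∫⁻ x, u x).toReal ≤ θ →
      (∀ k ≤ 4, Integrable (fun x => ((x - m) / s) ^ k * (u x + v x).toReal)) →
      ∫ x, (x - m) / s * (u x + v x).toReal = 0 →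
      ∫ x, ((x - m) / s) ^ 2 * (u x + v x).toReal = 1 →
      |∫ x, ((x - m) / s) ^ 3 * (u x + v x).toReal| ≤ η →
      ∫ x, ((x - m) / s) ^ 4 * (u x + v x).toReal ≤ C →
      (∀ ζ, 1 / (8 * C) ≤ |ζ| →
        ‖∫ x, Complex.exp ((-ζ * ((x - m) / s) : ℝ) * Complex.I) * ((u x + v x).toReal : ℂ)‖ ≤
          θ) →
      ∀ n ≥ n₀, √(n + 2) *
        |√(2 * π) * √(n + 2) * s * (ePow (u + v) (n + 1) ((n + 2) * m)).toReal - 1| ≤ δ := by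
  have hp := Real.pi_pos
  set J₃ := ∫ x : ℝ, |x| ^ 3 * Real.exp (-x ^ 2) with hJ₃
  set J₄ := ∫ x : ℝ, |x| ^ 4 * Real.exp (-x ^ 2) with hJ₄
  have hJ₃0 : 0 ≤ J₃ := integral_nonneg fun x => by positivity
  have hJ₄0 : 0 ≤ J₄ := integral_nonneg fun x => by positivity
  set κ := 1 / (8 * C) with hκ
  have hκ0 : 0 < κ := by positivity
  set R : ℕ → ℝ := fun n => 320 * C * J₄ * (√((n + 1) / 4))⁻¹ +
      2 * κ * (((n : ℝ) + 3) ^ 2 * θ ^ n) + 2 * π * M * (((n : ℝ) + 3) ^ 3 * θ ^ n) +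
      √(2 * π) * (((n : ℝ) + 3) ^ 1 * Real.exp (-(κ ^ 2 / 2)) ^ n) +
      √(2 * π) * M * (((n : ℝ) + 3) ^ 2 * θ ^ n) with hR
  have hRlim : Tendsto R atTop (𝓝 0) := by
    have hs : Tendsto (fun n : ℕ => (√(((n : ℝ) + 1) / 4))⁻¹) atTop (𝓝 0) := by
      refine tendsto_inv_atTop_zero.comp (Real.tendsto_sqrt_atTop.comp ?_)
      exact (tendsto_atTop_add_const_right _ _ tendsto_natCast_atTop_atTop).atTop_div_const
        (by norm_num)
    have he : Real.exp (-(κ ^ 2 / 2)) < 1 := by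
      rw [← Real.exp_zero]
      apply Real.exp_lt_exp.2
      have : 0 < κ ^ 2 := by positivity
      linarith
    have := ((((hs.const_mul (320 * C * J₄)).add
      ((tendsto_nat_add_mul_pow_mul_pow hθ0 hθ1 2).const_mul (2 * κ))).add
      ((tendsto_nat_add_mul_pow_mul_pow hθ0 hθ1 3).const_mul (2 * π * M))).add
      ((tendsto_nat_add_mul_pow_mul_pow (Real.exp_pos _).le he 1).const_mul (√(2 * π)))).add
      ((tendsto_nat_add_mul_pow_mul_pow hθ0 hθ1 2).const_mul (√(2 * π) * M))
    simpa [hR] using this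
  obtain ⟨n₀, hn₀⟩ := eventually_atTop.1 (hRlim.eventually (gt_mem_nhds (half_pos hδ)))
  refine ⟨min 1 (δ / (2 * (64 * J₃ + 1))), by positivity, n₀, ?_⟩
  intro u v m s K hu hv hmass hs hM hK hmK hθ hi h1 h2 h3 h4 hout n hn
  have hη1 := min_le_left 1 (δ / (2 * (64 * J₃ + 1)))
  have hη2 := min_le_right 1 (δ / (2 * (64 * J₃ + 1)))
  set η := min 1 (δ / (2 * (64 * J₃ + 1))) with hη
  have hη0 : 0 ≤ η := by positivity
  have key := abs_sqrt_mul_ePow_sub_one_le hu hv hmass hs hη1 hC hM0 hM hK hmK hθ hi h1 h2 h3 h4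
    hout n
  rw [← hJ₃, ← hJ₄, ← hκ] at key
  have hηδ : 64 * J₃ * η ≤ δ / 2 := by
    have : (64 * J₃ + 1) * η ≤ δ / 2 := by
      calc (64 * J₃ + 1) * η ≤ (64 * J₃ + 1) * (δ / (2 * (64 * J₃ + 1))) := by gcongr
        _ = δ / 2 := by field_simp
    linarith
  have hRn := hn₀ n hn
  set b := (√(((n : ℝ) + 1) / 4))⁻¹ with hb
  have hb0 : 0 ≤ b := by positivity
  have hN : (√((n : ℝ) + 2)) ^ 2 = n + 2 := Real.sq_sqrt (by positivity)
  have hb4 : ((n : ℝ) + 2) ^ 2 * b ^ 4 ≤ 64 := by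
    have : b ^ 4 = (((n : ℝ) + 1) / 4)⁻¹ ^ 2 := by
      rw [hb, inv_pow, inv_pow, show (4 : ℕ) = 2 * 2 from rfl, pow_mul,
        Real.sq_sqrt (by positivity)]
    rw [this, ← mul_pow, show (64 : ℝ) = 8 ^ 2 by norm_num]
    gcongr
    rw [← div_eq_mul_inv, div_le_iff₀ (by positivity)]
    have : (0 : ℝ) ≤ n := n.cast_nonneg
    linarith
  have hθn : θ ^ (n + 1) ≤ θ ^ n := pow_le_pow_of_le_one hθ0 hθ1.le (by omega)
  have hexp : Real.exp (-((n + 1) * κ ^ 2 / 2)) ≤ Real.exp (-(κ ^ 2 / 2)) ^ n := by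
    rw [← Real.exp_nat_mul]
    apply Real.exp_le_exp.2
    have : 0 ≤ κ ^ 2 := by positivity
    linarith
  have hn0 : (0 : ℝ) ≤ n := n.cast_nonneg
  calc √(n + 2) * |√(2 * π) * √(n + 2) * s * (ePow (u + v) (n + 1) ((n + 2) * m)).toReal - 1|
      ≤ √(n + 2) * (√(n + 2) * ((n + 2) * (η * (b ^ 4 * J₃) + 5 * C * (b ^ 5 * J₄)) +
        (n + 3) * θ ^ (n + 1) * (2 * κ) + (n + 1) ^ 2 * θ ^ n * (2 * π * M) +
        Real.exp (-((n + 1) * κ ^ 2 / 2)) * √(2 * π)) +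
        √(2 * π) * √(n + 2) * ((n + 2) * M * θ ^ (n + 1))) := by gcongr
    _ = (√(n + 2)) ^ 2 * ((n + 2) * (η * (b ^ 4 * J₃) + 5 * C * (b ^ 5 * J₄)) +
        (n + 3) * θ ^ (n + 1) * (2 * κ) + (n + 1) ^ 2 * θ ^ n * (2 * π * M) +
        Real.exp (-((n + 1) * κ ^ 2 / 2)) * √(2 * π) +
        √(2 * π) * ((n + 2) * M * θ ^ (n + 1))) := by ring
    _ = ((n + 2) ^ 2 * b ^ 4) * (J₃ * η) + ((n + 2) ^ 2 * b ^ 4) * (5 * C * J₄ * b) +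
        2 * κ * ((n + 2) * (n + 3) * θ ^ (n + 1)) +
        2 * π * M * ((n + 2) * (n + 1) ^ 2 * θ ^ n) +
        √(2 * π) * ((n + 2) * Real.exp (-((n + 1) * κ ^ 2 / 2))) +
        √(2 * π) * M * ((n + 2) * (n + 2) * θ ^ (n + 1)) := by rw [hN]; ring
    _ ≤ 64 * (J₃ * η) + 64 * (5 * C * J₄ * b) +
        2 * κ * ((n + 3) * (n + 3) * θ ^ n) +
        2 * π * M * ((n + 3) * (n + 3) ^ 2 * θ ^ n) +
        √(2 * π) * ((n + 3) * Real.exp (-(κ ^ 2 / 2)) ^ n) +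
        √(2 * π) * M * ((n + 3) * (n + 3) * θ ^ n) := by
        gcongr <;> linarith
    _ = 64 * J₃ * η + R n := by rw [hR]; ring
    _ ≤ δ := by linarith

lemma convPow_tilt (p : ℝ → ℝ) (t : ℝ) (n : ℕ) (x : ℝ) :
    convPow (tilt p t) (n + 1) x =
      Real.exp (t * x) * convPow p (n + 1) x / mgfFun p t ^ (n + 1) := by
  induction n generalizing x with
  | zero => simp [convPow, tilt]
  | succ n ih =>
    have h1 : convPow (tilt p t) (n + 1 + 1) x =
        ∫ y, tilt p t y * convPow (tilt p t) (n + 1) (x - y) := rfl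
    have h2 : convPow p (n + 1 + 1) x = ∫ y, p y * convPow p (n + 1) (x - y) := rfl
    rw [h1, h2, ← integral_const_mul, ← integral_div]
    congr 1; ext y
    rw [ih, tilt]
    have : Real.exp (t * x) = Real.exp (t * y) * Real.exp (t * (x - y)) := by
      rw [← Real.exp_add]; congr 1; ring
    rw [this, pow_succ (mgfFun p t) (n + 1)]
    ring

lemma convPow_eq_toReal_ePow {f : ℝ → ℝ} {e : ℝ → ENNReal} (he : Measurable e)
    (hfe : ∀ᵐ x, f x = (e x).toReal) (hi : ∫⁻ x, e x ≠ ⊤) (n : ℕ) (x : ℝ) :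
    convPow f (n + 2) x = (ePow e (n + 1) x).toReal := by
  have hstep : ∀ (n : ℕ), (∀ᵐ x, convPow f (n + 1) x = (ePow e n x).toReal) →
      ∀ x, convPow f (n + 2) x = (ePow e (n + 1) x).toReal := by
    intro n hn x
    have h1 : convPow f (n + 2) x = ∫ y, f y * convPow f (n + 1) (x - y) := rfl
    have h2 : ePow e (n + 1) x = eConv e (ePow e n) x := rfl
    rw [h1, h2, toReal_eConv he (measurable_ePow he n) hi
      (by rw [lintegral_ePow he]; exact ENNReal.pow_ne_top hi)]
    have h3 := (Measure.measurePreserving_sub_left volume x).quasiMeasurePreserving.ae hn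
    refine integral_congr_ae ?_
    filter_upwards [hfe, h3] with y h4 h5
    rw [h4, h5]
  have hall : ∀ n : ℕ, ∀ᵐ x, convPow f (n + 1) x = (ePow e n x).toReal := by
    intro n
    induction n with
    | zero => exact hfe
    | succ n ih => exact Eventually.of_forall (hstep n ih)
  exact hstep n (hall n) x

section

open ProbabilityTheory (mgf cgf integrableExpSet)

section MomentGenerating

variable {p : ℝ → ℝ}

lemma mgfFun_eq_integral (hpz : ∀ x < 0, p x = 0) (t : ℝ) :
    mgfFun p t = ∫ x, Real.exp (t * x) * p x :=
  setIntegral_eq_integral_of_forall_compl_eq_zero fun x hx => by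
    rw [hpz x (not_le.1 hx), mul_zero]

lemma integrable_density (hpz : ∀ x < 0, p x = 0)
    (hpdens : (∫ x in Set.Ici (0:ℝ), p x) = 1) : Integrable p := by
  have h : IntegrableOn p (Ici 0) := not_imp_comm.1 integral_undef (by rw [hpdens]; norm_num)
  exact (integrableOn_iff_integrable_of_support_subset fun x hx => by
    by_contra h'
    exact hx (hpz x (not_le.1 h'))).1 h

lemma integrable_exp_mul_density (hp0 : ∀ x, 0 ≤ p x) (hpz : ∀ x < 0, p x = 0)
    (hpdens : (∫ x in Set.Ici (0:ℝ), p x) = 1)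
    (hPhi : ∀ t > (0:ℝ), IntegrableOn (fun x => Real.exp (t * x) * p x) (Set.Ici 0)) (t : ℝ) :
    Integrable fun x => Real.exp (t * x) * p x := by
  have hp := integrable_density hpz hpdens
  rcases le_or_gt t 0 with ht | ht
  · refine hp.mono' ((Measurable.aestronglyMeasurable (by fun_prop)).mul hp.1)
      (Eventually.of_forall fun x => ?_)
    rw [Real.norm_of_nonneg (mul_nonneg (Real.exp_pos _).le (hp0 x))]
    rcases lt_or_ge x 0 with hx | hx
    · simp [hpz x hx]
    · exact mul_le_of_le_one_left (hp0 x)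
        (Real.exp_le_one_iff.2 (mul_nonpos_of_nonpos_of_nonneg ht hx))
  · exact (integrableOn_iff_integrable_of_support_subset fun x hx => by
      by_contra h'
      exact hx (by simp only [hpz x (not_le.1 h'), mul_zero])).1 (hPhi t ht)

variable (p) in
/-- The measure with density `p`. -/
def densityMeasure : Measure ℝ := volume.withDensity fun x => ENNReal.ofReal (p x)

lemma integral_densityMeasure (hp0 : ∀ x, 0 ≤ p x) (hp : Integrable p) (f : ℝ → ℝ) :
    ∫ x, f x ∂densityMeasure p = ∫ x, f x * p x := by
  rw [densityMeasure, integral_withDensity_eq_integral_toReal_smul₀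
    hp.1.aemeasurable.ennreal_ofReal (Eventually.of_forall fun x => ENNReal.ofReal_lt_top)]
  simp only [ENNReal.toReal_ofReal (hp0 _), smul_eq_mul, mul_comm]

lemma integrable_densityMeasure (hp0 : ∀ x, 0 ≤ p x) (hp : Integrable p) (f : ℝ → ℝ) :
    Integrable f (densityMeasure p) ↔ Integrable fun x => f x * p x := by
  rw [densityMeasure, integrable_withDensity_iff_integrable_smul₀'
    hp.1.aemeasurable.ennreal_ofReal (Eventually.of_forall fun x => ENNReal.ofReal_lt_top)]
  simp only [ENNReal.toReal_ofReal (hp0 _), smul_eq_mul, mul_comm]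

section

variable (hp0 : ∀ x, 0 ≤ p x) (hpz : ∀ x < 0, p x = 0)
    (hpdens : (∫ x in Set.Ici (0:ℝ), p x) = 1)
    (hPhi : ∀ t > (0:ℝ), IntegrableOn (fun x => Real.exp (t * x) * p x) (Set.Ici 0))

include hp0 hpz hpdens

lemma mgfFun_eq_mgf (t : ℝ) : mgfFun p t = mgf id (densityMeasure p) t := by
  rw [mgfFun_eq_integral hpz, mgf, integral_densityMeasure hp0 (integrable_density hpz hpdens)]
  rfl

lemma mFun_eq_deriv_cgf : mFun p = deriv (cgf id (densityMeasure p)) := by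
  unfold mFun cgf
  congr 1
  ext t
  rw [mgfFun_eq_mgf hp0 hpz hpdens]

include hPhi

lemma integrableExpSet_eq_univ : integrableExpSet id (densityMeasure p) = univ :=
  eq_univ_of_forall fun t => (integrable_densityMeasure hp0 (integrable_density hpz hpdens) _).2
    (integrable_exp_mul_density hp0 hpz hpdens hPhi t)

lemma mem_interior_integrableExpSet (t : ℝ) :
    t ∈ interior (integrableExpSet id (densityMeasure p)) := by
  rw [integrableExpSet_eq_univ hp0 hpz hpdens hPhi, interior_univ]; trivial

lemma integrable_pow_mul_exp_density (k : ℕ) (t : ℝ) :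
    Integrable fun x => x ^ k * (Real.exp (t * x) * p x) := by
  have := (integrable_densityMeasure hp0 (integrable_density hpz hpdens) _).1
    (ProbabilityTheory.integrable_pow_mul_exp_of_mem_interior_integrableExpSet
      (mem_interior_integrableExpSet hp0 hpz hpdens hPhi t) k)
  simpa only [id, mul_assoc] using this

lemma mgfFun_pos (t : ℝ) : 0 < mgfFun p t := by
  rw [mgfFun_eq_mgf hp0 hpz hpdens]
  refine ProbabilityTheory.mgf_pos' (fun h => ?_)
    (interior_subset (s := integrableExpSet id (densityMeasure p))
      (mem_interior_integrableExpSet hp0 hpz hpdens hPhi t))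
  have h1 := integral_densityMeasure hp0 (integrable_density hpz hpdens) (fun _ => 1)
  have h2 : ∫ x, p x = 1 := by
    rw [← hpdens]
    exact (setIntegral_eq_integral_of_forall_compl_eq_zero
      fun x hx => hpz x (not_le.1 hx)).symm
  simp [h, h2] at h1

lemma mFun_eq_div (t : ℝ) :
    mFun p t = (∫ x, x * (Real.exp (t * x) * p x)) / mgfFun p t := by
  rw [mFun_eq_deriv_cgf hp0 hpz hpdens, ProbabilityTheory.deriv_cgf
    (mem_interior_integrableExpSet hp0 hpz hpdens hPhi t), mgfFun_eq_mgf hp0 hpz hpdens,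
    integral_densityMeasure hp0 (integrable_density hpz hpdens)]
  simp only [id, mul_assoc]

lemma s2Fun_eq_div (t : ℝ) :
    s2Fun p t = (∫ x, (x - mFun p t) ^ 2 * (Real.exp (t * x) * p x)) / mgfFun p t := by
  have h := ProbabilityTheory.iteratedDeriv_two_cgf_eq_integral
    (mem_interior_integrableExpSet hp0 hpz hpdens hPhi t)
  rw [iteratedDeriv_succ, iteratedDeriv_one, ← mFun_eq_deriv_cgf hp0 hpz hpdens,
    ← mgfFun_eq_mgf hp0 hpz hpdens, integral_densityMeasure hp0 (integrable_density hpz hpdens)]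
    at h
  simp only [id, mul_assoc] at h
  exact h

lemma monotone_mFun : Monotone (mFun p) := by
  have hd : Differentiable ℝ (mFun p) := fun t => by
    rw [mFun_eq_deriv_cgf hp0 hpz hpdens]
    exact (ProbabilityTheory.analyticAt_cgf
      (mem_interior_integrableExpSet hp0 hpz hpdens hPhi t)).deriv.differentiableAt
  refine monotone_of_deriv_nonneg hd fun t => ?_
  change 0 ≤ s2Fun p t
  rw [s2Fun_eq_div hp0 hpz hpdens hPhi]
  exact div_nonneg (integral_nonneg fun x => mul_nonneg (sq_nonneg _)
    (mul_nonneg (Real.exp_pos _).le (hp0 x))) (mgfFun_pos hp0 hpz hpdens hPhi t).le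

end

end MomentGenerating

end

lemma hasDerivAt_exp_integral_div {ε : ℝ → ℝ} (hε : Continuous ε) {x : ℝ} (hx : 1 < x) :
    HasDerivAt (fun x => Real.exp (∫ u in (1:ℝ)..x, ε u / u))
      (Real.exp (∫ u in (1:ℝ)..x, ε u / u) * (ε x / x)) x := by
  have hc : ContinuousOn (fun u => ε u / u) (Ioi 0) :=
    hε.continuousOn.div continuousOn_id fun u hu => (ne_of_gt hu)
  refine HasDerivAt.exp (intervalIntegral.integral_hasDerivAt_right ?_ ?_ ?_)
  · refine (hc.mono fun u hu => ?_).intervalIntegrable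
    rw [uIcc_of_le hx.le] at hu
    exact lt_of_lt_of_le one_pos hu.1
  · exact hc.stronglyMeasurableAtFilter isOpen_Ioi x (one_pos.trans hx)
  · exact hc.continuousAt (Ioi_mem_nhds (one_pos.trans hx))

lemma tendsto_deriv_atTop_of_monotoneOn {g h : ℝ → ℝ} {K : ℝ}
    (hglim : Tendsto (fun x => g x / x) atTop atTop) (hg : ∀ x, HasDerivAt g (h x) x)
    (hm : MonotoneOn h (Ici K)) : Tendsto h atTop atTop := by
  have hd : ∀ x, deriv g x = h x := fun x => (hg x).deriv
  rw [tendsto_atTop]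
  intro b
  have h1 : ∀ᶠ x in atTop, |b| + |g (max K 1)| + 1 ≤ g x / x := hglim.eventually_ge_atTop _
  filter_upwards [h1, eventually_gt_atTop (max K 1)] with x hx hxK
  have hK1 : 1 ≤ max K 1 := le_max_right _ _
  have hx1 : 1 < x := hK1.trans_lt hxK
  obtain ⟨y, hy, hyx⟩ := exists_hasDerivAt_eq_slope g h hxK
    (fun y _ => (hg y).continuousAt.continuousWithinAt) (fun y _ => hg y)
  have h2 : h y ≤ h x := hm ((le_max_left K 1).trans hy.1.le)
    ((le_max_left K 1).trans hxK.le) hy.2.le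
  refine le_trans ?_ h2
  rw [hyx, le_div_iff₀ (by linarith)]
  rw [le_div_iff₀ (by linarith)] at hx
  have h3 : b * (x - max K 1) ≤ |b| * x := by
    calc b * (x - max K 1) ≤ |b| * (x - max K 1) :=
          mul_le_mul_of_nonneg_right (le_abs_self b) (by linarith)
      _ ≤ |b| * x := by gcongr; linarith
  have h4 : g (max K 1) ≤ |g (max K 1)| * x :=
    (le_abs_self _).trans (le_mul_of_one_le_right (abs_nonneg _) hx1.le)
  nlinarith

/-- `h` has a derivative `1 / V` that varies slowly at the scale `√V`. -/
def HasSlowScale (h V V' : ℝ → ℝ) : Prop :=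
  (∀ᶠ x in atTop, 0 < V x ∧ HasDerivAt h (1 / V x) x ∧ HasDerivAt V (V' x) x) ∧
    Tendsto (fun x => V' x / √(V x)) atTop (𝓝 0)

lemma MemRbeta.exists_hasSlowScale {g h : ℝ → ℝ} {β : ℝ} (hh : MemRbeta h β)
    (hglim : Tendsto (fun x => g x / x) atTop atTop) (hg : ∀ x, HasDerivAt g (h x) x) :
    Tendsto h atTop atTop ∧ ∃ V V', HasSlowScale h V V' := by
  obtain ⟨hβ, l, ε, ε', ε'', ⟨hε, -, hε0, hl⟩, hhl, ⟨C, hC⟩, -⟩ := hh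
  have hεc : Continuous ε := continuous_iff_continuousAt.2 fun x => (hε x).continuousAt
  obtain ⟨X, hX⟩ := eventually_atTop.1 hhl
  -- the logarithmic derivative
  have hpos : ∀ᶠ x in atTop, 0 < h x ∧ HasDerivAt h (h x * (β + ε x) / x) x := by
    filter_upwards [eventually_gt_atTop X, eventually_gt_atTop 1] with x hxX hx1
    have hx0 : 0 < x := one_pos.trans hx1
    have hform : ∀ y, X ≤ y → 1 ≤ y → h y = y ^ β * Real.exp (∫ u in (1:ℝ)..y, ε u / u) :=
      fun y h1 h2 => by rw [hX y h1, hl y h2]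
    have heq : h =ᶠ[𝓝 x] fun y => y ^ β * Real.exp (∫ u in (1:ℝ)..y, ε u / u) := by
      filter_upwards [lt_mem_nhds hxX, lt_mem_nhds hx1] with y h1 h2 using hform y h1.le h2.le
    have hd := ((Real.hasDerivAt_rpow_const (p := β) (Or.inl hx0.ne')).mul
      (hasDerivAt_exp_integral_div hεc hx1)).congr_of_eventuallyEq heq
    refine ⟨by rw [hform x hxX.le hx1.le]; positivity, hd.congr_deriv ?_⟩
    rw [hform x hxX.le hx1.le, Real.rpow_sub_one hx0.ne']
    field_simp
  have hβε : ∀ᶠ x in atTop, β / 2 < β + ε x ∧ β + ε x < 2 * β := by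
    filter_upwards [hε0.eventually (Ioo_mem_nhds (a := -(β / 2)) (b := β / 2) (by linarith)
      (by linarith))] with x hx
    exact ⟨by linarith [hx.1], by linarith [hx.2]⟩
  have hlim : Tendsto h atTop atTop := by
    obtain ⟨Y, hY⟩ := eventually_atTop.1 ((hpos.and hβε).and (eventually_gt_atTop 0))
    refine tendsto_deriv_atTop_of_monotoneOn (K := Y) hglim hg ?_
    refine monotoneOn_of_hasDerivWithinAt_nonneg (f' := fun x => h x * (β + ε x) / x)
      (convex_Ici Y)
      (fun x hx => (hY x hx).1.1.2.continuousAt.continuousWithinAt) (fun x hx => ?_)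
      (fun x hx => ?_)
    · rw [interior_Ici] at hx
      exact (hY x hx.le).1.1.2.hasDerivWithinAt
    · rw [interior_Ici] at hx
      have := hY x hx.le
      have h1 := this.1.1.1
      have h2 := this.1.2.1
      have h3 := this.2
      have h4 : 0 < β + ε x := by linarith
      positivity
  refine ⟨hlim, fun x => x / (h x * (β + ε x)), fun x =>
    (1 - (β + ε x) - x * ε' x / (β + ε x)) / (h x * (β + ε x)), ?_, ?_⟩
  · filter_upwards [hpos, hβε, eventually_gt_atTop 0] with x ⟨h1, h2⟩ ⟨h3, h4⟩ h5
    have h6 : 0 < β + ε x := by linarith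
    refine ⟨by positivity, h2.congr_deriv (by field_simp), ?_⟩
    refine ((hasDerivAt_id x).div (h2.mul ((hε x).const_add β)) (mul_pos h1 h6).ne').congr_deriv ?_
    simp only [id, Pi.mul_apply]
    field_simp
    ring
  · have hC0 : 0 ≤ max C 0 := le_max_right _ _
    have hbig : Tendsto (fun x => (1 + 2 * β + max C 0 / (β / 2)) / √(h x * (β / 2)))
        atTop (𝓝 0) :=
      (Real.tendsto_sqrt_atTop.comp (hlim.atTop_mul_const (half_pos hβ))).const_div_atTop _
    refine squeeze_zero_norm' ?_ hbig
    filter_upwards [hpos, hβε, hC, eventually_ge_atTop 1] with x ⟨h1, h2⟩ ⟨h3, h4⟩ h5 h6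
    have h7 : 0 < β + ε x := by linarith
    have hx0 : 0 < x := by linarith
    have e1 : (1 - (β + ε x) - x * ε' x / (β + ε x)) / (h x * (β + ε x)) /
        √(x / (h x * (β + ε x))) =
        (1 - (β + ε x) - x * ε' x / (β + ε x)) / √(x * (h x * (β + ε x))) := by
      rw [Real.sqrt_div hx0.le, Real.sqrt_mul hx0.le]
      have hw : 0 < h x * (β + ε x) := by positivity
      have hs := Real.mul_self_sqrt hw.le
      have hs' := Real.sqrt_pos.2 hw
      have hsx := Real.sqrt_pos.2 hx0
      rw [div_div, div_eq_div_iff (by positivity) (by positivity)]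
      rw [← hs]
      simp only [Real.sqrt_mul_self hs'.le]
      field_simp
    rw [e1, norm_div, Real.norm_eq_abs, Real.norm_of_nonneg (Real.sqrt_nonneg _)]
    refine div_le_div₀ (by positivity) ?_ (Real.sqrt_pos.2 (by positivity))
      (Real.sqrt_le_sqrt ?_)
    · have h8 : |x * ε' x / (β + ε x)| ≤ max C 0 / (β / 2) := by
        rw [abs_div, abs_mul, abs_of_pos hx0, abs_of_pos h7]
        gcongr
        exact h5.trans (le_max_left _ _)
      have h9 := abs_le.1 h8
      rw [abs_le]
      constructor <;> linarith
    · calc h x * (β / 2) ≤ h x * (β + ε x) := by gcongr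
        _ ≤ x * (h x * (β + ε x)) := le_mul_of_one_le_left (by positivity) h6

lemma geninv_eq_of_pos {h : ℝ → ℝ} (hm : StrictMonoOn h (Ici 0)) {x : ℝ} (hx : 0 ≤ x)
    (hpos : 0 < geninv h (h x)) : geninv h (h x) = x := by
  have hbdd : BddBelow {y : ℝ | h x ≤ h y} := by
    by_contra hb
    rw [geninv, Real.sInf_of_not_bddBelow hb] at hpos
    exact lt_irrefl _ hpos
  refine le_antisymm (csInf_le hbdd (le_refl (h x))) (le_csInf ⟨x, le_refl (h x)⟩ fun y hy => ?_)
  have hy0 : 0 ≤ y := hpos.le.trans (csInf_le hbdd hy)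
  exact (hm.le_iff_le hx hy0).1 hy

lemma MemRinfty.exists_hasSlowScale {g h : ℝ → ℝ} (hh : MemRinfty h)
    (hglim : Tendsto (fun x => g x / x) atTop atTop) (hg : ∀ x, HasDerivAt g (h x) x) :
    Tendsto h atTop atTop ∧ ∃ V V', HasSlowScale h V V' := by
  obtain ⟨hm, ε, ε', ε'', hε, -, hψ, hψlim, hε', -, η, hη, c, hc, hεη⟩ := hh
  have hlim : Tendsto h atTop atTop :=
    tendsto_deriv_atTop_of_monotoneOn hglim hg hm.monotoneOn
  have hεc : Continuous ε := continuous_iff_continuousAt.2 fun x => (hε x).continuousAt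
  have hεpos : ∀ᶠ u in atTop, 0 < ε u := by
    filter_upwards [hεη, eventually_gt_atTop 0] with u h1 h2
    have h3 : 0 < u ^ η := Real.rpow_pos_of_pos h2 η
    by_contra h4
    have : u ^ η * ε u ≤ 0 := mul_nonpos_of_nonneg_of_nonpos h3.le (not_lt.1 h4)
    linarith
  -- `ψ` is a left inverse of `h`
  have hleft : ∀ x, 0 ≤ x → 1 ≤ h x → geninv h (h x) = x := fun x hx h1 =>
    geninv_eq_of_pos hm hx (by rw [hψ _ h1]; exact Real.exp_pos _)
  have hψd : ∀ u, 1 < u → HasDerivAt (geninv h) (geninv h u * (ε u / u)) u := by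
    intro u hu
    refine ((hasDerivAt_exp_integral_div hεc hu).congr_of_eventuallyEq ?_).congr_deriv ?_
    · filter_upwards [lt_mem_nhds hu] with y hy using hψ y hy.le
    · rw [hψ u hu.le]
  -- `ψ` is injective near infinity
  obtain ⟨U, hU⟩ := eventually_atTop.1 (hεpos.and (eventually_gt_atTop 1))
  have hψmono : StrictMonoOn (geninv h) (Ici U) := by
    refine strictMonoOn_of_deriv_pos (convex_Ici U)
      (fun u hu => (hψd u (hU u hu).2).continuousAt.continuousWithinAt) fun u hu => ?_
    rw [interior_Ici] at hu
    have h1 := hU u hu.le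
    rw [(hψd u h1.2).deriv, hψ u h1.2.le]
    have := h1.1
    have := h1.2
    positivity
  have hright : ∀ᶠ u in atTop, 0 ≤ geninv h u ∧ h (geninv h u) = u := by
    filter_upwards [(hlim.comp hψlim).eventually_ge_atTop (max U 1), eventually_ge_atTop U,
      hψlim.eventually_ge_atTop 0] with u h1 h2 h3
    have h1' : max U 1 ≤ h (geninv h u) := h1
    exact ⟨h3, hψmono.injOn (show h (geninv h u) ∈ Ici U from (le_max_left _ _).trans h1') h2
      (hleft _ h3 ((le_max_right _ _).trans h1'))⟩
  obtain ⟨W, hW⟩ := eventually_atTop.1 hright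
  set V : ℝ → ℝ := fun x => x * (ε (h x) / h x) with hV
  have hderiv : ∀ᶠ x in atTop, 0 < V x ∧ HasDerivAt h (1 / V x) x := by
    filter_upwards [hlim.eventually_gt_atTop (max U 1), hlim.eventually_gt_atTop W,
      eventually_gt_atTop 0] with x h1 h2 hx
    have hU1 := hU (h x) ((le_max_left _ _).trans h1.le)
    have hVpos : 0 < V x := by
      have h3 := hU1.1
      have h4 : 0 < h x := one_pos.trans hU1.2
      simp only [hV]
      positivity
    refine ⟨hVpos, ?_⟩
    have hcont : ContinuousAt h x := by
      refine hm.continuousAt_of_image_mem_nhds (Ici_mem_nhds hx) ?_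
      filter_upwards [lt_mem_nhds h2] with u hu
      exact ⟨geninv h u, (hW u hu.le).1, (hW u hu.le).2⟩
    have hd : HasDerivAt (geninv h) (V x) (h x) := by
      have := hψd (h x) hU1.2
      rwa [hleft x hx.le hU1.2.le] at this
    rw [one_div]
    refine HasDerivAt.of_local_left_inverse hcont hd hVpos.ne' ?_
    filter_upwards [lt_mem_nhds hx, hcont.eventually (lt_mem_nhds hU1.2)] with y h3 h4
      using hleft y h3.le h4.le
  refine ⟨hlim, V, fun x => (ε (h x) - 1 + h x * ε' (h x) / ε (h x)) / h x, ?_, ?_⟩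
  · filter_upwards [hderiv, hlim.eventually hεpos, hlim.eventually_gt_atTop 0,
      eventually_gt_atTop 0] with x ⟨h1, h2⟩ h3 h4 hx
    refine ⟨h1, h2, ?_⟩
    have hq := ((hε (h x)).comp x h2).div h2 h4.ne'
    refine ((hasDerivAt_id x).mul hq).congr_deriv ?_
    simp only [id, Pi.div_apply, Function.comp_apply, hV]
    field_simp
    ring
  · -- `ε u / u` is bounded
    obtain ⟨B, hB⟩ : ∃ B, ∀ᶠ u in atTop, ε u / u ≤ B := by
      obtain ⟨Y, hY⟩ := eventually_atTop.1 ((hεpos.and (eventually_gt_atTop 1)).and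
        (hε'.eventually (gt_mem_nhds one_pos)))
      have hanti : AntitoneOn (fun u => ε u / u) (Ici Y) := by
        have hd : ∀ u ∈ Ici Y, HasDerivAt (fun u => ε u / u)
            ((ε' u * u - ε u * 1) / u ^ 2) u := fun u hu =>
          (hε u).div (hasDerivAt_id u) (by have := (hY u hu).1.2; positivity)
        refine antitoneOn_of_hasDerivWithinAt_nonpos (convex_Ici Y)
          (f' := fun u => (ε' u * u - ε u * 1) / u ^ 2)
          (fun u hu => (hd u hu).continuousAt.continuousWithinAt)
          (fun u hu => (hd u (interior_subset hu)).hasDerivWithinAt) fun u hu => ?_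
        have h1 := hY u (interior_subset hu)
        have h2 : u * ε' u < 1 * ε u := (div_lt_iff₀ h1.1.1).1 h1.2
        exact div_nonpos_of_nonpos_of_nonneg (by linarith) (sq_nonneg u)
      exact ⟨ε Y / Y, (eventually_ge_atTop Y).mono fun u hu => hanti self_mem_Ici hu hu⟩
    have hBlim : Tendsto (fun x : ℝ => √(max B 0) / √x + 2 / √(c * x)) atTop (𝓝 0) := by
      simpa using (Real.tendsto_sqrt_atTop.const_div_atTop (√(max B 0))).add
        ((Real.tendsto_sqrt_atTop.comp (tendsto_id.const_mul_atTop hc)).const_div_atTop 2)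
    refine squeeze_zero_norm' ?_ hBlim
    filter_upwards [hderiv, hlim.eventually hεpos, hlim.eventually_ge_atTop 1,
      eventually_gt_atTop 0, hlim.eventually hB, hlim.eventually hεη,
      hlim.eventually (hε'.eventually (Ioo_mem_nhds (a := -1) (b := 1) (by norm_num)
        (by norm_num)))] with x ⟨h1, h2⟩ h3 h4 hx h5 h6 h7
    have hu0 : 0 < h x := by linarith
    have hlow : c ≤ h x * ε (h x) := by
      refine h6.trans ?_
      gcongr
      calc h x ^ η ≤ h x ^ (1 : ℝ) := Real.rpow_le_rpow_of_exponent_le h4 (by linarith [hη.2])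
        _ = h x := Real.rpow_one _
    have hnum : |ε (h x) - 1 + h x * ε' (h x) / ε (h x)| ≤ ε (h x) + 2 := by
      rw [abs_le]
      constructor <;> linarith [h7.1, h7.2]
    have hsV : 0 < √(V x) := Real.sqrt_pos.2 h1
    rw [Real.norm_eq_abs, abs_div, abs_div, abs_of_pos hu0, abs_of_pos hsV]
    have h8 : ε (h x) / h x / √(V x) ≤ √(max B 0) / √x := by
      have e : ε (h x) / h x / √(V x) = √(ε (h x) / h x) / √x := by
        have h9 : 0 < ε (h x) / h x := by positivity
        have h10 := Real.sqrt_pos.2 h9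
        have h11 := Real.sqrt_pos.2 hx
        simp only [hV]
        rw [Real.sqrt_mul hx.le, div_eq_div_iff (by positivity) (by positivity)]
        nth_rewrite 1 [← Real.mul_self_sqrt h9.le]
        ring
      rw [e]
      gcongr
      exact h5.trans (le_max_left _ _)
    have h9 : 2 / h x / √(V x) ≤ 2 / √(c * x) := by
      rw [div_div]
      gcongr
      rw [Real.sqrt_le_left (by positivity), mul_pow, Real.sq_sqrt h1.le]
      simp only [hV]
      calc c * x ≤ (h x * ε (h x)) * x := by gcongr
        _ = h x ^ 2 * (x * (ε (h x) / h x)) := by field_simp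
    calc |ε (h x) - 1 + h x * ε' (h x) / ε (h x)| / h x / √(V x)
        ≤ (ε (h x) + 2) / h x / √(V x) := by gcongr
      _ = ε (h x) / h x / √(V x) + 2 / h x / √(V x) := by ring
      _ ≤ _ := add_le_add h8 h9

lemma MemFrakR.exists_hasSlowScale {g h : ℝ → ℝ} (hh : MemFrakR h)
    (hglim : Tendsto (fun x => g x / x) atTop atTop) (hg : ∀ x, HasDerivAt g (h x) x) :
    Tendsto h atTop atTop ∧ ∃ V V', HasSlowScale h V V' :=
  hh.elim (fun ⟨_, hβ⟩ => hβ.exists_hasSlowScale hglim hg)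
    fun hinf => hinf.exists_hasSlowScale hglim hg

namespace HasSlowScale

variable {g h V V' : ℝ → ℝ}

lemma eventually_abs_sqrt_sub_le (H : HasSlowScale h V V') {ε : ℝ} (hε : 0 < ε) :
    ∀ᶠ X in atTop, ∀ x ≥ X, ∀ z ≥ X, |√(V z) - √(V x)| ≤ ε * |z - x| := by
  have h1 : ∀ᶠ x in atTop, |V' x / √(V x)| < ε := by
    simpa [abs_div] using H.2.eventually (Metric.ball_mem_nhds 0 hε)
  filter_upwards [eventually_forall_ge_atTop.2 (H.1.and h1)] with X hX x hx z hz
  have := Convex.norm_image_sub_le_of_norm_hasDerivWithin_le (f := fun x => √(V x))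
    (f' := fun x => V' x / (2 * √(V x))) (s := Ici X) (C := ε)
    (fun y hy => (((hX y hy).1.2.2).sqrt (hX y hy).1.1.ne').hasDerivWithinAt)
    (fun y hy => ?_) (convex_Ici X) hx hz
  · simpa [Real.norm_eq_abs] using this
  · have h2 := (hX y hy).2
    rw [Real.norm_eq_abs, mul_comm, ← div_div, abs_div, abs_two]
    linarith [abs_nonneg (V' y / √(V y))]

lemma tendsto_sqrt_div (H : HasSlowScale h V V') :
    Tendsto (fun x => √(V x) / x) atTop (𝓝 0) := by
  rw [Metric.tendsto_nhds]
  intro ε hε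
  obtain ⟨X, hX⟩ := (H.eventually_abs_sqrt_sub_le (half_pos hε)).exists
  have h1 : Tendsto (fun x : ℝ => ε / 2 * x - (√(V X) + ε / 2 * |X|)) atTop atTop :=
    tendsto_atTop_add_const_right _ _ (tendsto_id.const_mul_atTop (half_pos hε))
  filter_upwards [h1.eventually_gt_atTop 0, eventually_ge_atTop X, eventually_gt_atTop 0]
    with x h2 h3 h4
  rw [Real.dist_eq, sub_zero, abs_of_nonneg (by positivity), div_lt_iff₀ h4]
  have h5 := (abs_le.1 (hX X le_rfl x h3)).2
  have h6 : |x - X| ≤ x + |X| := by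
    simpa [abs_of_pos h4] using abs_sub x X
  nlinarith

lemma eventually_half_le (H : HasSlowScale h V V') (R : ℝ) :
    ∀ᶠ x in atTop, ∀ z, |z - x| ≤ R * √(V x) → x / 2 ≤ z := by
  have h1 : Tendsto (fun x => R * (√(V x) / x)) atTop (𝓝 0) := by
    simpa using H.tendsto_sqrt_div.const_mul R
  filter_upwards [h1.eventually (gt_mem_nhds (half_pos one_pos)), eventually_gt_atTop 0]
    with x h2 h3 z hz
  have h4 := (abs_le.1 hz).1
  rw [← mul_div_assoc, div_lt_iff₀ h3] at h2
  linarith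

lemma eventually_abs_one_div_sub_le (H : HasSlowScale h V V') (R : ℝ) {ε : ℝ} (hε : 0 < ε) :
    ∀ᶠ x in atTop, ∀ z, |z - x| ≤ R * √(V x) → |1 / V z - 1 / V x| ≤ ε / V x := by
  -- continuity of `w ↦ 1 / w ^ 2` at `1`
  obtain ⟨δ, hδ, hδε⟩ : ∃ δ > 0, ∀ w : ℝ, |w - 1| < δ → |1 / w ^ 2 - 1| < ε := by
    have hc : ContinuousAt (fun w : ℝ => 1 / w ^ 2) 1 := by
      refine ContinuousAt.div (by fun_prop) (by fun_prop) (by norm_num)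
    obtain ⟨δ, hδ, h1⟩ := Metric.continuousAt_iff.1 hc ε hε
    exact ⟨δ, hδ, fun w hw => by simpa [Real.dist_eq] using h1 (by rwa [Real.dist_eq])⟩
  have hR : 0 < δ / (|R| + 1) := by positivity
  obtain ⟨X, hX, hXpos⟩ := ((H.eventually_abs_sqrt_sub_le hR).and
    (eventually_forall_ge_atTop.2 H.1)).exists
  filter_upwards [H.eventually_half_le R, eventually_ge_atTop X, eventually_ge_atTop (2 * X)]
    with x h2 h3 h4 z hz
  have hzX : X ≤ z := by linarith [h2 z hz]
  have hVx := (hXpos x h3).1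
  have hVz := (hXpos z hzX).1
  have hs := Real.sqrt_pos.2 hVx
  have hsz := Real.sqrt_pos.2 hVz
  have h5 : |√(V z) / √(V x) - 1| < δ := by
    rw [div_sub_one hs.ne', abs_div, abs_of_pos hs, div_lt_iff₀ hs]
    calc |√(V z) - √(V x)| ≤ δ / (|R| + 1) * |z - x| := hX x h3 z hzX
      _ ≤ δ / (|R| + 1) * (|R| * √(V x)) := by
        gcongr
        exact hz.trans (by gcongr; exact le_abs_self R)
      _ = δ * √(V x) * (|R| / (|R| + 1)) := by ring
      _ < δ * √(V x) * 1 := by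
        gcongr
        rw [div_lt_one (by positivity)]
        linarith
      _ = δ * √(V x) := mul_one _
  have h6 := hδε _ h5
  rw [div_pow, Real.sq_sqrt hVz.le, Real.sq_sqrt hVx.le] at h6
  have h7 : 1 / V z - 1 / V x = (1 / (V z / V x) - 1) / V x := by field_simp
  rw [h7, abs_div, abs_of_pos hVx]
  gcongr

/-- The second order expansion of `g` at the scale `√V`. -/
lemma tendsto_taylor (H : HasSlowScale h V V') (hg : ∀ x, HasDerivAt g (h x) x) (y : ℝ) :
    Tendsto (fun x => h x * (√(V x) * y) - (g (x + √(V x) * y) - g x)) atTop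
      (𝓝 (-(y ^ 2 / 2))) := by
  rw [Metric.tendsto_nhds]
  intro ε hε
  have hε' : 0 < ε / (y ^ 2 + 1) := by positivity
  obtain ⟨X, hXpos⟩ := (eventually_forall_ge_atTop.2 H.1).exists
  filter_upwards [H.eventually_half_le |y|, H.eventually_abs_one_div_sub_le |y| hε',
    eventually_ge_atTop X, eventually_ge_atTop (2 * X)] with x h2 h1 h3 h4
  have hVx := (hXpos x h3).1
  have hs := Real.sqrt_pos.2 hVx
  set R := |y| * √(V x) with hR
  have hR0 : 0 ≤ R := by positivity
  set I : Set ℝ := Metric.closedBall x R with hI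
  have hIc : Convex ℝ I := convex_closedBall x R
  have hmem : ∀ z, z ∈ I ↔ |z - x| ≤ R := fun z => by
    rw [hI, Metric.mem_closedBall, Real.dist_eq]
  have hxI : x ∈ I := Metric.mem_closedBall_self hR0
  have hIX : ∀ z ∈ I, X ≤ z := fun z hz => by linarith [h2 z ((hmem z).1 hz)]
  have b1 : ∀ z ∈ I, |h z - h x - (z - x) / V x| ≤ ε / (y ^ 2 + 1) / V x * |z - x| := by
    intro z hz
    have := Convex.norm_image_sub_le_of_norm_hasDerivWithin_le
      (f := fun z => h z - z / V x) (f' := fun z => 1 / V z - 1 / V x) (s := I)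
      (C := ε / (y ^ 2 + 1) / V x)
      (fun w hw => (((hXpos w (hIX w hw)).2.1).sub
        ((hasDerivAt_id w).div_const _)).hasDerivWithinAt)
      (fun w hw => h1 w ((hmem w).1 hw)) hIc hxI hz
    simp only [Real.norm_eq_abs] at this
    convert this using 2
    ring
  have hw : x + √(V x) * y ∈ I := (hmem _).2 (by
    rw [add_sub_cancel_left, abs_mul, abs_of_pos hs, mul_comm])
  have b2 := Convex.norm_image_sub_le_of_norm_hasDerivWithin_le
      (f := fun z => g z - h x * z - (z - x) ^ 2 / (2 * V x))
      (f' := fun z => h z - h x - (z - x) / V x) (s := I)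
      (C := ε / (y ^ 2 + 1) / V x * R)
      (fun w hw => ?_)
      (fun w hw => (b1 w hw).trans (by gcongr; exact (hmem w).1 hw)) hIc hxI hw
  · rw [Real.dist_eq]
    simp only [Real.norm_eq_abs, add_sub_cancel_left] at b2
    have e1 : (√(V x) * y) ^ 2 / (2 * V x) = y ^ 2 / 2 := by
      rw [mul_pow, Real.sq_sqrt hVx.le]; field_simp
    have e2 : ε / (y ^ 2 + 1) / V x * R * |√(V x) * y| = ε * (y ^ 2 / (y ^ 2 + 1)) := by
      rw [hR, abs_mul, abs_of_pos hs]
      calc ε / (y ^ 2 + 1) / V x * (|y| * √(V x)) * (√(V x) * |y|)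
          = ε / (y ^ 2 + 1) / V x * (|y| ^ 2 * (√(V x)) ^ 2) := by ring
        _ = _ := by rw [sq_abs, Real.sq_sqrt hVx.le]; field_simp
    rw [e1, e2] at b2
    rw [abs_sub_comm]
    have e3 : -(y ^ 2 / 2) - (h x * (√(V x) * y) - (g (x + √(V x) * y) - g x)) =
        g (x + √(V x) * y) - h x * (x + √(V x) * y) - y ^ 2 / 2
          - (g x - h x * x - (x - x) ^ 2 / (2 * V x)) := by
      rw [sub_self]; ring
    rw [e3]
    refine b2.trans_lt ?_
    calc ε * (y ^ 2 / (y ^ 2 + 1)) < ε * 1 := by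
          gcongr
          rw [div_lt_one (by positivity)]
          linarith
      _ = ε := mul_one _
  · refine ((((hg w).sub ((hasDerivAt_id w).const_mul (h x))).sub
      ((((hasDerivAt_id w).sub_const x).pow 2).div_const (2 * V x))).congr_deriv
        ?_).hasDerivWithinAt
    simp only [id]
    field_simp
    norm_num
    ring

/-- An exponential bound for the expansion of `g`, from convexity. -/
lemma eventually_expansion_le (H : HasSlowScale h V V') (hg : ∀ x, HasDerivAt g (h x) x) :
    ∃ K₀, ∀ K ≥ K₀, ∀ᶠ x in atTop, ∀ y, K ≤ x + √(V x) * y →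
      h x * (√(V x) * y) - (g (x + √(V x) * y) - g x) ≤ 1 / 4 - |y| / 4 := by
  obtain ⟨K₀, hK₀⟩ := (eventually_forall_ge_atTop.2 H.1).exists
  refine ⟨K₀, fun K hK => ?_⟩
  have hmono : MonotoneOn h (Ici K) := by
    refine monotoneOn_of_hasDerivWithinAt_nonneg (f' := fun x => 1 / V x) (convex_Ici K)
      (fun x hx => (hK₀ x (hK.trans hx)).2.1.continuousAt.continuousWithinAt)
      (fun x hx => (hK₀ x (hK.trans (interior_subset hx))).2.1.hasDerivWithinAt) fun x hx => ?_
    have := (hK₀ x (hK.trans (interior_subset hx))).1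
    positivity
  have hconv : ConvexOn ℝ (Ici K) g := by
    refine MonotoneOn.convexOn_of_deriv (convex_Ici K)
      (fun x _ => (hg x).continuousAt.continuousWithinAt)
      (fun x _ => (hg x).differentiableAt.differentiableWithinAt) ?_
    rw [show deriv g = h from funext fun x => (hg x).deriv]
    exact hmono.mono interior_subset
  have hlim : ∀ y : ℝ, y ^ 2 = 1 → ∀ᶠ x in atTop,
      h x * (√(V x) * y) - (g (x + √(V x) * y) - g x) < -(1 / 4) := fun y hy =>
    (H.tendsto_taylor hg y).eventually (gt_mem_nhds (by rw [hy]; norm_num))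
  filter_upwards [hlim 1 (by norm_num), hlim (-1) (by norm_num), eventually_ge_atTop K,
    H.eventually_half_le 1, eventually_ge_atTop (2 * K)] with x h1 h2 hx h3 h4 y hy
  set σ := √(V x) with hσ
  have hσ0 : 0 ≤ σ := Real.sqrt_nonneg _
  have key : ∀ a : ℝ, |a| = 1 → h x * (σ * a) - (g (x + σ * a) - g x) < -(1 / 4) →
      ∀ r, 1 ≤ r → K ≤ x + σ * (a * r) →
      h x * (σ * (a * r)) - (g (x + σ * (a * r)) - g x) ≤ -(r / 4) := by
    intro a ha h5 r hr h6
    have hr0 : 0 < r := by linarith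
    have h7 := hconv.2 (show x ∈ Ici K from hx) h6
      (show 0 ≤ 1 - 1 / r by rw [sub_nonneg, div_le_one hr0]; exact hr)
      (show 0 ≤ 1 / r by positivity) (by ring)
    simp only [smul_eq_mul] at h7
    have e : (1 - 1 / r) * x + 1 / r * (x + σ * (a * r)) = x + σ * a := by field_simp; ring
    rw [e] at h7
    have h8 : r * g (x + σ * a) ≤ (r - 1) * g x + g (x + σ * (a * r)) := by
      calc r * g (x + σ * a) ≤ r * ((1 - 1 / r) * g x + 1 / r * g (x + σ * (a * r))) := by
            gcongr
        _ = _ := by field_simp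
    nlinarith
  rcases le_or_gt |y| 1 with hy1 | hy1
  · -- tangent line inequality
    have h5 : h x * (σ * y) ≤ g (x + σ * y) - g x := by
      rcases lt_trichotomy (σ * y) 0 with h6 | h6 | h6
      · have := hconv.slope_le_of_hasDerivAt (x := x + σ * y) (y := x) hy hx (by linarith) (hg x)
        rw [slope_def_field, div_le_iff₀ (by linarith)] at this
        linarith
      · rw [h6]; simp
      · have := hconv.le_slope_of_hasDerivAt (x := x) (y := x + σ * y) hx hy (by linarith) (hg x)
        rw [slope_def_field, le_div_iff₀ (by linarith)] at this
        linarith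
    linarith
  · rcases le_or_gt 0 y with h5 | h5
    · rw [abs_of_nonneg h5] at hy1 ⊢
      have := key 1 (by simp) h1 y hy1.le (by rwa [one_mul])
      rw [one_mul] at this
      linarith
    · rw [abs_of_neg h5] at hy1 ⊢
      have := key (-1) (by simp) h2 (-y) hy1.le (by rwa [neg_one_mul, neg_neg])
      rw [neg_one_mul, neg_neg] at this
      linarith

end HasSlowScale

lemma integrable_affine_pow_mul {f : ℝ → ℝ} (hf : ∀ k : ℕ, Integrable fun x => x ^ k * f x)
    (a b : ℝ) (k : ℕ) : Integrable fun x => (a * x + b) ^ k * f x := by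
  have : (fun x => (a * x + b) ^ k * f x) = fun x => ∑ i ∈ Finset.range (k + 1),
      (a ^ i * b ^ (k - i) * (k.choose i)) * (x ^ i * f x) := by
    ext x
    rw [add_pow, Finset.sum_mul]
    refine Finset.sum_congr rfl fun i _ => ?_
    rw [mul_pow]; ring
  rw [this]
  exact integrable_finsetSum _ fun i _ => (hf i).const_mul _

lemma integrable_pow_mul_comp_affine {f : ℝ → ℝ} (hf : ∀ k : ℕ, Integrable fun x => x ^ k * f x)
    (x : ℝ) {σ : ℝ} (hσ : σ ≠ 0) (k : ℕ) : Integrable fun y => y ^ k * f (x + σ * y) := by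
  have h := ((integrable_affine_pow_mul hf σ⁻¹ (-(x / σ)) k).comp_add_left x).comp_mul_left' hσ
  refine h.congr (Eventually.of_forall fun y => ?_)
  simp only
  congr 2
  field_simp
  ring

lemma integral_comp_affine (f : ℝ → ℝ) (x : ℝ) {σ : ℝ} (hσ : 0 < σ) :
    ∫ y, f (x + σ * y) = σ⁻¹ * ∫ y, f y := by
  rw [Measure.integral_comp_mul_left (fun y => f (x + y)), integral_add_left_eq_self f x,
    abs_of_pos (inv_pos.2 hσ), smul_eq_mul]

lemma integrable_pow_mul_exp_neg_div (k : ℕ) {b : ℝ} (hb : 0 < b) :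
    Integrable fun y : ℝ => |y| ^ k * Real.exp (-(b * |y|)) := by
  have h : IntegrableOn (fun y : ℝ => y ^ (k : ℝ) * Real.exp (-b * y ^ (1 : ℝ))) (Ioi 0) :=
    integrableOn_rpow_mul_exp_neg_mul_rpow (by have := k.cast_nonneg (α := ℝ); linarith) one_pos hb
  have h2 : IntegrableOn (fun y : ℝ => |y| ^ k * Real.exp (-(b * |y|))) (Ioi 0) := by
    refine h.congr_fun (fun y hy => ?_) measurableSet_Ioi
    simp only [Real.rpow_natCast, Real.rpow_one, abs_of_pos (show (0 : ℝ) < y from hy), neg_mul]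
  have h3 : IntegrableOn (fun y : ℝ => |y| ^ k * Real.exp (-(b * |y|))) (Iic 0) := by
    rw [integrableOn_Iic_iff_integrableOn_Iio]
    have := IntegrableOn.comp_neg_Iio (c := (0 : ℝ)) (by simpa using h2)
    simpa using this
  simpa using h3.union h2

section Laplace

variable (p g h V : ℝ → ℝ) (c : ℝ)

/-- The exponentially tilted density, rescaled around `x` at the scale `√V x`. -/
def laplaceIntegrand (x y : ℝ) : ℝ :=
  Real.exp (h x * (x + √(V x) * y)) * p (x + √(V x) * y) / (c * Real.exp (h x * x - g x))

variable {p g h V c} {q V' : ℝ → ℝ}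
  (hc : 0 < c) (hpdef : ∀ x ≥ (0:ℝ), p x = c * Real.exp (-(g x - q x)))

include hc hpdef

lemma laplaceIntegrand_eq {x y : ℝ} (hy : 0 ≤ x + √(V x) * y) :
    laplaceIntegrand p g h V c x y = Real.exp (h x * (√(V x) * y) -
      (g (x + √(V x) * y) - g x)) * Real.exp (q (x + √(V x) * y)) := by
  rw [laplaceIntegrand, hpdef _ hy, div_eq_iff (by positivity), ← Real.exp_add,
    mul_left_comm _ c, mul_left_comm _ c, ← Real.exp_add, ← Real.exp_add]
  congr 2
  ring

lemma laplaceIntegrand_nonneg (hpz : ∀ x < 0, p x = 0) (x y : ℝ) :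
    0 ≤ laplaceIntegrand p g h V c x y := by
  have hp0 : 0 ≤ p (x + √(V x) * y) := by
    rcases lt_or_ge (x + √(V x) * y) 0 with h1 | h1
    · rw [hpz _ h1]
    · rw [hpdef _ h1]; positivity
  unfold laplaceIntegrand
  positivity

variable (H : HasSlowScale h V V') (hg : ∀ x, HasDerivAt g (h x) x)
  (hq0 : Tendsto q atTop (𝓝 0))

include H hg hq0

lemma tendsto_laplaceIntegrand (y : ℝ) :
    Tendsto (fun x => laplaceIntegrand p g h V c x y) atTop (𝓝 (Real.exp (-(y ^ 2 / 2)))) := by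
  have hlarge : Tendsto (fun x => x + √(V x) * y) atTop atTop := by
    refine tendsto_atTop_mono' _ ?_ (tendsto_id.atTop_div_const (r := (2 : ℝ)) two_pos)
    filter_upwards [H.eventually_half_le |y|] with x hx
    refine hx _ ?_
    rw [add_sub_cancel_left, abs_mul, abs_of_nonneg (Real.sqrt_nonneg _), mul_comm]
  have h1 := ((H.tendsto_taylor hg y).rexp).mul ((hq0.comp hlarge).rexp)
  rw [Real.exp_zero, mul_one] at h1
  refine h1.congr' ?_
  filter_upwards [hlarge.eventually_ge_atTop 0] with x hx
  rw [laplaceIntegrand_eq hc hpdef hx]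
  rfl

lemma eventually_laplaceIntegrand_le :
    ∃ K₀, ∀ K ≥ K₀, ∀ᶠ x in atTop, ∀ y, K ≤ x + √(V x) * y →
      laplaceIntegrand p g h V c x y ≤ Real.exp (5 / 4) * Real.exp (-(1 / 4 * |y|)) := by
  obtain ⟨K₀, hK₀⟩ := H.eventually_expansion_le hg
  obtain ⟨K₁, hK₁⟩ := eventually_atTop.1 (hq0.eventually (gt_mem_nhds one_pos))
  refine ⟨max 0 (max K₀ K₁), fun K hK => ?_⟩
  have hK0 : 0 ≤ K := (le_max_left _ _).trans hK
  have hK2 := (le_max_right _ _).trans hK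
  filter_upwards [hK₀ K ((le_max_left _ _).trans hK2)] with x hx y hy
  rw [laplaceIntegrand_eq hc hpdef (hK0.trans hy), ← Real.exp_add, ← Real.exp_add]
  have h1 := hx y hy
  have h2 := hK₁ _ (((le_max_right _ _).trans hK2).trans hy)
  exact Real.exp_le_exp.2 (by linarith)

variable (hpz : ∀ x < 0, p x = 0) (hpdens : (∫ x in Set.Ici (0:ℝ), p x) = 1)
  (hlim : Tendsto h atTop atTop)

include hpz hpdens hlim

omit hq0 in
/-- The part of the tilted density below a fixed threshold is negligible. -/
lemma tendsto_integral_laplaceIntegrand_Iio (k : ℕ) :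
    ∃ K₀, ∀ K ≥ K₀, Tendsto (fun x => ∫ y, {y | x + √(V x) * y < K}.indicator
      (fun y => |y| ^ k * laplaceIntegrand p g h V c x y) y) atTop (𝓝 0) := by
  obtain ⟨K₀, hK₀⟩ := H.eventually_expansion_le hg
  refine ⟨max 0 K₀, fun K hK => ?_⟩
  have hK0 : 0 ≤ K := (le_max_left _ _).trans hK
  have hp : Integrable p := integrable_density hpz hpdens
  have hp1 : ∫ x, p x = 1 := by
    rw [← hpdens]
    exact (setIntegral_eq_integral_of_forall_compl_eq_zero
      fun x hx => hpz x (not_le.1 hx)).symm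
  have hp0 : ∀ x, 0 ≤ p x := fun x => by
    rcases lt_or_ge x 0 with h1 | h1
    · rw [hpz _ h1]
    · rw [hpdef _ h1]; positivity
  have hs : Tendsto (fun x => x / √(V x) * (1 / 8)) atTop atTop := by
    refine Tendsto.atTop_mul_const (by norm_num) ?_
    have h0 : Tendsto (fun x => √(V x) / x) atTop (𝓝[>] 0) :=
      tendsto_nhdsWithin_iff.2 ⟨H.tendsto_sqrt_div, by
        filter_upwards [H.1, eventually_gt_atTop 0] with x h1 h2
        have := Real.sqrt_pos.2 h1.1
        exact mem_Ioi.2 (by positivity)⟩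
    exact h0.inv_tendsto_nhdsGT_zero.congr fun x => by simp
  have hlim0 := ((Real.tendsto_pow_mul_exp_neg_atTop_nhds_zero (k + 1)).comp hs).const_mul
    (Real.exp (g K + 1 / 4) / c * 8 ^ (k + 1))
  rw [mul_zero] at hlim0
  refine squeeze_zero' (Eventually.of_forall fun x => integral_nonneg fun y =>
    indicator_nonneg (fun y _ => mul_nonneg (by positivity)
      (laplaceIntegrand_nonneg hc hpdef hpz x y)) y) ?_ hlim0
  filter_upwards [hK₀ K ((le_max_right _ _).trans hK), H.1, eventually_ge_atTop 1,
    eventually_ge_atTop (2 * K), hlim.eventually_ge_atTop 0] with x h1 h2 h3 h4 h5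
  have hσ := Real.sqrt_pos.2 h2.1
  set σ := √(V x) with hσd
  set A : ℝ := (x / σ) ^ k * (Real.exp (g K + 1 / 4 - x / σ * (1 / 8)) / c) with hA
  have hA0 : 0 ≤ A := by positivity
  have hx0 : 0 < x := by linarith
  -- the exponential factor at the threshold
  have h6 : h x * (K - x) + g x ≤ g K + 1 / 4 - x / σ * (1 / 8) := by
    have h7 := h1 ((K - x) / σ) (by rw [mul_div_cancel₀ _ hσ.ne']; linarith)
    rw [mul_div_cancel₀ _ hσ.ne', add_sub_cancel, abs_div, abs_of_pos hσ,
      abs_of_nonpos (by linarith)] at h7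
    have h8 : x / 2 / σ ≤ -(K - x) / σ := by gcongr; linarith
    have h9 : x / 2 / σ = x / σ * (1 / 8) * 4 := by ring
    linarith
  have hbound : ∀ y, {y | x + σ * y < K}.indicator
      (fun y => |y| ^ k * laplaceIntegrand p g h V c x y) y ≤ A * p (x + σ * y) := by
    intro y
    refine indicator_le' (g := fun y => A * p (x + σ * y)) (fun y hy => ?_)
      (fun y hy => mul_nonneg hA0 (hp0 _)) y
    rcases lt_or_ge (x + σ * y) 0 with h7 | h7
    · rw [laplaceIntegrand, ← hσd, hpz _ h7]; simp
    · have hy' : x + σ * y < K := hy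
      have h8 : |y| ≤ x / σ := by
        rw [le_div_iff₀ hσ]
        calc |y| * σ = |σ * y| := by rw [abs_mul, abs_of_pos hσ, mul_comm]
          _ ≤ x := abs_le.2 ⟨by linarith, by linarith⟩
      have h9 : Real.exp (h x * (x + σ * y)) ≤ Real.exp (h x * K) := by gcongr
      have h10 : Real.exp (h x * K) / (c * Real.exp (h x * x - g x)) ≤
          Real.exp (g K + 1 / 4 - x / σ * (1 / 8)) / c := by
        rw [mul_comm c, ← div_div, ← Real.exp_sub]
        exact div_le_div_of_nonneg_right (Real.exp_le_exp.2 (by linarith)) hc.le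
      calc |y| ^ k * laplaceIntegrand p g h V c x y
          = |y| ^ k * (Real.exp (h x * (x + σ * y)) / (c * Real.exp (h x * x - g x))) *
            p (x + σ * y) := by rw [laplaceIntegrand]; ring
        _ ≤ (x / σ) ^ k * (Real.exp (h x * K) / (c * Real.exp (h x * x - g x))) *
            p (x + σ * y) := by
          have := hp0 (x + σ * y)
          gcongr
        _ ≤ A * p (x + σ * y) := by
          have := hp0 (x + σ * y)
          rw [hA]
          gcongr
  have h_int : Integrable fun y => A * p (x + σ * y) :=
    ((hp.comp_add_left x).comp_mul_left' hσ.ne').const_mul A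
  refine (integral_mono_of_nonneg (Eventually.of_forall fun y => indicator_nonneg (fun y _ =>
    mul_nonneg (by positivity) (laplaceIntegrand_nonneg hc hpdef hpz x y)) y) h_int
    (Eventually.of_forall hbound)).trans ?_
  rw [integral_const_mul, integral_comp_affine p x hσ, hp1, mul_one, hA]
  have h7 : σ⁻¹ ≤ x / σ := by
    rw [div_eq_mul_inv]; exact le_mul_of_one_le_left (by positivity) h3
  have h8 : Real.exp (g K + 1 / 4 - x / σ * (1 / 8)) =
      Real.exp (g K + 1 / 4) * Real.exp (-(x / σ * (1 / 8))) := by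
    rw [← Real.exp_add]; ring_nf
  calc (x / σ) ^ k * (Real.exp (g K + 1 / 4 - x / σ * (1 / 8)) / c) * σ⁻¹
      ≤ (x / σ) ^ k * (Real.exp (g K + 1 / 4 - x / σ * (1 / 8)) / c) * (x / σ) := by gcongr
    _ = _ := by
      rw [h8]
      simp only [Function.comp]
      rw [mul_pow (x / σ) (1 / 8) (k + 1), one_div_pow, ← hσd]
      field_simp
      rw [pow_succ]
      field_simp

/-- Laplace's method: the rescaled tilted densities converge to a Gaussian in weighted `L¹`. -/
lemma tendsto_integral_abs_laplaceIntegrand_sub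
    (hPhi : ∀ t > (0:ℝ), IntegrableOn (fun x => Real.exp (t * x) * p x) (Set.Ici 0)) (k : ℕ) :
    Tendsto (fun x => ∫ y, |y| ^ k * |laplaceIntegrand p g h V c x y - Real.exp (-(y ^ 2 / 2))|)
      atTop (𝓝 0) := by
  have hp0 : ∀ x, 0 ≤ p x := fun x => by
    rcases lt_or_ge x 0 with h1 | h1
    · rw [hpz _ h1]
    · rw [hpdef _ h1]; positivity
  obtain ⟨K₀, hK₀⟩ := tendsto_integral_laplaceIntegrand_Iio hc hpdef H hg hpz hpdens hlim k
  obtain ⟨K₁, hK₁⟩ := eventually_laplaceIntegrand_le hc hpdef H hg hq0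
  set K := max K₀ K₁
  have htail := hK₀ K (le_max_left _ _)
  have hdom := hK₁ K (le_max_right _ _)
  set D : ℝ → ℝ → ℝ := fun x y => |y| ^ k *
    |{y | K ≤ x + √(V x) * y}.indicator (laplaceIntegrand p g h V c x) y
      - Real.exp (-(y ^ 2 / 2))| with hD
  have h_int : ∀ᶠ x in atTop, Integrable fun y => |y| ^ k * laplaceIntegrand p g h V c x y := by
    filter_upwards [H.1] with x hx
    have hσ := Real.sqrt_pos.2 hx.1
    have h1 := ((integrable_pow_mul_comp_affine (fun k => integrable_pow_mul_exp_density hp0 hpz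
      hpdens hPhi k (h x)) x hσ.ne' k).div_const (c * Real.exp (h x * x - g x))).abs
    refine h1.congr (Eventually.of_forall fun y => ?_)
    have h2 := laplaceIntegrand_nonneg (h := h) (V := V) (g := g) hc hpdef hpz x y
    simp only
    rw [mul_div_assoc, abs_mul, abs_pow]
    congr 1
    exact abs_of_nonneg h2
  have hms : ∀ x, MeasurableSet {y | K ≤ x + √(V x) * y} := fun x =>
    measurableSet_le measurable_const (by fun_prop)
  have hmeas : ∀ᶠ x in atTop, AEStronglyMeasurable (laplaceIntegrand p g h V c x) volume := by
    filter_upwards [H.1] with x hx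
    have hσ := Real.sqrt_pos.2 hx.1
    have h1 := integrable_pow_mul_comp_affine (fun k => integrable_pow_mul_exp_density hp0 hpz
      hpdens hPhi k (h x)) x hσ.ne' 0
    simp only [pow_zero, one_mul] at h1
    exact (h1.div_const _).1
  have hDmeas : ∀ᶠ x in atTop, AEStronglyMeasurable (D x) volume := by
    filter_upwards [hmeas] with x hx
    exact (Measurable.aestronglyMeasurable (by fun_prop)).mul
      (((hx.indicator (hms x)).sub (Measurable.aestronglyMeasurable (by fun_prop))).norm)
  have hgauss : ∀ y : ℝ,
      Real.exp (-(y ^ 2 / 2)) ≤ Real.exp (5 / 4) * Real.exp (-(1 / 4 * |y|)) := by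
    intro y
    rw [← Real.exp_add, ← sq_abs]
    gcongr
    nlinarith [sq_nonneg (|y| - 1 / 4)]
  have hbdd : ∀ᶠ x in atTop, ∀ y, ‖D x y‖ ≤
      Real.exp (5 / 4) * (|y| ^ k * Real.exp (-(1 / 4 * |y|))) := by
    filter_upwards [hdom] with x hx y
    rw [Real.norm_of_nonneg (by positivity)]
    have h1 : |{y | K ≤ x + √(V x) * y}.indicator (laplaceIntegrand p g h V c x) y
      - Real.exp (-(y ^ 2 / 2))| ≤ Real.exp (5 / 4) * Real.exp (-(1 / 4 * |y|)) := by
      refine abs_sub_le_of_nonneg_of_le (indicator_nonneg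
        (fun y _ => laplaceIntegrand_nonneg hc hpdef hpz x y) y) ?_ (Real.exp_pos _).le (hgauss y)
      exact indicator_le' (f := laplaceIntegrand p g h V c x)
        (g := fun y => Real.exp (5 / 4) * Real.exp (-(1 / 4 * |y|)))
        (fun y hy => hx y hy) (fun y _ => by positivity) y
    calc D x y ≤ |y| ^ k * (Real.exp (5 / 4) * Real.exp (-(1 / 4 * |y|))) := by
          simp only [hD]; gcongr
      _ = _ := by ring
  have hbint := (integrable_pow_mul_exp_neg_div k (b := 1 / 4) (by norm_num)).const_mul
    (Real.exp (5 / 4))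
  have hDlim : Tendsto (fun x => ∫ y, D x y) atTop (𝓝 (∫ _ : ℝ, (0 : ℝ))) := by
    refine tendsto_integral_filter_of_dominated_convergence _ hDmeas
      (hbdd.mono fun x hx => Eventually.of_forall hx) hbint (Eventually.of_forall fun y => ?_)
    have h1 := ((tendsto_laplaceIntegrand hc hpdef H hg hq0 y).sub_const
      (Real.exp (-(y ^ 2 / 2)))).abs.const_mul (|y| ^ k)
    rw [sub_self, abs_zero, mul_zero] at h1
    refine h1.congr' ?_
    filter_upwards [H.eventually_half_le |y|, eventually_ge_atTop (2 * K)] with x h2 h3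
    have h4 := h2 (x + √(V x) * y) (by
      rw [add_sub_cancel_left, abs_mul, abs_of_nonneg (Real.sqrt_nonneg _), mul_comm])
    simp only [hD]
    rw [indicator_of_mem (show y ∈ {y | K ≤ x + √(V x) * y} from (by linarith : K ≤ _))]
  rw [integral_zero] at hDlim
  have hsum := hDlim.add htail
  rw [add_zero] at hsum
  refine squeeze_zero' (Eventually.of_forall fun x => integral_nonneg fun y => by positivity)
    ?_ hsum
  filter_upwards [h_int, hDmeas, hbdd] with x h1 h2 h3
  have hi1 : Integrable (D x) := hbint.mono' h2 (Eventually.of_forall h3)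
  have hms' : MeasurableSet {y | x + √(V x) * y < K} :=
    measurableSet_lt (by fun_prop) measurable_const
  have hi2 := h1.indicator hms'
  rw [← integral_add hi1 hi2]
  refine integral_mono_of_nonneg (Eventually.of_forall fun y => by positivity) (hi1.add hi2)
    (Eventually.of_forall fun y => ?_)
  have h4 := laplaceIntegrand_nonneg (h := h) (V := V) (g := g) hc hpdef hpz x y
  simp only [hD]
  rcases lt_or_ge (x + √(V x) * y) K with h5 | h5
  · rw [indicator_of_mem (show y ∈ {y | x + √(V x) * y < K} from h5),
      indicator_of_notMem (show y ∉ {y | K ≤ x + √(V x) * y} from not_le.2 h5), ← mul_add]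
    gcongr
    have := Real.exp_pos (-(y ^ 2 / 2))
    rw [zero_sub, abs_neg, abs_of_pos this]
    refine abs_le.2 ⟨by linarith, by linarith⟩
  · rw [indicator_of_notMem (show y ∉ {y | x + √(V x) * y < K} from not_lt.2 h5),
      indicator_of_mem (show y ∈ {y | K ≤ x + √(V x) * y} from h5), add_zero]

end Laplace

/-- The unnormalized moments of the standard Gaussian. -/
def gaussMoment (k : ℕ) : ℝ := ∫ y : ℝ, y ^ k * Real.exp (-(y ^ 2 / 2))

lemma gaussMoment_zero : gaussMoment 0 = √(2 * π) := by
  have := integral_gaussian (1 / 2)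
  simp only [gaussMoment, pow_zero, one_mul]
  convert this using 3 <;> ring_nf

lemma gaussMoment_eq_zero_of_odd {k : ℕ} (hk : Odd k) : gaussMoment k = 0 := by
  have h := integral_neg_eq_self (fun y : ℝ => y ^ k * Real.exp (-(y ^ 2 / 2))) volume
  simp only [hk.neg_pow, neg_sq, neg_mul, integral_neg] at h
  rw [gaussMoment]
  linarith

lemma gaussMoment_two : gaussMoment 2 = √(2 * π) := by
  have h := ProbabilityTheory.variance_of_integral_eq_zero
    (μ := ProbabilityTheory.gaussianReal 0 1) (X := id) aemeasurable_id
    (by simp [ProbabilityTheory.integral_id_gaussianReal])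
  rw [ProbabilityTheory.variance_id_gaussianReal,
    ProbabilityTheory.integral_gaussianReal_eq_integral_smul one_ne_zero] at h
  simp only [ProbabilityTheory.gaussianPDFReal, id, NNReal.coe_one, mul_one, sub_zero,
    smul_eq_mul] at h
  have e : (fun x : ℝ => (√(2 * π))⁻¹ * Real.exp (-x ^ 2 / 2) * x ^ 2) =
      fun x => (√(2 * π))⁻¹ * (x ^ 2 * Real.exp (-(x ^ 2 / 2))) := by
    ext x; rw [neg_div]; ring
  rw [e, integral_const_mul, ← gaussMoment] at h
  have hpos : 0 < √(2 * π) := by positivity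
  field_simp at h
  exact h.symm

lemma integrable_pow_mul_gauss (k : ℕ) :
    Integrable fun y : ℝ => y ^ k * Real.exp (-(y ^ 2 / 2)) := by
  have := integrable_rpow_mul_exp_neg_mul_sq (b := 1 / 2) (by norm_num)
    (s := k) (by have := k.cast_nonneg (α := ℝ); linarith)
  refine this.congr (Eventually.of_forall fun y => ?_)
  simp only [Real.rpow_natCast]
  ring_nf

lemma norm_integral_cexp_mul_gauss (ω a : ℝ) :
    ‖∫ y : ℝ, (Real.exp (-(y ^ 2 / 2)) : ℂ) * Complex.exp ((ω * y + a : ℝ) * Complex.I)‖ =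
      √(2 * π) * Real.exp (-(ω ^ 2 / 2)) := by
  have h := fourierIntegral_gaussian (b := 1 / 2) (by norm_num) (ω : ℂ)
  have e : (fun y : ℝ => (Real.exp (-(y ^ 2 / 2)) : ℂ) *
      Complex.exp ((ω * y + a : ℝ) * Complex.I)) = fun y : ℝ =>
      Complex.exp (a * Complex.I) *
        (Complex.exp (Complex.I * ω * y) * Complex.exp (-(1 / 2) * (y : ℂ) ^ 2)) := by
    ext y
    push_cast
    rw [← Complex.exp_add, ← Complex.exp_add, ← Complex.exp_add]
    congr 1; ring
  rw [e, integral_const_mul, h, norm_mul, Complex.norm_exp_ofReal_mul_I, one_mul, norm_mul]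
  congr 1
  · rw [show (π / (1 / 2) : ℂ) = ((2 * π : ℝ) : ℂ) by push_cast; ring,
      Complex.norm_cpow_eq_rpow_re_of_pos (by positivity), Real.sqrt_eq_rpow]
    norm_num
  · rw [show (-(ω : ℂ) ^ 2 / (4 * (1 / 2)) : ℂ) = ((-(ω ^ 2 / 2) : ℝ) : ℂ) by push_cast; ring,
      ← Complex.ofReal_exp, Complex.norm_real, Real.norm_of_nonneg (Real.exp_pos _).le]

/-- Standardized moments of an asymptotically Gaussian family of weights. -/
lemma tendsto_integral_standardized {F : ℝ → ℝ → ℝ} {μ r : ℝ → ℝ} {n : ℕ}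
    (h_int : ∀ k, ∀ᶠ x in atTop, Integrable fun y => y ^ k * F x y)
    (hI : ∀ k, Tendsto (fun x => ∫ y, y ^ k * F x y) atTop (𝓝 (gaussMoment k)))
    (hμ : Tendsto μ atTop (𝓝 0)) (hr : Tendsto r atTop (𝓝 1)) :
    Tendsto (fun x => ∫ y, ((y - μ x) / r x) ^ n * F x y) atTop (𝓝 (gaussMoment n)) := by
  have h1 : ∀ᶠ x in atTop, ∫ y, ((y - μ x) / r x) ^ n * F x y =
      (r x ^ n)⁻¹ * ∑ k ∈ Finset.range (n + 1),
        ((-μ x) ^ (n - k) * (n.choose k)) * ∫ y, y ^ k * F x y := by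
    have := eventually_all_finset (Finset.range (n + 1)) (l := atTop)
      (p := fun k x => Integrable fun y => y ^ k * F x y) |>.2 fun k _ => h_int k
    filter_upwards [this] with x hx
    simp only [← integral_const_mul]
    rw [← integral_finsetSum _ fun k hk => (hx k hk).const_mul _, ← integral_const_mul]
    congr 1
    ext y
    rw [div_pow, sub_eq_add_neg, add_pow, Finset.sum_div, Finset.sum_mul, Finset.mul_sum]
    refine Finset.sum_congr rfl fun k _ => ?_
    rw [div_eq_inv_mul]; ring
  have h2 : Tendsto (fun x => (r x ^ n)⁻¹ * ∑ k ∈ Finset.range (n + 1),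
        ((-μ x) ^ (n - k) * (n.choose k)) * ∫ y, y ^ k * F x y) atTop
      (𝓝 (((1 : ℝ) ^ n)⁻¹ * ∑ k ∈ Finset.range (n + 1),
        ((-0 : ℝ) ^ (n - k) * (n.choose k)) * gaussMoment k)) :=
    ((hr.pow n).inv₀ (by simp)).mul (tendsto_finsetSum _ fun k _ =>
      ((hμ.neg.pow _).mul_const _).mul (hI k))
  have h3 : ((1 : ℝ) ^ n)⁻¹ * ∑ k ∈ Finset.range (n + 1),
        ((-0 : ℝ) ^ (n - k) * (n.choose k)) * gaussMoment k = gaussMoment n := by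
    rw [one_pow, inv_one, one_mul, Finset.sum_range_succ, Finset.sum_eq_zero]
    · simp
    · intro k hk
      rw [Finset.mem_range] at hk
      rw [neg_zero, zero_pow (by omega)]; ring
  rw [h3] at h2
  exact h2.congr' (h1.mono fun x hx => hx.symm)

lemma integral_comp_affine_smul {E : Type*} [NormedAddCommGroup E] [NormedSpace ℝ E]
    (f : ℝ → E) (x : ℝ) {σ : ℝ} (hσ : 0 < σ) :
    ∫ y, f (x + σ * y) = σ⁻¹ • ∫ y, f y := by
  rw [Measure.integral_comp_mul_left (fun y => f (x + y)), integral_add_left_eq_self f x,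
    abs_of_pos (inv_pos.2 hσ)]

section Standardization

variable {p g h V q V' : ℝ → ℝ} {c : ℝ}

lemma tilt_comp_affine (hc : 0 < c) (x y : ℝ) :
    tilt p (h x) (x + √(V x) * y) =
      c * Real.exp (h x * x - g x) / mgfFun p (h x) * laplaceIntegrand p g h V c x y := by
  have : 0 < c * Real.exp (h x * x - g x) := by positivity
  rw [tilt, laplaceIntegrand]
  field_simp

lemma integral_laplaceIntegrand (hpz : ∀ x < 0, p x = 0) {x : ℝ} (hV : 0 < V x) :
    ∫ y, laplaceIntegrand p g h V c x y =
      (√(V x))⁻¹ * (mgfFun p (h x) / (c * Real.exp (h x * x - g x))) := by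
  simp only [laplaceIntegrand, integral_div, mgfFun_eq_integral hpz]
  rw [integral_comp_affine (fun w => Real.exp (h x * w) * p w) x (Real.sqrt_pos.2 hV),
    mul_div_assoc]

lemma integral_tilt_smul {E : Type*} [NormedAddCommGroup E] [NormedSpace ℝ E]
    (hc : 0 < c) (hpz : ∀ x < 0, p x = 0) {x : ℝ} (hV : 0 < V x)
    (P : ℝ → E) :
    ∫ w, tilt p (h x) w • P w = (∫ y, laplaceIntegrand p g h V c x y)⁻¹ •
      ∫ y, laplaceIntegrand p g h V c x y • P (x + √(V x) * y) := by
  have hσ := Real.sqrt_pos.2 hV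
  have h1 := integral_comp_affine_smul (fun w => tilt p (h x) w • P w) x hσ
  have hA : 0 < c * Real.exp (h x * x - g x) := by positivity
  simp only [tilt_comp_affine (g := g) hc, mul_smul] at h1
  rw [integral_smul] at h1
  rw [integral_laplaceIntegrand hpz hV, mul_inv, inv_inv, inv_div, mul_smul, h1, smul_smul,
    mul_inv_cancel₀ hσ.ne', one_smul]

lemma tilt_eq (hc : 0 < c) (hpz : ∀ x < 0, p x = 0) {x : ℝ} (hV : 0 < V x) (y : ℝ) :
    tilt p (h x) (x + √(V x) * y) = laplaceIntegrand p g h V c x y /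
      (√(V x) * ∫ y, laplaceIntegrand p g h V c x y) := by
  have hσ := Real.sqrt_pos.2 hV
  rw [integral_laplaceIntegrand hpz hV, tilt_comp_affine (g := g) hc, ← mul_assoc,
    mul_inv_cancel₀ hσ.ne', one_mul, div_div_eq_mul_div]
  ring

variable
  (hc : 0 < c) (hpdef : ∀ x ≥ (0:ℝ), p x = c * Real.exp (-(g x - q x)))
  (H : HasSlowScale h V V') (hg : ∀ x, HasDerivAt g (h x) x)
  (hq0 : Tendsto q atTop (𝓝 0))
  (hpz : ∀ x < 0, p x = 0) (hpdens : (∫ x in Set.Ici (0:ℝ), p x) = 1)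
  (hlim : Tendsto h atTop atTop)
  (hPhi : ∀ t > (0:ℝ), IntegrableOn (fun x => Real.exp (t * x) * p x) (Set.Ici 0))

include hc hpdef hpz in
lemma density_nonneg (x : ℝ) : 0 ≤ p x := by
  rcases lt_or_ge x 0 with h1 | h1
  · rw [hpz _ h1]
  · rw [hpdef _ h1]; positivity

include hc hpdef H hpz hpdens hPhi

lemma eventually_integrable_pow_mul_laplaceIntegrand (k : ℕ) :
    ∀ᶠ x in atTop, Integrable fun y => y ^ k * laplaceIntegrand p g h V c x y := by
  filter_upwards [H.1] with x hx
  have hσ := Real.sqrt_pos.2 hx.1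
  have h1 := (integrable_pow_mul_comp_affine (fun k => integrable_pow_mul_exp_density
    (density_nonneg hc hpdef hpz) hpz hpdens hPhi k (h x)) x hσ.ne' k).div_const
    (c * Real.exp (h x * x - g x))
  refine h1.congr (Eventually.of_forall fun y => ?_)
  simp only [laplaceIntegrand, mul_div_assoc]

include hg hq0 hlim

lemma tendsto_integral_pow_mul_laplaceIntegrand (k : ℕ) :
    Tendsto (fun x => ∫ y, y ^ k * laplaceIntegrand p g h V c x y) atTop
      (𝓝 (gaussMoment k)) := by
  have h1 := tendsto_integral_abs_laplaceIntegrand_sub hc hpdef H hg hq0 hpz hpdens hlim hPhi k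
  rw [tendsto_iff_dist_tendsto_zero]
  refine squeeze_zero' (Eventually.of_forall fun x => dist_nonneg) ?_ h1
  filter_upwards [eventually_integrable_pow_mul_laplaceIntegrand hc hpdef H hpz hpdens hPhi k]
    with x hx
  rw [Real.dist_eq, gaussMoment, ← integral_sub hx (integrable_pow_mul_gauss k)]
  refine (abs_integral_le_integral_abs).trans_eq ?_
  simp only [← mul_sub, abs_mul, abs_pow]

lemma tendsto_integral_laplaceIntegrand :
    Tendsto (fun x => ∫ y, laplaceIntegrand p g h V c x y) atTop (𝓝 (√(2 * π))) := by
  have := tendsto_integral_pow_mul_laplaceIntegrand hc hpdef H hg hq0 hpz hpdens hlim hPhi 0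
  rw [gaussMoment_zero] at this
  simpa using this

lemma tendsto_mFun_sub_div :
    Tendsto (fun x => (mFun p (h x) - x) / √(V x)) atTop (𝓝 0) := by
  have hp0 := density_nonneg hc hpdef hpz
  have hI := tendsto_integral_pow_mul_laplaceIntegrand hc hpdef H hg hq0 hpz hpdens hlim hPhi
  have hI0 := tendsto_integral_laplaceIntegrand hc hpdef H hg hq0 hpz hpdens hlim hPhi
  have h2π : 0 < √(2 * π) := by positivity
  have h1 := (hI 1).div hI0 h2π.ne'
  rw [gaussMoment_eq_zero_of_odd (by decide), zero_div] at h1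
  refine h1.congr' ?_
  filter_upwards [H.1, hI0.eventually (lt_mem_nhds h2π),
    eventually_integrable_pow_mul_laplaceIntegrand hc hpdef H hpz hpdens hPhi 0,
    eventually_integrable_pow_mul_laplaceIntegrand hc hpdef H hpz hpdens hPhi 1]
    with x hx hx0 hi0 hi1
  have hσ := Real.sqrt_pos.2 hx.1
  have h2 := integral_tilt_smul (h := h) (g := g) (c := c) hc hpz hx.1 (fun w => w)
  simp only [pow_zero, one_mul, pow_one] at hi0 hi1
  have h3 : mFun p (h x) = ∫ w, tilt p (h x) w • w := by
    rw [mFun_eq_div hp0 hpz hpdens hPhi, ← integral_div]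
    congr 1; ext w
    rw [tilt, smul_eq_mul]; ring
  have h4 : ∫ y, laplaceIntegrand p g h V c x y • (x + √(V x) * y) =
      x * (∫ y, laplaceIntegrand p g h V c x y) +
        √(V x) * ∫ y, y * laplaceIntegrand p g h V c x y := by
    rw [← integral_const_mul, ← integral_const_mul,
      ← integral_add (hi0.const_mul _) (hi1.const_mul _)]
    congr 1; ext y
    rw [smul_eq_mul]; ring
  rw [h3, h2, h4, smul_eq_mul]
  simp only [pow_one, Pi.div_apply]
  field_simp
  ring

lemma tendsto_sqrt_s2Fun_div :
    Tendsto (fun x => √(s2Fun p (h x)) / √(V x)) atTop (𝓝 1) := by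
  have hp0 := density_nonneg hc hpdef hpz
  have hI := tendsto_integral_pow_mul_laplaceIntegrand hc hpdef H hg hq0 hpz hpdens hlim hPhi
  have hI0 := tendsto_integral_laplaceIntegrand hc hpdef H hg hq0 hpz hpdens hlim hPhi
  have hμ := tendsto_mFun_sub_div hc hpdef H hg hq0 hpz hpdens hlim hPhi
  have h2π : 0 < √(2 * π) := by positivity
  have h1 := ((tendsto_integral_standardized (n := 2)
    (eventually_integrable_pow_mul_laplaceIntegrand hc hpdef H hpz hpdens hPhi) hI hμ
    tendsto_const_nhds).div hI0 h2π.ne').sqrt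
  rw [gaussMoment_two, div_self h2π.ne', Real.sqrt_one] at h1
  refine h1.congr' ?_
  filter_upwards [H.1, hI0.eventually (lt_mem_nhds h2π)] with x hx hx0
  have hσ := Real.sqrt_pos.2 hx.1
  have h2 := integral_tilt_smul (h := h) (g := g) (c := c) hc hpz hx.1
    (fun w => (w - mFun p (h x)) ^ 2)
  have h3 : s2Fun p (h x) = ∫ w, tilt p (h x) w • (w - mFun p (h x)) ^ 2 := by
    rw [s2Fun_eq_div hp0 hpz hpdens hPhi, ← integral_div]
    congr 1; ext w
    rw [tilt, smul_eq_mul]; ring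
  have h4 : ∫ y, laplaceIntegrand p g h V c x y • (x + √(V x) * y - mFun p (h x)) ^ 2 =
      V x * ∫ y, ((y - (mFun p (h x) - x) / √(V x)) / 1) ^ 2 * laplaceIntegrand p g h V c x y := by
    rw [← integral_const_mul]
    congr 1; ext y
    have e : x + √(V x) * y - mFun p (h x) =
        √(V x) * ((y - (mFun p (h x) - x) / √(V x)) / 1) := by
      field_simp
      ring
    rw [smul_eq_mul, e, mul_pow, Real.sq_sqrt hx.1.le]
    ring
  rw [← Real.sqrt_div' _ hx.1.le, h3, h2, h4, smul_eq_mul]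
  congr 1
  rw [Pi.div_apply, mul_left_comm, mul_div_cancel_left₀ _ hx.1.ne', div_eq_inv_mul]

end Standardization

/-- Quantitative regularity of the tilted density at the parameter `t`: a bounded part above `K`
carrying a fixed amount of mass, small third and bounded fourth standardized moments, and a
standardized characteristic function bounded away from `1` outside a neighbourhood of the origin. -/
structure TiltRegular (p : ℝ → ℝ) (C M θ K η t : ℝ) : Prop where
  s2_pos : 0 < √(s2Fun p t)
  le_mFun : K ≤ mFun p t
  tilt_le : ∀ w ≥ K, tilt p t w ≤ M / √(s2Fun p t)
  mass_le : ∫ w in Iio K, tilt p t w ≤ θ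
  third_le : |∫ w, ((w - mFun p t) / √(s2Fun p t)) ^ 3 * tilt p t w| ≤ η
  fourth_le : ∫ w, ((w - mFun p t) / √(s2Fun p t)) ^ 4 * tilt p t w ≤ C
  char_le : ∀ ζ : ℝ, 1 / (8 * C) ≤ |ζ| →
    ‖∫ w, Complex.exp ((-ζ * ((w - mFun p t) / √(s2Fun p t)) : ℝ) * Complex.I) *
      (tilt p t w : ℂ)‖ ≤ θ

section Regular

variable {p g h V q V' : ℝ → ℝ} {c : ℝ}
  (hc : 0 < c) (hpdef : ∀ x ≥ (0:ℝ), p x = c * Real.exp (-(g x - q x)))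
  (H : HasSlowScale h V V') (hg : ∀ x, HasDerivAt g (h x) x)
  (hq0 : Tendsto q atTop (𝓝 0))
  (hpz : ∀ x < 0, p x = 0) (hpdens : (∫ x in Set.Ici (0:ℝ), p x) = 1)
  (hlim : Tendsto h atTop atTop)
  (hPhi : ∀ t > (0:ℝ), IntegrableOn (fun x => Real.exp (t * x) * p x) (Set.Ici 0))

include hc hpdef H hg hq0 hpz hpdens hlim hPhi

lemma tendsto_integral_standardized_tilt (n : ℕ) :
    Tendsto (fun x => ∫ w, ((w - mFun p (h x)) / √(s2Fun p (h x))) ^ n * tilt p (h x) w) atTop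
      (𝓝 (gaussMoment n / √(2 * π))) := by
  have hI := tendsto_integral_pow_mul_laplaceIntegrand hc hpdef H hg hq0 hpz hpdens hlim hPhi
  have hI0 := tendsto_integral_laplaceIntegrand hc hpdef H hg hq0 hpz hpdens hlim hPhi
  have hμ := tendsto_mFun_sub_div hc hpdef H hg hq0 hpz hpdens hlim hPhi
  have hr := tendsto_sqrt_s2Fun_div hc hpdef H hg hq0 hpz hpdens hlim hPhi
  have h2π : 0 < √(2 * π) := by positivity
  refine ((tendsto_integral_standardized (n := n)
    (eventually_integrable_pow_mul_laplaceIntegrand hc hpdef H hpz hpdens hPhi) hI hμ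
    hr).div hI0 h2π.ne').congr' ?_
  filter_upwards [H.1] with x hx
  have hσ := Real.sqrt_pos.2 hx.1
  have h1 := integral_tilt_smul (h := h) (g := g) (c := c) hc hpz hx.1
    (fun w => ((w - mFun p (h x)) / √(s2Fun p (h x))) ^ n)
  simp only [smul_eq_mul, mul_comm (tilt p (h x) _)] at h1
  rw [h1, Pi.div_apply, div_eq_inv_mul]
  congr 2
  ext y
  rw [mul_comm]
  congr 2
  rw [sub_div' hσ.ne', div_div_div_cancel_right₀ hσ.ne']
  congr 1
  ring

lemma eventually_char_le {κ : ℝ} (hκ : 0 < κ) :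
    ∃ θ : ℝ, 0 ≤ θ ∧ θ < 1 ∧ ∀ᶠ x in atTop, ∀ ζ : ℝ, κ ≤ |ζ| →
      ‖∫ w, Complex.exp ((-ζ * ((w - mFun p (h x)) / √(s2Fun p (h x))) : ℝ) * Complex.I) *
        (tilt p (h x) w : ℂ)‖ ≤ θ := by
  have hI0 := tendsto_integral_laplaceIntegrand hc hpdef H hg hq0 hpz hpdens hlim hPhi
  have hr := tendsto_sqrt_s2Fun_div hc hpdef H hg hq0 hpz hpdens hlim hPhi
  have hA := tendsto_integral_abs_laplaceIntegrand_sub hc hpdef H hg hq0 hpz hpdens hlim hPhi 0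
  simp only [pow_zero, one_mul] at hA
  have h2π : 0 < √(2 * π) := by positivity
  set ρ : ℝ := Real.exp (-(κ ^ 2 / 8)) with hρ
  have hρ1 : ρ < 1 := by
    rw [hρ, Real.exp_lt_one_iff]
    have : 0 < κ ^ 2 / 8 := by positivity
    linarith
  have hρ0 : 0 < ρ := Real.exp_pos _
  have hb := ((hA.const_add (√(2 * π) * ρ)).div hI0 h2π.ne')
  rw [add_zero, mul_div_cancel_left₀ _ h2π.ne'] at hb
  refine ⟨(1 + ρ) / 2, by linarith, by linarith, ?_⟩
  have hi0 := eventually_integrable_pow_mul_laplaceIntegrand hc hpdef H hpz hpdens hPhi 0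
  simp only [pow_zero, one_mul] at hi0
  filter_upwards [hb.eventually (gt_mem_nhds (by linarith : ρ < (1 + ρ) / 2)),
    H.1, hI0.eventually (lt_mem_nhds h2π), hr.eventually (Ioo_mem_nhds (a := 0) (b := 2)
      (by norm_num) (by norm_num)), hi0] with x hbx hx hx0 hrx hix ζ hζ
  have hσ := Real.sqrt_pos.2 hx.1
  set σ := √(V x)
  set m := mFun p (h x)
  set s := √(s2Fun p (h x))
  have hs : 0 < s := by
    have := mul_pos hrx.1 hσ
    rwa [div_mul_cancel₀ _ hσ.ne'] at this
  have h1 := integral_tilt_smul (h := h) (g := g) (c := c) hc hpz hx.1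
    (fun w => Complex.exp ((-ζ * ((w - m) / s) : ℝ) * Complex.I))
  have e1 : ∀ w, Complex.exp ((-ζ * ((w - m) / s) : ℝ) * Complex.I) * (tilt p (h x) w : ℂ) =
      tilt p (h x) w • Complex.exp ((-ζ * ((w - m) / s) : ℝ) * Complex.I) := fun w => by
    rw [Complex.real_smul, mul_comm]
  simp only [e1]
  rw [h1, norm_smul, norm_inv, Real.norm_of_nonneg hx0.le, ← div_eq_inv_mul]
  refine le_trans ?_ hbx.le
  simp only [Pi.div_apply]
  gcongr
  -- compare with the Gaussian characteristic function
  set ω : ℝ := -ζ * σ / s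
  set a : ℝ := -ζ * (x - m) / s
  have e2 : ∀ y, -ζ * ((x + √(V x) * y - m) / s) = ω * y + a := fun y => by
    change -ζ * ((x + σ * y - m) / s) = _
    simp only [ω, a]; field_simp; ring
  have hgauss := norm_integral_cexp_mul_gauss ω a
  have hgi : Integrable fun y : ℝ => Real.exp (-(y ^ 2 / 2)) := by
    simpa using integrable_pow_mul_gauss 0
  have hcont : ∀ f : ℝ → ℝ, Integrable f →
      Integrable fun y => f y • Complex.exp ((ω * y + a : ℝ) * Complex.I) := fun f hf => by
    refine (hf.norm).mono' (hf.1.smul (Continuous.aestronglyMeasurable (by fun_prop)))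
      (Eventually.of_forall fun y => ?_)
    rw [norm_smul, Complex.norm_exp_ofReal_mul_I, mul_one]
  have e4 : ∫ y, laplaceIntegrand p g h V c x y •
        Complex.exp ((-ζ * ((x + √(V x) * y - m) / s) : ℝ) * Complex.I) =
      ∫ y, laplaceIntegrand p g h V c x y • Complex.exp ((ω * y + a : ℝ) * Complex.I) := by
    congr 1; ext y
    rw [e2]
  have e3 : ∫ y, laplaceIntegrand p g h V c x y • Complex.exp ((ω * y + a : ℝ) * Complex.I) =
      (∫ y : ℝ, (Real.exp (-(y ^ 2 / 2)) : ℂ) * Complex.exp ((ω * y + a : ℝ) * Complex.I)) +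
      ∫ y, (laplaceIntegrand p g h V c x y - Real.exp (-(y ^ 2 / 2))) •
        Complex.exp ((ω * y + a : ℝ) * Complex.I) := by
    have h1 := integral_add (hcont _ hgi) (hcont _ (hix.sub hgi))
    simp only [Pi.sub_apply, ← add_smul, add_sub_cancel] at h1
    rw [h1]
    simp only [Complex.real_smul]
  rw [e4, e3]
  refine (norm_add_le _ _).trans (add_le_add ?_ ?_)
  · rw [hgauss]
    have hω : κ ^ 2 / 4 ≤ ω ^ 2 := by
      have h3 : κ / 2 ≤ |ω| := by
        have h4 : s < 2 * σ := (div_lt_iff₀ hσ).1 hrx.2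
        simp only [ω]
        rw [abs_div, abs_mul, abs_neg, abs_of_pos hσ, abs_of_pos hs, le_div_iff₀ hs]
        nlinarith
      calc κ ^ 2 / 4 = (κ / 2) ^ 2 := by ring
        _ ≤ |ω| ^ 2 := by gcongr
        _ = ω ^ 2 := sq_abs ω
    exact mul_le_mul_of_nonneg_left (Real.exp_le_exp.2 (by linarith)) h2π.le
  · refine (norm_integral_le_integral_norm _).trans_eq ?_
    congr 1; ext y
    rw [norm_smul, Complex.norm_exp_ofReal_mul_I, mul_one, Real.norm_eq_abs]

lemma exists_eventually_tiltRegular : ∃ C M θ K : ℝ, 1 ≤ C ∧ 0 ≤ M ∧ 0 ≤ θ ∧ θ < 1 ∧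
    ∀ η > 0, ∀ᶠ x in atTop, TiltRegular p C M θ K η (h x) := by
  have hI0 := tendsto_integral_laplaceIntegrand hc hpdef H hg hq0 hpz hpdens hlim hPhi
  have hμ := tendsto_mFun_sub_div hc hpdef H hg hq0 hpz hpdens hlim hPhi
  have hr := tendsto_sqrt_s2Fun_div hc hpdef H hg hq0 hpz hpdens hlim hPhi
  have hst := tendsto_integral_standardized_tilt hc hpdef H hg hq0 hpz hpdens hlim hPhi
  have h2π : 0 < √(2 * π) := by positivity
  have h2π1 : 1 < √(2 * π) := by
    rw [Real.lt_sqrt (by norm_num)]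
    linarith [Real.pi_gt_three]
  obtain ⟨K₀, hK₀⟩ := tendsto_integral_laplaceIntegrand_Iio hc hpdef H hg hpz hpdens hlim 0
  obtain ⟨K₁, hK₁⟩ := eventually_laplaceIntegrand_le hc hpdef H hg hq0
  set K := max K₀ K₁
  have htail := (hK₀ K (le_max_left _ _)).div hI0 h2π.ne'
  rw [zero_div] at htail
  have hdom := hK₁ K (le_max_right _ _)
  set C : ℝ := max 1 (gaussMoment 4 / √(2 * π) + 1) with hC
  have hC1 : 1 ≤ C := le_max_left _ _
  obtain ⟨θ, hθ0, hθ1, hθ⟩ := eventually_char_le hc hpdef H hg hq0 hpz hpdens hlim hPhi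
    (κ := 1 / (8 * C)) (by positivity)
  refine ⟨C, Real.exp (5 / 4) * 2, max θ (1 / 2), K, hC1, by positivity, by positivity,
    max_lt hθ1 (by norm_num), fun η hη => ?_⟩
  have h3 := (hst 3).abs
  rw [gaussMoment_eq_zero_of_odd (by decide), zero_div, abs_zero] at h3
  filter_upwards [hθ, hdom, H.1, hI0.eventually (lt_mem_nhds h2π1),
    htail.eventually (gt_mem_nhds (show (0 : ℝ) < 1 / 2 by norm_num)),
    hr.eventually (Ioo_mem_nhds (a := 0) (b := 2) (by norm_num) (by norm_num)),
    hμ.eventually (Ioo_mem_nhds (a := -1) (b := 1) (by norm_num) (by norm_num)),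
    H.eventually_half_le 1, eventually_ge_atTop (2 * K), h3.eventually (gt_mem_nhds hη),
    (hst 4).eventually (gt_mem_nhds (lt_add_one _))]
    with x hx1 hx2 hx3 hx4 hx5 hx6 hx7 hx8 hx9 hx10 hx11
  have hσ := Real.sqrt_pos.2 hx3.1
  have hs : 0 < √(s2Fun p (h x)) := by
    have := mul_pos hx6.1 hσ
    rwa [div_mul_cancel₀ _ hσ.ne'] at this
  refine ⟨hs, ?_, fun w hw => ?_, ?_, hx10.le, hx11.le.trans (le_max_right _ _),
    fun ζ hζ => (hx1 ζ hζ).trans (le_max_left _ _)⟩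
  · have := hx8 (mFun p (h x)) (by
      rw [one_mul, abs_le]
      have h4 := (lt_div_iff₀ hσ).1 hx7.1
      have h5 := (div_lt_iff₀ hσ).1 hx7.2
      constructor <;> linarith)
    linarith
  · obtain ⟨y, rfl⟩ : ∃ y, w = x + √(V x) * y := ⟨(w - x) / √(V x), by field_simp; ring⟩
    rw [tilt_eq (g := g) hc hpz hx3.1]
    have h4 : √(s2Fun p (h x)) < 2 * √(V x) := (div_lt_iff₀ hσ).1 hx6.2
    have h5 : laplaceIntegrand p g h V c x y ≤ Real.exp (5 / 4) := by
      refine (hx2 y hw).trans (mul_le_of_le_one_right (Real.exp_pos _).le ?_)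
      rw [Real.exp_le_one_iff]
      linarith [abs_nonneg y]
    rw [div_le_div_iff₀ (by positivity) hs]
    calc laplaceIntegrand p g h V c x y * √(s2Fun p (h x))
        ≤ Real.exp (5 / 4) * (2 * √(V x)) := by
          refine mul_le_mul h5 h4.le hs.le (Real.exp_pos _).le
      _ ≤ Real.exp (5 / 4) * (2 * √(V x)) * ∫ y, laplaceIntegrand p g h V c x y :=
          le_mul_of_one_le_right (by positivity) hx4.le
      _ = _ := by ring
  · refine le_trans (le_of_eq ?_) (hx5.le.trans (le_max_right _ _))
    have h4 := integral_tilt_smul (h := h) (g := g) (c := c) hc hpz hx3.1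
      ((Iio K).indicator fun _ => (1 : ℝ))
    have e1 : ∀ w, tilt p (h x) w • (Iio K).indicator (fun _ => (1 : ℝ)) w =
        (Iio K).indicator (tilt p (h x)) w := fun w => by simp [indicator_apply]
    simp only [e1] at h4
    rw [integral_indicator measurableSet_Iio] at h4
    rw [h4]
    rw [Pi.div_apply, div_eq_inv_mul]
    congr 2
    ext y
    simp [indicator_apply]

lemma exists_eventually_atTop_tiltRegular : ∃ C M θ K : ℝ, 1 ≤ C ∧ 0 ≤ M ∧ 0 ≤ θ ∧ θ < 1 ∧
    ∀ η > 0, ∀ᶠ t in atTop, TiltRegular p C M θ K η t := by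
  obtain ⟨C, M, θ, K, hC, hM, hθ0, hθ1, hreg⟩ :=
    exists_eventually_tiltRegular hc hpdef H hg hq0 hpz hpdens hlim hPhi
  refine ⟨C, M, θ, K, hC, hM, hθ0, hθ1, fun η hη => ?_⟩
  obtain ⟨X, hX⟩ := eventually_atTop.1 ((hreg η hη).and H.1)
  filter_upwards [eventually_ge_atTop (h X)] with t ht
  have hcont : ContinuousOn h (Ici X) := fun x hx =>
    (hX x hx).2.2.1.continuousAt.continuousWithinAt
  obtain ⟨Y, hY, hXY⟩ := ((hlim.eventually_ge_atTop t).and (eventually_ge_atTop X)).exists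
  obtain ⟨x, hx, rfl⟩ := intermediate_value_Icc hXY (hcont.mono Icc_subset_Ici_self) ⟨ht, hY⟩
  exact (hX x hx.1).1

end Regular

/-- Splitting of a nonnegative integrable function that is bounded on `[K, ∞)` into measurable
parts below and above `K`. -/
lemma exists_measurable_split {f : ℝ → ℝ} {K B : ℝ} (hf : Integrable f) (hf0 : ∀ x, 0 ≤ f x)
    (hB : ∀ x ≥ K, f x ≤ B) : ∃ u v : ℝ → ENNReal, Measurable u ∧ Measurable v ∧
      (∀ᵐ x, (u x + v x).toReal = f x) ∧ ∫⁻ x, (u x + v x) = ENNReal.ofReal (∫ x, f x) ∧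
      (∀ x, v x ≤ ENNReal.ofReal B) ∧ (∀ x, K ≤ x → u x = 0) ∧
      (∫⁻ x, u x).toReal = ∫ x in Iio K, f x := by
  set f' := hf.1.mk f
  have hf'm : Measurable f' := hf.1.stronglyMeasurable_mk.measurable
  have hff' : f =ᵐ[volume] f' := hf.1.ae_eq_mk
  set e : ℝ → ENNReal := fun x => ENNReal.ofReal (f' x)
  have he : Measurable e := ENNReal.measurable_ofReal.comp hf'm
  have hsum : ∀ᵐ x, (Iio K).indicator e x +
      (Ici K).indicator (fun x => min (e x) (ENNReal.ofReal B)) x = ENNReal.ofReal (f x) := by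
    filter_upwards [hff'] with x hx
    rcases lt_or_ge x K with h | h
    · simp [h, not_le.2 h, e, hx]
    · simp only [indicator_apply, mem_Iio, not_lt.2 h, if_false, mem_Ici, h, if_true, zero_add, e]
      rw [← hx, min_eq_left (ENNReal.ofReal_le_ofReal (hB x h))]
  refine ⟨(Iio K).indicator e, (Ici K).indicator fun x => min (e x) (ENNReal.ofReal B),
    he.indicator measurableSet_Iio, (he.min measurable_const).indicator measurableSet_Ici,
    ?_, ?_, fun x => ?_, fun x hx => ?_, ?_⟩
  · filter_upwards [hsum] with x hx
    rw [hx, ENNReal.toReal_ofReal (hf0 x)]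
  · rw [lintegral_congr_ae hsum,
      ofReal_integral_eq_lintegral_ofReal hf (Eventually.of_forall hf0)]
  · by_cases h : K ≤ x <;> simp [h]
  · simp [hx]
  · rw [lintegral_indicator measurableSet_Iio, integral_eq_lintegral_of_nonneg_ae
      (Eventually.of_forall hf0) hf.1.restrict]
    congr 1
    refine lintegral_congr_ae ?_
    filter_upwards [ae_restrict_of_ae hff'] with x hx
    simp only [e, hx]

section TiltedLimit

variable {p : ℝ → ℝ} (hp0 : ∀ x, 0 ≤ p x) (hpz : ∀ x < 0, p x = 0)
  (hpdens : (∫ x in Set.Ici (0:ℝ), p x) = 1)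
  (hPhi : ∀ t > (0:ℝ), IntegrableOn (fun x => Real.exp (t * x) * p x) (Set.Ici 0))

include hp0 hpz hpdens hPhi

lemma integrable_pow_mul_tilt (k : ℕ) (t : ℝ) : Integrable fun x => x ^ k * tilt p t x := by
  have := (integrable_pow_mul_exp_density hp0 hpz hpdens hPhi k t).div_const (mgfFun p t)
  simpa only [tilt, mul_div_assoc] using this

lemma integral_tilt (t : ℝ) : ∫ x, tilt p t x = 1 := by
  simp only [tilt, integral_div]
  rw [← mgfFun_eq_integral hpz, div_self (mgfFun_pos hp0 hpz hpdens hPhi t).ne']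

lemma integral_mul_tilt (t : ℝ) : ∫ x, x * tilt p t x = mFun p t := by
  rw [mFun_eq_div hp0 hpz hpdens hPhi, ← integral_div]
  simp only [tilt, mul_div_assoc]

lemma integral_sub_sq_mul_tilt (t : ℝ) :
    ∫ x, (x - mFun p t) ^ 2 * tilt p t x = s2Fun p t := by
  rw [s2Fun_eq_div hp0 hpz hpdens hPhi, ← integral_div]
  simp only [tilt, mul_div_assoc]

lemma exists_tiltRegular_abs_convPow_sub_one_le {C M θ K : ℝ} (hC : 1 ≤ C) (hM : 0 ≤ M)
    (hθ0 : 0 ≤ θ) (hθ1 : θ < 1) {δ : ℝ} (hδ : 0 < δ) :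
    ∃ η > 0, ∃ n₀ : ℕ, ∀ t, TiltRegular p C M θ K η t → ∀ n ≥ n₀,
      √(n + 2) * |√(2 * π) * √(n + 2) * √(s2Fun p t) *
        convPow (tilt p t) (n + 2) ((n + 2) * mFun p t) - 1| ≤ δ := by
  obtain ⟨η, hη, n₀, hmain⟩ := exists_abs_sqrt_mul_ePow_sub_one_le hC hM hθ0 hθ1 hδ
  refine ⟨η, hη, n₀, fun t ht n hn => ?_⟩
  set m := mFun p t
  set s := √(s2Fun p t)
  have hs : 0 < s := ht.s2_pos
  have hpow := fun k => integrable_pow_mul_tilt hp0 hpz hpdens hPhi k t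
  have h_int : Integrable (tilt p t) := by simpa using hpow 0
  have hf0 : ∀ x, 0 ≤ tilt p t x := fun x =>
    div_nonneg (mul_nonneg (Real.exp_pos _).le (hp0 x)) (mgfFun_pos hp0 hpz hpdens hPhi t).le
  obtain ⟨u, v, hu, hv, huv, hone, hvB, huK, hmass⟩ := exists_measurable_split h_int hf0 ht.tilt_le
  rw [integral_tilt hp0 hpz hpdens hPhi, ENNReal.ofReal_one] at hone
  have hstd : ∀ k : ℕ, Integrable fun x => ((x - m) / s) ^ k * tilt p t x := fun k => by
    have := integrable_affine_pow_mul hpow (1 / s) (-m / s) k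
    refine this.congr (Eventually.of_forall fun x => ?_)
    simp only
    congr 2
    ring
  have hcongr : ∀ k : ℕ, (fun x => ((x - m) / s) ^ k * (u x + v x).toReal) =ᵐ[volume]
      fun x => ((x - m) / s) ^ k * tilt p t x := fun k => by
    filter_upwards [huv] with x hx
    rw [hx]
  rw [convPow_eq_toReal_ePow (hu.add hv) (huv.mono fun x hx => hx.symm)
    (by simp only [Pi.add_apply]; rw [hone]; exact ENNReal.one_ne_top)]
  refine hmain u v m s K hu hv hone hs hvB huK ht.le_mFun (hmass.trans_le ht.mass_le)
    (fun k _ => (hstd k).congr (hcongr k).symm) ?_ ?_ ?_ ?_ (fun ζ hζ => ?_) n hn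
  · have h1 := integral_congr_ae (hcongr 1)
    simp only [pow_one] at h1
    rw [h1]
    have h2 : ∀ x, (x - m) / s * tilt p t x = (x * tilt p t x - m * tilt p t x) / s := fun x => by
      ring
    simp only [h2]
    rw [integral_div, integral_sub (by simpa using hpow 1) (h_int.const_mul m),
      integral_mul_tilt hp0 hpz hpdens hPhi, integral_const_mul,
      integral_tilt hp0 hpz hpdens hPhi, mul_one, sub_self, zero_div]
  · rw [integral_congr_ae (hcongr 2)]
    have h2 : ∀ x, ((x - m) / s) ^ 2 * tilt p t x = (x - m) ^ 2 * tilt p t x / s ^ 2 := fun x => by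
      ring
    simp only [h2]
    rw [integral_div, integral_sub_sq_mul_tilt hp0 hpz hpdens hPhi,
      Real.sq_sqrt (Real.sqrt_pos.1 hs).le, div_self (Real.sqrt_pos.1 hs).ne']
  · rw [integral_congr_ae (hcongr 3)]
    exact ht.third_le
  · rw [integral_congr_ae (hcongr 4)]
    exact ht.fourth_le
  · refine le_trans (le_of_eq ?_) (ht.char_le ζ hζ)
    congr 1
    refine integral_congr_ae ?_
    filter_upwards [huv] with x hx
    rw [hx]

lemma density_ratio_eq {t u : ℝ} (hu : mFun p t = u) {n : ℕ} (hn : 0 < n) :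
    (n : ℝ) * convPow p n ((n : ℝ) * u) /
      (√n * Real.exp (-((n : ℝ) * (u * t - Real.log (mgfFun p t)))) /
        (√(2 * π) * √(s2Fun p t))) =
    √(2 * π) * √n * √(s2Fun p t) * convPow (tilt p t) n ((n : ℝ) * mFun p t) := by
  have hΦ := mgfFun_pos hp0 hpz hpdens hPhi t
  obtain ⟨k, rfl⟩ := Nat.exists_eq_succ_of_ne_zero hn.ne'
  rw [Nat.succ_eq_add_one, convPow_tilt, hu]
  have hsq : √((k + 1 : ℕ) : ℝ) * √((k + 1 : ℕ) : ℝ) = ((k + 1 : ℕ) : ℝ) :=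
    Real.mul_self_sqrt (Nat.cast_nonneg _)
  have hsq0 : 0 < √((k + 1 : ℕ) : ℝ) := Real.sqrt_pos.2 (by positivity)
  set N : ℝ := ((k + 1 : ℕ) : ℝ)
  have he : Real.exp (-(N * (u * t - Real.log (mgfFun p t)))) =
      mgfFun p t ^ (k + 1) / Real.exp (t * (N * u)) := by
    rw [← Real.exp_log (pow_pos hΦ (k + 1)), ← Real.exp_sub, Real.log_pow]
    congr 1
    ring
  rw [he, div_div_eq_mul_div]
  nth_rewrite 1 [← hsq]
  have := Real.exp_pos (t * (N * u))
  have := pow_pos hΦ (k + 1)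
  field_simp

end TiltedLimit

lemma tendsto_perturbation_zero {q h : ℝ → ℝ} (hlim : Tendsto h atTop atTop)
    (hq : ∃ ϑ > (0:ℝ), ∀ᶠ x in atTop, ∀ v, |v - x| < ϑ * x →
      |q v| ≤ 1 / Real.sqrt (x * h x)) : Tendsto q atTop (𝓝 0) := by
  obtain ⟨ϑ, hϑ, hq⟩ := hq
  have h1 : Tendsto (fun x => 1 / √(x * h x)) atTop (𝓝 0) := by
    simp only [one_div]
    exact (Real.tendsto_sqrt_atTop.comp (tendsto_id.atTop_mul_atTop₀ hlim)).inv_tendsto_atTop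
  refine squeeze_zero_norm' ?_ h1
  filter_upwards [hq, eventually_gt_atTop 0] with x hx hx0
  exact hx x (by rw [sub_self, abs_zero]; positivity)

end Auxiliary

/-- **uniform density estimate above `aₙ`.** If `aₙ → ∞`,
`tₙ = m⁻¹(aₙ)` and `ψ(tₙ)²/(√n ψ'(tₙ)) → 0`, then with
`I(u) = u m⁻¹(u) - log Φ(m⁻¹(u))` and `Hₙ(u) = √n exp(-n I(u))/(√(2π) s(m⁻¹(u)))`,
the density of `Sₙ/n` at `u`, namely `n p^{*n}(n u)`, satisfies uniformly in `u > aₙ`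
that its ratio to `Hₙ(u)` is `1 + o(1/√n)`. -/
theorem density_ratio_uniform_above
    (p g q h : ℝ → ℝ) (c : ℝ) (hc : 0 < c)
    (hpdef : ∀ x ≥ (0:ℝ), p x = c * Real.exp (-(g x - q x)))
    (hpzero : ∀ x < (0:ℝ), p x = 0)
    (hpdens : (∫ x in Set.Ici (0:ℝ), p x) = 1)
    (hgpos : ∀ x ≥ (0:ℝ), 0 < g x)
    (hglim : Tendsto (fun x => g x / x) atTop atTop)
    (hgderiv : ∀ x, HasDerivAt g (h x) x)
    (hq : ∃ ϑ > (0:ℝ), ∀ᶠ x in atTop, ∀ v, |v - x| < ϑ * x → |q v| ≤ 1 / Real.sqrt (x * h x))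
    (hmem : MemFrakR h)
    (hPhi : ∀ t > (0:ℝ), IntegrableOn (fun x => Real.exp (t * x) * p x) (Set.Ici 0))
    (a : ℕ → ℝ) (ha : Tendsto a atTop atTop)
    (minv : ℝ → ℝ) (hminv : ∀ᶠ n : ℕ in atTop, ∀ u ≥ a n, mFun p (minv u) = u)
    (hgrowth : Tendsto
      (fun n : ℕ =>
        geninv h (minv (a n)) ^ 2 / (Real.sqrt n * deriv (geninv h) (minv (a n))))
      atTop (𝓝 0)) :
    ∀ ε > (0:ℝ), ∀ᶠ n : ℕ in atTop, ∀ u > a n,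
      |(n : ℝ) * convPow p n ((n : ℝ) * u) /
          (Real.sqrt n * Real.exp (-((n : ℝ) * (u * minv u - Real.log (mgfFun p (minv u))))) /
            (Real.sqrt (2 * Real.pi) * Real.sqrt (s2Fun p (minv u)))) - 1| ≤
        ε / Real.sqrt n := by
  intro ε hε
  obtain ⟨hlim, V, V', H⟩ := hmem.exists_hasSlowScale hglim hgderiv
  have hq0 := tendsto_perturbation_zero hlim hq
  have hp0 := density_nonneg hc hpdef hpzero
  obtain ⟨C, M, θ, K, hC, hM, hθ0, hθ1, hreg⟩ := exists_eventually_atTop_tiltRegular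
    hc hpdef H hgderiv hq0 hpzero hpdens hlim hPhi
  obtain ⟨η, hη, n₀, hmain⟩ := exists_tiltRegular_abs_convPow_sub_one_le hp0 hpzero hpdens hPhi
    (K := K) hC hM hθ0 hθ1 hε
  obtain ⟨T, hT⟩ := eventually_atTop.1 (hreg η hη)
  filter_upwards [hminv, ha.eventually_gt_atTop (mFun p T), eventually_ge_atTop (n₀ + 2)]
    with n hn haT hn₀ u hu
  have hmu := hn u hu.le
  have hTu : T < minv u := (monotone_mFun hp0 hpzero hpdens hPhi).reflect_lt
    (by rw [hmu]; exact haT.trans hu)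
  have hn0 : 0 < √(n : ℝ) := Real.sqrt_pos.2 (by exact_mod_cast (by omega : 0 < n))
  rw [density_ratio_eq hp0 hpzero hpdens hPhi hmu (by omega), le_div_iff₀ hn0, mul_comm]
  obtain ⟨k, rfl⟩ : ∃ k, n = k + 2 := ⟨n - 2, by omega⟩
  have := hmain (minv u) (hT _ hTu.le) k (by omega)
  push_cast
  exact this
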